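/- arXiv:2302.05537 — 2 statements merged into one kernel-verified Lean document; each statement's English description precedes it below -/
import Mathlib

section
/- There is an absolute constant C ≥ 1 such that for every integer N ≥ 1, every real d ≥ 1 and every set A ⊆ {1,…,N} with |A| ≥ 2^{−d}·N, the number of triples (x, y, z) ∈ A³ with x + y = 2z is at least 2^{−C·d^{12}} · N². -/
namespace KelleyMeka
open Finset
open scoped BigOperators

variable {G : Type*} [AddCommGroup G] [Fintype G]

/-- The sum convolution `w ↦ ∑ x, f x * f (w - x)`. -/
def conv (f : G → ℝ) (w : G) : ℝ := ∑ x, f x * f (w - x)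

/-- The autocorrelation `w ↦ ∑ x, f x * f (x + w)`. -/
def corr (f : G → ℝ) (w : G) : ℝ := ∑ x, f x * f (x + w)

lemma corr_sub (f : G → ℝ) (a b : G) : corr f (a - b) = ∑ x, f (x + a) * f (x + b) := by
  unfold corr
  rw [← Equiv.sum_comp (Equiv.addRight b)]
  refine sum_congr rfl fun x _ => ?_
  simp only [Equiv.coe_addRight]
  rw [mul_comm]
  congr 2
  abel

lemma conv_add_sub (f : G → ℝ) (t a b : G) :
    conv f (t + a - b) = ∑ x, f (x + a) * f (t - x - b) := by
  unfold conv
  rw [← Equiv.sum_comp (Equiv.addRight a)]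
  refine sum_congr rfl fun x _ => ?_
  simp only [Equiv.coe_addRight]
  congr 2
  abel

lemma sum_sum_sum_comm {ι κ : Type*} (J : Finset ι) (T : Finset κ) (F : ι → ι → κ → ℝ) :
    ∑ i ∈ J, ∑ j ∈ J, ∑ t ∈ T, F i j t = ∑ t ∈ T, ∑ i ∈ J, ∑ j ∈ J, F i j t := by
  rw [sum_comm (s := T)]
  exact sum_congr rfl fun i _ => sum_comm

lemma sum_corr_pow {ι : Type*} (J : Finset ι) (e : ι → G) (f : G → ℝ) (p : ℕ) :
    ∑ i ∈ J, ∑ j ∈ J, corr f (e i - e j) ^ p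
      = ∑ x : Fin p → G, (∑ i ∈ J, ∏ k, f (x k + e i)) ^ 2 := by
  simp_rw [corr_sub, Fintype.sum_pow, pow_two, sum_mul_sum, prod_mul_distrib]
  exact sum_sum_sum_comm J _ _

lemma sum_corr_pow_nonneg {ι : Type*} (J : Finset ι) (e : ι → G) (f : G → ℝ) (p : ℕ) :
    0 ≤ ∑ i ∈ J, ∑ j ∈ J, corr f (e i - e j) ^ p := by
  rw [sum_corr_pow]
  positivity

lemma sum_conv_pow_le {ι : Type*} (J : Finset ι) (e : ι → G) (f : G → ℝ) (p : ℕ) (t : G) :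
    ∑ i ∈ J, ∑ j ∈ J, conv f (t + e i - e j) ^ p
      ≤ ∑ i ∈ J, ∑ j ∈ J, corr f (e i - e j) ^ p := by
  have h1 : ∑ i ∈ J, ∑ j ∈ J, conv f (t + e i - e j) ^ p
      = ∑ x : Fin p → G, (∑ i ∈ J, ∏ k, f (x k + e i)) * (∑ j ∈ J, ∏ k, f (t - x k - e j)) := by
    simp_rw [conv_add_sub, Fintype.sum_pow, sum_mul_sum, prod_mul_distrib]
    exact sum_sum_sum_comm J _ _
  have h2 : ∑ x : Fin p → G, (∑ j ∈ J, ∏ k, f (t - x k - e j)) ^ 2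
      = ∑ i ∈ J, ∑ j ∈ J, corr f (e i - e j) ^ p := by
    have h3 : ∑ i ∈ J, ∑ j ∈ J, corr f (e i - e j) ^ p
        = ∑ i ∈ J, ∑ j ∈ J, corr f ((-e i) - (-e j)) ^ p := by
      rw [sum_comm]
      refine sum_congr rfl fun i _ => sum_congr rfl fun j _ => ?_
      congr 2; abel
    rw [h3, sum_corr_pow J (fun i => - e i),
      ← Equiv.sum_comp (Equiv.piCongrRight fun _ : Fin p => Equiv.subLeft t)]
    refine sum_congr rfl fun x _ => ?_
    simp [sub_eq_add_neg]
  have h4 := sum_corr_pow J e f p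
  rw [h1]
  have h5 : ∀ x : Fin p → G,
      (∑ i ∈ J, ∏ k, f (x k + e i)) * (∑ j ∈ J, ∏ k, f (t - x k - e j))
      ≤ ((∑ i ∈ J, ∏ k, f (x k + e i)) ^ 2 + (∑ j ∈ J, ∏ k, f (t - x k - e j)) ^ 2) / 2 := by
    intro x
    nlinarith [sq_nonneg ((∑ i ∈ J, ∏ k, f (x k + e i)) - (∑ j ∈ J, ∏ k, f (t - x k - e j)))]
  refine (sum_le_sum fun x _ => h5 x).trans ?_
  rw [← sum_div, sum_add_distrib, h2, ← h4]
  linarith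

/-- Passing from a small value of the average of `conv f` on `C` to a large `p`-norm of
the autocorrelation of `f` with respect to a positive definite weight. -/
lemma card_mul_pow_le_sum_corr_pow [DecidableEq G] {ι : Type*} (J : Finset ι) (e : ι → G)
    (f : G → ℝ) {p : ℕ} (hp : Even p) (C T : Finset G) {M : ℝ} (hM : 0 ≤ M)
    (hC : ∑ w ∈ C, conv f w ≤ -(M * #C))
    (hT : ∀ w ∈ C, ∀ i ∈ J, ∀ j ∈ J, w - e i + e j ∈ T) :
    (#J : ℝ) ^ 2 * (#C * M ^ p) ≤ #T * ∑ i ∈ J, ∑ j ∈ J, corr f (e i - e j) ^ p := by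
  have h1 : (#C : ℝ) * M ^ p ≤ ∑ w ∈ C, conv f w ^ p := by
    rcases C.eq_empty_or_nonempty with rfl | hne
    · simp
    have hc : (0 : ℝ) < #C := by exact_mod_cast hne.card_pos
    have h := Real.pow_arith_mean_le_arith_mean_pow_of_even C (fun _ => (#C : ℝ)⁻¹) (conv f)
      (fun _ _ => by positivity) (by simp [hc.ne']) hp
    rw [← mul_sum, ← mul_sum] at h
    have h3 : M ≤ -((#C : ℝ)⁻¹ * ∑ w ∈ C, conv f w) := by
      rw [← mul_neg, inv_mul_eq_div, le_div_iff₀ hc]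
      linarith
    have h4 := pow_le_pow_left₀ hM h3 p
    rw [hp.neg_pow] at h4
    have h5 := mul_le_mul_of_nonneg_left (h4.trans h) hc.le
    rwa [mul_inv_cancel_left₀ hc.ne'] at h5
  have h2 : ∀ i ∈ J, ∀ j ∈ J,
      ∑ w ∈ C, conv f w ^ p ≤ ∑ t ∈ T, conv f (t + e i - e j) ^ p := by
    intro i hi j hj
    have : ∑ w ∈ C, conv f w ^ p
        = ∑ t ∈ C.image (fun w => w - e i + e j), conv f (t + e i - e j) ^ p := by
      rw [sum_image]
      · refine sum_congr rfl fun w _ => ?_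
        congr 2; abel
      · intro a _ b _ hab
        simpa using hab
    rw [this]
    refine sum_le_sum_of_subset_of_nonneg ?_ fun _ _ _ => hp.pow_nonneg _
    intro t ht
    obtain ⟨w, hw, rfl⟩ := mem_image.1 ht
    exact hT w hw i hi j hj
  calc (#J : ℝ) ^ 2 * (#C * M ^ p) = ∑ i ∈ J, ∑ j ∈ J, (#C * M ^ p) := by
        simp [pow_two, mul_assoc]
    _ ≤ ∑ i ∈ J, ∑ j ∈ J, ∑ t ∈ T, conv f (t + e i - e j) ^ p :=
        sum_le_sum fun i hi => sum_le_sum fun j hj => h1.trans (h2 i hi j hj)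
    _ = ∑ t ∈ T, ∑ i ∈ J, ∑ j ∈ J, conv f (t + e i - e j) ^ p :=
        sum_sum_sum_comm J T _
    _ ≤ ∑ t ∈ T, ∑ i ∈ J, ∑ j ∈ J, corr f (e i - e j) ^ p :=
        sum_le_sum fun t _ => sum_conv_pow_le J e f p t
    _ = _ := by simp

/-- Unbalancing: all power sums of `corr f` are nonnegative, so a single large even one is seen
by high power sums of `1 + corr f / Q`. -/
lemma choose_mul_sum_corr_pow_le {ι : Type*} (J : Finset ι) (e : ι → G) (f : G → ℝ) (p q : ℕ)
    (hpq : p ≤ q) {Q : ℝ} (hQ : 0 < Q) :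
    (q.choose p : ℝ) * ((∑ i ∈ J, ∑ j ∈ J, corr f (e i - e j) ^ p) / Q ^ p)
      ≤ ∑ i ∈ J, ∑ j ∈ J, (1 + corr f (e i - e j) / Q) ^ q := by
  have h1 : ∑ i ∈ J, ∑ j ∈ J, (1 + corr f (e i - e j) / Q) ^ q
      = ∑ m ∈ range (q + 1), (q.choose m : ℝ) *
        ((∑ i ∈ J, ∑ j ∈ J, corr f (e i - e j) ^ m) / Q ^ m) := by
    simp_rw [add_comm (1 : ℝ), add_pow, sum_div, mul_sum]
    simp_rw [sum_comm (s := J) (t := range (q + 1))]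
    refine sum_congr rfl fun m _ => sum_congr rfl fun i _ => sum_congr rfl fun j _ => ?_
    rw [div_pow]; ring
  rw [h1]
  refine single_le_sum (f := fun m => (q.choose m : ℝ) *
        ((∑ i ∈ J, ∑ j ∈ J, corr f (e i - e j) ^ m) / Q ^ m)) (fun m _ => ?_) ?_
  · exact mul_nonneg (Nat.cast_nonneg _)
      (div_nonneg (sum_corr_pow_nonneg J e f m) (pow_nonneg hQ.le _))
  · simpa using Nat.lt_succ_of_le hpq

lemma pow_le_choose_mul (c k : ℕ) : (c + 1) ^ k ≤ ((c + 1) * k).choose k := by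
  induction k with
  | zero => simp
  | succ k ih =>
    have h := Nat.add_one_mul_choose_eq ((c + 1) * k + c) k
    have h2 : (c + 1) * k + c + 1 = (c + 1) * (k + 1) := by ring
    rw [h2] at h
    have h3 : (c + 1) * ((c + 1) * k + c).choose k = ((c + 1) * (k + 1)).choose (k + 1) := by
      apply Nat.eq_of_mul_eq_mul_right (Nat.succ_pos k)
      rw [← h, Nat.succ_eq_add_one]; ring
    rw [← h3, pow_succ']
    exact Nat.mul_le_mul_left _ (ih.trans (Nat.choose_le_choose k (by omega)))

variable [DecidableEq G]

/-- The real indicator function of a finite set. -/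
def ind (A : Finset G) (x : G) : ℝ := if x ∈ A then 1 else 0

omit [AddCommGroup G] [Fintype G] in
lemma ind_nonneg (A : Finset G) (x : G) : 0 ≤ ind A x := by
  unfold ind; split_ifs <;> norm_num

omit [AddCommGroup G] [Fintype G] in
lemma ind_le_one (A : Finset G) (x : G) : ind A x ≤ 1 := by
  unfold ind; split_ifs <;> norm_num

omit [AddCommGroup G] in
lemma sum_ind_mul (A : Finset G) (F : G → ℝ) : ∑ x, ind A x * F x = ∑ x ∈ A, F x := by
  simp [ind]

lemma corr_ind_nonneg (A : Finset G) (w : G) : 0 ≤ corr (ind A) w :=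
  sum_nonneg fun _ _ => mul_nonneg (ind_nonneg _ _) (ind_nonneg _ _)

/-- The balanced function of `A` relative to `B`. -/
noncomputable def bal (A B : Finset G) (x : G) : ℝ := ind A x - #A / #B * ind B x

omit [AddCommGroup G] [Fintype G] in
/-- A map moving few points of `B` out of `B` moves few points of a subset out of `B`. -/
lemma card_sub_le_sum_ind {A B : Finset G} (hA : A ⊆ B) {η : ℝ} (φ : G → G)
    (h : (#(B.filter fun x => φ x ∉ B) : ℝ) ≤ η * #B) :
    (#A : ℝ) - η * #B ≤ ∑ x ∈ A, ind B (φ x) := by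
  have h1 : ∑ x ∈ A, ind B (φ x) = #A - #(A.filter fun x => φ x ∉ B) := by
    have := card_filter_add_card_filter_not (s := A) (fun x => φ x ∈ B)
    have h2 : ∑ x ∈ A, ind B (φ x) = #(A.filter fun x => φ x ∈ B) := by
      simp [ind]
    rw [h2, ← this]; push_cast; ring
  have h3 : #(A.filter fun x => φ x ∉ B) ≤ #(B.filter fun x => φ x ∉ B) :=
    card_le_card (filter_subset_filter _ hA)
  have h4 : (#(A.filter fun x => φ x ∉ B) : ℝ) ≤ #(B.filter fun x => φ x ∉ B) := by
    exact_mod_cast h3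
  rw [h1]; linarith

omit [AddCommGroup G] [Fintype G] in
lemma sum_ind_le_card {A B : Finset G} (φ : G → G) : ∑ x ∈ A, ind B (φ x) ≤ #A := by
  calc ∑ x ∈ A, ind B (φ x) ≤ ∑ x ∈ A, (1 : ℝ) := sum_le_sum fun x _ => ind_le_one _ _
    _ = #A := by simp

lemma conv_bal_le {A B : Finset G} (hA : A ⊆ B) (hB : B.Nonempty) {η : ℝ} {w : G}
    (h : (#(B.filter fun x => w - x ∉ B) : ℝ) ≤ η * #B) :
    conv (bal A B) w ≤ conv (ind A) w - (#A / #B : ℝ) ^ 2 * #B + 2 * (#A / #B) * η * #B := by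
  set β : ℝ := #A / #B with hβ
  have hb : (0 : ℝ) < #B := by exact_mod_cast hB.card_pos
  have hβ0 : 0 ≤ β := by positivity
  have hAβ : (#A : ℝ) = β * #B := by rw [hβ]; field_simp
  have h1 := card_sub_le_sum_ind hA (fun x => w - x) h
  have h2 : ∑ x ∈ B, ind B (w - x) ≤ #B := sum_ind_le_card _
  have h3 : ∑ x, ind B x * ind A (w - x) = ∑ x, ind A x * ind B (w - x) := by
    rw [← Equiv.sum_comp (Equiv.subLeft w)]
    refine sum_congr rfl fun x _ => ?_
    simp [mul_comm]
  have h4 : conv (bal A B) w = conv (ind A) w - β * ∑ x, ind A x * ind B (w - x)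
      - β * ∑ x, ind B x * ind A (w - x) + β ^ 2 * ∑ x, ind B x * ind B (w - x) := by
    unfold conv bal
    simp_rw [mul_sum]
    rw [← sum_sub_distrib, ← sum_sub_distrib, ← sum_add_distrib]
    refine sum_congr rfl fun x _ => ?_
    ring
  rw [h4, h3, sum_ind_mul, sum_ind_mul]
  rw [hAβ] at h1
  nlinarith [mul_le_mul_of_nonneg_left h1 hβ0, mul_le_mul_of_nonneg_left h2 (sq_nonneg β)]

lemma corr_bal_bounds {A B : Finset G} (hA : A ⊆ B) (hB : B.Nonempty) {η : ℝ} {w : G}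
    (h : (#(B.filter fun x => x + w ∉ B) : ℝ) ≤ η * #B)
    (h' : (#(B.filter fun x => x - w ∉ B) : ℝ) ≤ η * #B) :
    corr (bal A B) w ≤ corr (ind A) w - (#A / #B : ℝ) ^ 2 * #B + 2 * (#A / #B) * η * #B ∧
    corr (ind A) w - (#A / #B : ℝ) ^ 2 * #B - η * (#A / #B : ℝ) ^ 2 * #B
      ≤ corr (bal A B) w := by
  set β : ℝ := #A / #B with hβ
  have hb : (0 : ℝ) < #B := by exact_mod_cast hB.card_pos
  have hβ0 : 0 ≤ β := by positivity
  have hAβ : (#A : ℝ) = β * #B := by rw [hβ]; field_simp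
  have h1 := card_sub_le_sum_ind hA (fun x => x + w) h
  have h1' := card_sub_le_sum_ind hA (fun x => x - w) h'
  have h5 := card_sub_le_sum_ind (subset_refl B) (fun x => x + w) h
  have h2 : ∑ x ∈ B, ind B (x + w) ≤ #B := sum_ind_le_card _
  have h6 : ∑ x ∈ A, ind B (x + w) ≤ #A := sum_ind_le_card _
  have h7 : ∑ x ∈ A, ind B (x - w) ≤ #A := sum_ind_le_card _
  have h3 : ∑ x, ind B x * ind A (x + w) = ∑ x, ind A x * ind B (x - w) := by
    rw [← Equiv.sum_comp (Equiv.subRight w)]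
    refine sum_congr rfl fun x _ => ?_
    simp [mul_comm]
  have h4 : corr (bal A B) w = corr (ind A) w - β * ∑ x, ind A x * ind B (x + w)
      - β * ∑ x, ind B x * ind A (x + w) + β ^ 2 * ∑ x, ind B x * ind B (x + w) := by
    unfold corr bal
    simp_rw [mul_sum]
    rw [← sum_sub_distrib, ← sum_sub_distrib, ← sum_add_distrib]
    refine sum_congr rfl fun x _ => ?_
    ring
  rw [h4, h3, sum_ind_mul, sum_ind_mul, sum_ind_mul]
  rw [hAβ] at h1 h1' h6 h7
  constructor <;>
  nlinarith [mul_le_mul_of_nonneg_left h1 hβ0, mul_le_mul_of_nonneg_left h2 (sq_nonneg β),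
    mul_le_mul_of_nonneg_left h1' hβ0, mul_le_mul_of_nonneg_left h5 (sq_nonneg β),
    mul_le_mul_of_nonneg_left h6 hβ0, mul_le_mul_of_nonneg_left h7 hβ0]

/-- The popular differences of `A`, relative to the expectation `Q`. -/
def popular (A : Finset G) (Q : ℝ) : Set G := {w | (1 + 1 / 128) * Q ≤ corr (ind A) w}

lemma pow_sub_le_ite_mul_pow {H F δ : ℝ} (hH0 : 0 ≤ H) (hl : -(H + 1 / 128) ≤ 1 + F)
    (hu : 1 + F ≤ H + 1 / 128) (hδ : 0 < δ) (p : ℕ) :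
    (1 + F) ^ (64 * p) / 2 ^ p - 3 ^ p * (1 / 2 ^ p + 1 / δ)
      ≤ (if 1 + 1 / 128 ≤ H then 1 else -(1 / δ)) * H ^ (64 * p) := by
  have hpow : (1 + F) ^ (64 * p) ≤ (H + 1 / 128) ^ (64 * p) := by
    have he : Even (64 * p) := ⟨32 * p, by ring⟩
    rw [← he.pow_abs (1 + _)]
    exact pow_le_pow_left₀ (abs_nonneg _) (abs_le.2 ⟨hl, hu⟩) _
  split_ifs with hS
  · have h11 : (H + 1 / 128) ^ (64 * p) ≤ 2 ^ p * H ^ (64 * p) := by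
      calc (H + 1 / 128) ^ (64 * p) ≤ (129 / 128 * H) ^ (64 * p) := by
            gcongr; linarith
        _ = ((129 / 128 : ℝ) ^ 64) ^ p * H ^ (64 * p) := by rw [mul_pow, pow_mul]
        _ ≤ 2 ^ p * H ^ (64 * p) := by gcongr; norm_num
    have h12 : (1 + F) ^ (64 * p) / 2 ^ p ≤ H ^ (64 * p) := by
      rw [div_le_iff₀ (by positivity)]; linarith
    have : (0 : ℝ) ≤ 3 ^ p * (1 / 2 ^ p + 1 / δ) := by positivity
    linarith
  · have h11 : (H + 1 / 128) ^ (64 * p) ≤ 3 ^ p := by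
      calc (H + 1 / 128) ^ (64 * p) ≤ (65 / 64) ^ (64 * p) := by gcongr; linarith
        _ = ((65 / 64 : ℝ) ^ 64) ^ p := by rw [pow_mul]
        _ ≤ 3 ^ p := by gcongr; norm_num
    have h12 : (1 + F) ^ (64 * p) / 2 ^ p ≤ 3 ^ p * (1 / 2 ^ p) := by
      rw [← div_eq_mul_one_div]; gcongr; linarith
    have h13 : H ^ (64 * p) ≤ 3 ^ p :=
      le_trans (pow_le_pow_left₀ hH0 (by linarith) _) h11
    have h14 : 1 / δ * H ^ (64 * p) ≤ 1 / δ * 3 ^ p := by gcongr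
    linarith

lemma corr_bal_div_bounds {A B : Finset G} (hAB : A ⊆ B) (hA : A.Nonempty) {η : ℝ}
    (hηβ : 256 * η ≤ #A / #B) {w : G}
    (h : (#(B.filter fun x => x + w ∉ B) : ℝ) ≤ η * #B)
    (h' : (#(B.filter fun x => x - w ∉ B) : ℝ) ≤ η * #B) {Q : ℝ}
    (hQ : Q = (#A / #B : ℝ) ^ 2 * #B) :
    1 + corr (bal A B) w / Q ≤ corr (ind A) w / Q + 1 / 128 ∧
      -(corr (ind A) w / Q + 1 / 128) ≤ 1 + corr (bal A B) w / Q := by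
  have hB : B.Nonempty := hA.mono hAB
  have hb : (0 : ℝ) < #B := by exact_mod_cast hB.card_pos
  have ha : (0 : ℝ) < #A := by exact_mod_cast hA.card_pos
  obtain ⟨u, l⟩ := corr_bal_bounds hAB hB h h'
  have hβ1 : (#A / #B : ℝ) ≤ 1 := by
    rw [div_le_one hb]; exact_mod_cast card_le_card hAB
  generalize hβ : (#A / #B : ℝ) = β at *
  have hβ0 : 0 < β := by rw [← hβ]; positivity
  have hQ0 : 0 < Q := by rw [hQ]; positivity
  have h0 := corr_ind_nonneg A w
  have h8 : 2 * β * η * #B ≤ 1 / 128 * Q := by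
    have := mul_le_mul_of_nonneg_left hηβ (mul_pos hβ0 hb).le
    rw [hQ]; linarith
  have h10 : η * β ^ 2 * #B ≤ 1 / 128 * Q := by
    rw [mul_assoc, ← hQ]; exact mul_le_mul_of_nonneg_right (by linarith) hQ0.le
  rw [← hQ] at u l
  have e1 : 1 + corr (bal A B) w / Q = (Q + corr (bal A B) w) / Q := by field_simp
  have e2 : corr (ind A) w / Q + 1 / 128 = (corr (ind A) w + 1 / 128 * Q) / Q := by field_simp
  rw [e1, e2, ← neg_div]
  exact ⟨div_le_div_of_nonneg_right (by linarith) hQ0.le,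
    div_le_div_of_nonneg_right (by linarith) hQ0.le⟩

lemma one_add_pow_mul_le {p : ℕ} {γ δ : ℝ} (hδ : 0 < δ) (hδ1 : δ ≤ 1)
    (hpγ : 3 ≤ 2 ^ p * (γ * δ)) :
    (1 : ℝ) + 3 ^ p * (1 / 2 ^ p + 1 / δ) ≤ 8 ^ p * γ := by
  have e1 : (3 : ℝ) ^ p ≤ 4 ^ p := by gcongr; norm_num
  have e2 : (1 : ℝ) ≤ 3 ^ p := one_le_pow₀ (by norm_num)
  have e3 : (1 : ℝ) / 2 ^ p ≤ 1 / δ :=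
    one_div_le_one_div_of_le hδ (hδ1.trans (one_le_pow₀ (by norm_num)))
  have e4 : 3 / δ ≤ 2 ^ p * γ := by
    rw [div_le_iff₀ hδ]; linarith
  have e5 : (1 : ℝ) ≤ 1 / δ := by rw [le_div_iff₀ hδ]; linarith
  calc (1 : ℝ) + 3 ^ p * (1 / 2 ^ p + 1 / δ)
      ≤ 3 ^ p * (1 / δ) + 3 ^ p * (1 / δ + 1 / δ) := by
        gcongr
        exact one_le_mul_of_one_le_of_one_le e2 e5
    _ = 3 ^ p * (3 / δ) := by ring
    _ ≤ 4 ^ p * (2 ^ p * γ) := by gcongr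
    _ = 8 ^ p * γ := by rw [← mul_assoc, ← mul_pow]; norm_num

omit [DecidableEq G] in
lemma sixteen_pow_le_sum {ι : Type*} (J : Finset ι) (e : ι → G) (f : G → ℝ) {p : ℕ}
    {c t γ Q : ℝ} (hQ : 0 < Q) (ht : 0 < t) (hct : γ * t ≤ c)
    (h : (#J : ℝ) ^ 2 * (c * (Q / 4) ^ p) ≤ t * ∑ i ∈ J, ∑ j ∈ J, corr f (e i - e j) ^ p) :
    16 ^ p * γ * (#J : ℝ) ^ 2
      ≤ ∑ i ∈ J, ∑ j ∈ J, (1 + corr f (e i - e j) / Q) ^ (64 * p) := by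
  have h2 := choose_mul_sum_corr_pow_le J e f p (64 * p) (by omega) hQ
  have hch : (64 : ℝ) ^ p ≤ ((64 * p).choose p : ℝ) := by
    exact_mod_cast pow_le_choose_mul 63 p
  have hSg0 := sum_corr_pow_nonneg J e f p
  refine le_trans ?_ ((mul_le_mul_of_nonneg_right hch (by positivity)).trans h2)
  generalize ∑ i ∈ J, ∑ j ∈ J, corr f (e i - e j) ^ p = Sg at *
  have h5 : (#J : ℝ) ^ 2 * (γ * (Q / 4) ^ p) ≤ Sg := by
    have h6 : t * ((#J : ℝ) ^ 2 * (γ * (Q / 4) ^ p)) ≤ t * Sg := by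
      refine le_trans (le_of_eq_of_le ?_ (mul_le_mul_of_nonneg_left
        (mul_le_mul_of_nonneg_right hct (by positivity : (0 : ℝ) ≤ (Q / 4) ^ p))
        (sq_nonneg (#J : ℝ)))) h
      ring
    exact le_of_mul_le_mul_left h6 ht
  have h7 : (16 : ℝ) ^ p * γ * (#J : ℝ) ^ 2
      = 64 ^ p * (((#J : ℝ) ^ 2 * (γ * (Q / 4) ^ p)) / Q ^ p) := by
    rw [div_pow, show (64 : ℝ) = 16 * 4 by norm_num, mul_pow]
    field_simp
  rw [h7]
  gcongr

open Classical in
/-- If a set `A ⊆ B` has few solutions to `x + y ∈ C`, then the popular differences dominate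
the high power sums of the autocorrelation of `A` along a positive definite weight. -/
lemma card_sq_le_sum_popular {ι : Type*} (J : Finset ι) (e : ι → G) {A B C T : Finset G}
    (hAB : A ⊆ B) (hA : A.Nonempty) {η δ γ : ℝ} (hδ : 0 < δ) (hδ1 : δ ≤ 1)
    (hηβ : 256 * η ≤ #A / #B)
    (hC : ∑ w ∈ C, conv (ind A) w ≤ 1 / 2 * ((#A / #B : ℝ) ^ 2 * #B) * #C)
    (hCB : ∀ w ∈ C, (#(B.filter fun x => w - x ∉ B) : ℝ) ≤ η * #B)
    (hT : ∀ w ∈ C, ∀ i ∈ J, ∀ j ∈ J, w - e i + e j ∈ T)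
    (hCT : γ * #T ≤ #C) (hT0 : T.Nonempty)
    (hJ : ∀ i ∈ J, ∀ j ∈ J, (#(B.filter fun x => x + (e i - e j) ∉ B) : ℝ) ≤ η * #B)
    {p : ℕ} (hp : Even p) (hpγ : 3 ≤ 2 ^ p * (γ * δ)) :
    (#J : ℝ) ^ 2 ≤ ∑ i ∈ J, ∑ j ∈ J,
      (if e i - e j ∈ popular A ((#A / #B : ℝ) ^ 2 * #B) then 1 else -(1 / δ)) *
        (corr (ind A) (e i - e j) / ((#A / #B : ℝ) ^ 2 * #B)) ^ (64 * p) := by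
  have hB : B.Nonempty := hA.mono hAB
  have hb : (0 : ℝ) < #B := by exact_mod_cast hB.card_pos
  have ha : (0 : ℝ) < #A := by exact_mod_cast hA.card_pos
  have ht : (0 : ℝ) < #T := by exact_mod_cast hT0.card_pos
  set β : ℝ := #A / #B with hβ
  have hβ0 : 0 < β := by positivity
  have hβ1 : β ≤ 1 := by
    rw [hβ, div_le_one hb]; exact_mod_cast card_le_card hAB
  set Q : ℝ := β ^ 2 * #B with hQ
  have hQ0 : 0 < Q := by positivity
  have hsum : ∑ w ∈ C, conv (bal A B) w ≤ -(Q / 4 * #C) := by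
    calc ∑ w ∈ C, conv (bal A B) w
        ≤ ∑ w ∈ C, (conv (ind A) w - Q + 2 * β * η * #B) :=
          sum_le_sum fun w hw => conv_bal_le hAB hB (hCB w hw)
      _ = ∑ w ∈ C, conv (ind A) w - Q * #C + 2 * β * η * #B * #C := by
          rw [sum_add_distrib, sum_sub_distrib]; simp; ring
      _ ≤ 1 / 2 * Q * #C - Q * #C + Q / 4 * #C := by
          have : 2 * β * η * #B ≤ Q / 4 := by
            rw [hQ]
            have := mul_le_mul_of_nonneg_left hηβ (mul_pos hβ0 hb).le
            nlinarith
          have := mul_le_mul_of_nonneg_right this (Nat.cast_nonneg (α := ℝ) #C)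
          linarith
      _ = _ := by ring
  have h1 := card_mul_pow_le_sum_corr_pow J e (bal A B) hp C T (by positivity) hsum hT
  have h3 := sixteen_pow_le_sum J e (bal A B) hQ0 ht hCT h1
  have h4 : ∀ i ∈ J, ∀ j ∈ J,
      (1 + corr (bal A B) (e i - e j) / Q) ^ (64 * p) / 2 ^ p - 3 ^ p * (1 / 2 ^ p + 1 / δ) ≤
      (if e i - e j ∈ popular A Q then 1 else -(1 / δ)) *
        (corr (ind A) (e i - e j) / Q) ^ (64 * p) := by
    intro i hi j hj
    set w := e i - e j with hw
    have hw1 := hJ i hi j hj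
    have hw2 := hJ j hj i hi
    have hw3 : (#(B.filter fun x => x - w ∉ B) : ℝ) ≤ η * #B := by
      have : ∀ x : G, x - w = x + (e j - e i) := fun x => by rw [hw]; abel
      simpa only [this] using hw2
    obtain ⟨hu, hl⟩ := corr_bal_div_bounds hAB hA hηβ hw1 hw3 hQ
    set H := corr (ind A) w / Q with hH
    have hH0 : 0 ≤ H := div_nonneg (corr_ind_nonneg _ _) hQ0.le
    have hmem : w ∈ popular A Q ↔ 1 + 1 / 128 ≤ H := by
      rw [hH, le_div_iff₀ hQ0]; rfl
    simp only [hmem]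
    exact pow_sub_le_ite_mul_pow hH0 hl hu hδ p
  have h5 : (∑ i ∈ J, ∑ j ∈ J, (1 + corr (bal A B) (e i - e j) / Q) ^ (64 * p)) / 2 ^ p
      - 3 ^ p * (1 / 2 ^ p + 1 / δ) * (#J : ℝ) ^ 2 ≤ ∑ i ∈ J, ∑ j ∈ J,
      (if e i - e j ∈ popular A Q then 1 else -(1 / δ)) *
        (corr (ind A) (e i - e j) / Q) ^ (64 * p) := by
    refine le_of_eq_of_le ?_ (sum_le_sum fun i hi => sum_le_sum fun j hj => h4 i hi j hj)
    simp only [sum_sub_distrib, sum_div, sum_const, nsmul_eq_mul]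
    ring
  refine le_trans ?_ h5
  have h6 : 8 ^ p * γ * (#J : ℝ) ^ 2
      ≤ (∑ i ∈ J, ∑ j ∈ J, (1 + corr (bal A B) (e i - e j) / Q) ^ (64 * p)) / 2 ^ p := by
    rw [le_div_iff₀ (by positivity)]
    refine le_of_eq_of_le ?_ h3
    rw [show (16 : ℝ) = 8 * 2 by norm_num, mul_pow]; ring
  have h7 := one_add_pow_mul_le hδ hδ1 hpγ
  have h8 := mul_le_mul_of_nonneg_right h7 (sq_nonneg (#J : ℝ))
  linarith

omit [AddCommGroup G] [Fintype G] in
lemma prod_ind {q : ℕ} (A : Finset G) (y : Fin q → G) :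
    ∏ k, ind A (y k) = if ∀ k, y k ∈ A then 1 else 0 := by
  unfold ind
  rw [prod_ite_zero]
  simp

/-- Sifting (dependent random choice). -/
lemma exists_sift_weight {E₁ E₂ A Z : Finset G} (h₁ : E₁.Nonempty) (h₂ : E₂.Nonempty)
    (hZ : ∀ a ∈ A, ∀ v ∈ E₂, a - v ∈ Z) {Q : ℝ} (hQ : 0 < Q) (q : ℕ) (F : G → ℝ)
    (h : (#(E₁ ×ˢ E₂) : ℝ) ^ 2 ≤ ∑ i ∈ E₁ ×ˢ E₂, ∑ j ∈ E₁ ×ˢ E₂,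
      F (i.1 + i.2 - (j.1 + j.2)) * (corr (ind A) (i.1 + i.2 - (j.1 + j.2)) / Q) ^ q) :
    ∃ c : G, ∃ U ⊆ E₁, ∃ V ⊆ E₂,
      (#E₁ : ℝ) * #E₂ * Q ^ q ≤ (#Z : ℝ) ^ q * ∑ u ∈ U, ∑ v ∈ V, F (u - v + c) := by
  set P := E₁ ×ˢ E₂ with hP
  have hPne : P.Nonempty := h₁.product h₂
  have hcard : (#P : ℝ) = #E₁ * #E₂ := by rw [hP, card_product]; push_cast; rfl
  set Φ : G → ℝ := fun w => F w * (corr (ind A) w / Q) ^ q with hΦ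
  have hswap : ∑ i ∈ P, ∑ j ∈ P, Φ (i.1 + i.2 - (j.1 + j.2))
      = ∑ i ∈ P, ∑ j ∈ P, Φ (j.1 - j.2 + (i.2 - i.1)) := by
    rw [← sum_product', ← sum_product']
    refine sum_nbij' (fun x => ((x.2.1, x.1.2), (x.1.1, x.2.2)))
      (fun x => ((x.2.1, x.1.2), (x.1.1, x.2.2))) ?_ ?_ ?_ ?_ ?_
    · simp only [hP, mem_product]; tauto
    · simp only [hP, mem_product]; tauto
    · simp
    · simp
    · intro x _
      congr 1
      simp only
      abel
  obtain ⟨i, hi, hi2⟩ : ∃ i ∈ P, (#P : ℝ) ≤ ∑ j ∈ P, Φ (j.1 - j.2 + (i.2 - i.1)) := by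
    refine exists_le_of_sum_le hPne ?_
    rw [← hswap]
    refine le_trans (le_of_eq ?_) h
    simp [pow_two]
  set c := i.2 - i.1 with hc
  refine ⟨c, ?_⟩
  set Us : (Fin q → G) → Finset G := fun s => E₁.filter fun u => ∀ k, s k + (u + c) ∈ A with hUs
  set Vs : (Fin q → G) → Finset G := fun s => E₂.filter fun v => ∀ k, s k + v ∈ A with hVs
  set I : (Fin q → G) → ℝ := fun s => ∑ u ∈ Us s, ∑ v ∈ Vs s, F (u - v + c) with hI
  have hexp : ∑ j ∈ P, Φ (j.1 - j.2 + c) = (∑ s, I s) / Q ^ q := by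
    have h1 : ∀ u v : G, Φ (u - v + c) = (∑ s : Fin q → G,
        F (u - v + c) * ((if ∀ k, s k + (u + c) ∈ A then 1 else 0) *
          (if ∀ k, s k + v ∈ A then 1 else 0))) / Q ^ q := by
      intro u v
      rw [← mul_sum, hΦ]
      simp only
      rw [div_pow, mul_div_assoc]
      congr 2
      rw [show u - v + c = (u + c) - v by abel, corr_sub, Fintype.sum_pow]
      refine sum_congr rfl fun s _ => ?_
      rw [prod_mul_distrib, prod_ind A (fun k => s k + (u + c)), prod_ind A (fun k => s k + v)]
    rw [hP, sum_product]
    simp_rw [h1]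
    rw [sum_congr rfl fun u _ => (sum_div _ _ _).symm, ← sum_div]
    congr 1
    have h2 : ∀ s, I s = ∑ u ∈ E₁, ∑ v ∈ E₂,
        F (u - v + c) * ((if ∀ k, s k + (u + c) ∈ A then 1 else 0) *
          (if ∀ k, s k + v ∈ A then 1 else 0)) := by
      intro s
      simp only [hI, hUs, hVs, sum_filter]
      refine sum_congr rfl fun u _ => ?_
      split_ifs with hu
      · refine sum_congr rfl fun v _ => ?_
        split_ifs <;> simp
      · simp
    simp_rw [h2]
    rw [sum_comm]
    rw [sum_comm (s := univ)]
    rw [sum_comm]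
    exact sum_congr rfl fun u _ => sum_comm
  have hrestrict : ∑ s, I s = ∑ s ∈ Fintype.piFinset (fun _ : Fin q => Z), I s := by
    refine (sum_subset (subset_univ _) fun s _ hs => ?_).symm
    have : Vs s = ∅ := by
      rw [eq_empty_iff_forall_notMem]
      intro v hv
      obtain ⟨hv1, hv2⟩ := mem_filter.1 hv
      refine hs (Fintype.mem_piFinset.2 fun k => ?_)
      simpa using hZ _ (hv2 k) v hv1
    simp [hI, this]
  have hpos : (#E₁ : ℝ) * #E₂ * Q ^ q ≤ ∑ s ∈ Fintype.piFinset (fun _ : Fin q => Z), I s := by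
    rw [← hrestrict, ← hcard]
    rw [hexp, le_div_iff₀ (by positivity)] at hi2
    exact hi2
  have hlhs : 0 < (#E₁ : ℝ) * #E₂ * Q ^ q := by
    have := h₁.card_pos; have := h₂.card_pos; positivity
  have hne : (Fintype.piFinset (fun _ : Fin q => Z)).Nonempty := by
    by_contra hcon
    rw [not_nonempty_iff_eq_empty] at hcon
    rw [hcon, sum_empty] at hpos
    linarith
  have hcardZ : (#(Fintype.piFinset (fun _ : Fin q => Z)) : ℝ) = (#Z : ℝ) ^ q := by
    rw [Fintype.card_piFinset_const]; push_cast; rfl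
  have hZpos : 0 < (#Z : ℝ) ^ q := by
    rw [← hcardZ]; exact_mod_cast hne.card_pos
  obtain ⟨s, -, hs⟩ : ∃ s ∈ Fintype.piFinset (fun _ : Fin q => Z),
      (#E₁ : ℝ) * #E₂ * Q ^ q / (#Z : ℝ) ^ q ≤ I s := by
    refine exists_le_of_sum_le hne ?_
    rw [sum_const, nsmul_eq_mul, hcardZ, mul_div_cancel₀ _ hZpos.ne']
    exact hpos
  refine ⟨Us s, filter_subset _ _, Vs s, filter_subset _ _, ?_⟩
  rw [div_le_iff₀' hZpos] at hs
  exact hs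

open Classical in
lemma exists_sift {E₁ E₂ A Z : Finset G} (h₁ : E₁.Nonempty) (h₂ : E₂.Nonempty)
    (hZ : ∀ a ∈ A, ∀ v ∈ E₂, a - v ∈ Z) {Q κ : ℝ} (hQ : 0 < Q) (hκ : 0 < κ) (hκQ : κ * #Z ≤ Q)
    (q : ℕ) (S : Set G) {δ : ℝ} (hδ : 0 < δ)
    (h : (#(E₁ ×ˢ E₂) : ℝ) ^ 2 ≤ ∑ i ∈ E₁ ×ˢ E₂, ∑ j ∈ E₁ ×ˢ E₂,
      (if i.1 + i.2 - (j.1 + j.2) ∈ S then 1 else -(1 / δ)) *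
        (corr (ind A) (i.1 + i.2 - (j.1 + j.2)) / Q) ^ q) :
    ∃ c : G, ∃ U ⊆ E₁, ∃ V ⊆ E₂, κ ^ q * (#E₁ * #E₂) ≤ (#U : ℝ) * #V ∧
      (1 - δ) * (#U * #V) ≤ ∑ u ∈ U, ∑ v ∈ V, if u - v + c ∈ S then (1 : ℝ) else 0 := by
  obtain ⟨c, U, hU, V, hV, hUV⟩ := exists_sift_weight h₁ h₂ hZ hQ q
    (fun w => if w ∈ S then 1 else -(1 / δ)) h
  refine ⟨c, U, hU, V, hV, ?_⟩
  set g := ∑ u ∈ U, ∑ v ∈ V, if u - v + c ∈ S then (1 : ℝ) else 0 with hg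
  have hsplit : ∑ u ∈ U, ∑ v ∈ V, (if u - v + c ∈ S then (1 : ℝ) else -(1 / δ))
      = g - 1 / δ * (#U * #V - g) := by
    have : ∀ u v : G, (if u - v + c ∈ S then (1 : ℝ) else -(1 / δ))
        = (1 + 1 / δ) * (if u - v + c ∈ S then (1 : ℝ) else 0) - 1 / δ := by
      intro u v; split_ifs <;> ring
    simp_rw [this, sum_sub_distrib, ← mul_sum, ← hg]
    simp
    ring
  rw [hsplit] at hUV
  have hE : 0 < (#E₁ : ℝ) * #E₂ := by
    have := h₁.card_pos; have := h₂.card_pos; positivity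
  have hgle : g ≤ #U * #V := by
    calc g ≤ ∑ u ∈ U, ∑ v ∈ V, (1 : ℝ) :=
          sum_le_sum fun u _ => sum_le_sum fun v _ => by split_ifs <;> norm_num
      _ = #U * #V := by simp
  have hprod : 0 < (#Z : ℝ) ^ q * (g - 1 / δ * (#U * #V - g)) :=
    lt_of_lt_of_le (by positivity) hUV
  have hpos : 0 < g - 1 / δ * (#U * #V - g) :=
    pos_of_mul_pos_right hprod (by positivity)
  have hZq : 0 < (#Z : ℝ) ^ q := pos_of_mul_pos_left hprod hpos.le
  have hbad : #U * #V - g ≤ δ * g := by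
    have : 1 / δ * (#U * #V - g) ≤ g := by linarith
    rw [one_div, inv_mul_le_iff₀ hδ] at this
    exact this
  constructor
  · have h3 : 0 ≤ 1 / δ * (#U * #V - g) := mul_nonneg (by positivity) (by linarith)
    have h4 : (#Z : ℝ) ^ q * (κ ^ q * (#E₁ * #E₂)) ≤ (#Z : ℝ) ^ q * (#U * #V) := by
      calc (#Z : ℝ) ^ q * (κ ^ q * (#E₁ * #E₂)) = (κ * #Z) ^ q * (#E₁ * #E₂) := by
            rw [mul_pow]; ring
        _ ≤ Q ^ q * (#E₁ * #E₂) := by gcongr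
        _ = #E₁ * #E₂ * Q ^ q := by ring
        _ ≤ _ := hUV
        _ ≤ (#Z : ℝ) ^ q * (#U * #V) := by gcongr; linarith
    exact le_of_mul_le_mul_left h4 hZq
  · have : δ * g ≤ δ * (#U * #V) := by gcongr
    linarith

omit [AddCommGroup G] [Fintype G] [DecidableEq G] in
lemma sum_exp_le {V : Finset G} {h : G → ℝ} (hh : ∀ v ∈ V, |h v| ≤ 1) (h0 : ∑ v ∈ V, h v = 0)
    {l : ℝ} (hl : |l| ≤ 1) : ∑ v ∈ V, Real.exp (l * h v) ≤ #V * Real.exp (l ^ 2) := by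
  calc ∑ v ∈ V, Real.exp (l * h v) ≤ ∑ v ∈ V, (1 + l * h v + l ^ 2) := by
        refine sum_le_sum fun v hv => ?_
        have h1 : |l * h v| ≤ 1 := by
          rw [abs_mul]; exact mul_le_one₀ hl (abs_nonneg _) (hh v hv)
        have h2 := (abs_le.1 (Real.abs_exp_sub_one_sub_id_le h1)).2
        have h3 : (l * h v) ^ 2 ≤ l ^ 2 := by
          rw [mul_pow]
          have : h v ^ 2 ≤ 1 := (sq_le_one_iff_abs_le_one _).2 (hh v hv)
          nlinarith [sq_nonneg l]
        linarith
    _ = #V * (1 + l ^ 2) := by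
        rw [sum_add_distrib, sum_add_distrib, ← mul_sum, h0]; simp; ring
    _ ≤ _ := by
        gcongr
        linarith [Real.add_one_le_exp (l ^ 2)]

omit [AddCommGroup G] [Fintype G] [DecidableEq G] in
lemma card_large_sum_le {V : Finset G} {h : G → ℝ} (hh : ∀ v ∈ V, |h v| ≤ 1)
    (h0 : ∑ v ∈ V, h v = 0) {ε : ℝ} (hε : 0 ≤ ε) (hε1 : ε ≤ 1) (n : ℕ) :
    (#((Fintype.piFinset fun _ : Fin n => V).filter fun a => n * ε ≤ ∑ i, h (a i)) : ℝ)
      ≤ Real.exp (-(n * ε ^ 2 / 4)) * #V ^ n := by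
  rw [card_filter]
  push_cast
  calc (∑ a ∈ Fintype.piFinset fun _ : Fin n => V, if n * ε ≤ ∑ i, h (a i) then (1 : ℝ) else 0)
      ≤ ∑ a ∈ Fintype.piFinset fun _ : Fin n => V,
          Real.exp (-(n * ε ^ 2 / 2)) * ∏ i, Real.exp (ε / 2 * h (a i)) := by
        refine sum_le_sum fun a _ => ?_
        rw [← Real.exp_sum, ← Real.exp_add, ← mul_sum]
        split_ifs with hc
        · apply Real.one_le_exp
          nlinarith
        · positivity
    _ = Real.exp (-(n * ε ^ 2 / 2)) * (∑ v ∈ V, Real.exp (ε / 2 * h v)) ^ n := by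
        have := prod_univ_sum (fun _ : Fin n => V) (fun _ v => Real.exp (ε / 2 * h v))
        rw [← mul_sum, ← this]; simp
    _ ≤ Real.exp (-(n * ε ^ 2 / 2)) * (#V * Real.exp ((ε / 2) ^ 2)) ^ n := by
        gcongr
        exact sum_exp_le hh h0 (by rw [abs_le]; constructor <;> linarith)
    _ = _ := by
        rw [mul_pow, ← Real.exp_nat_mul, mul_left_comm, ← Real.exp_add, mul_comm]
        congr 2; ring

omit [AddCommGroup G] [Fintype G] in
lemma card_large_abs_sum_le {V : Finset G} {h : G → ℝ} (hh : ∀ v ∈ V, |h v| ≤ 1)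
    (h0 : ∑ v ∈ V, h v = 0) {ε : ℝ} (hε : 0 ≤ ε) (hε1 : ε ≤ 1) (n : ℕ) :
    (#((Fintype.piFinset fun _ : Fin n => V).filter fun a => n * ε ≤ |∑ i, h (a i)|) : ℝ)
      ≤ 2 * Real.exp (-(n * ε ^ 2 / 4)) * #V ^ n := by
  have h1 := card_large_sum_le hh h0 hε hε1 n
  have h2 := card_large_sum_le (h := fun v => - h v) (by simpa using hh) (by simp [h0]) hε hε1 n
  have h3 : ((Fintype.piFinset fun _ : Fin n => V).filter fun a => n * ε ≤ |∑ i, h (a i)|)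
      ⊆ ((Fintype.piFinset fun _ : Fin n => V).filter fun a => n * ε ≤ ∑ i, h (a i)) ∪
        ((Fintype.piFinset fun _ : Fin n => V).filter fun a => n * ε ≤ ∑ i, - h (a i)) := by
    intro a
    simp only [mem_filter, mem_union, sum_neg_distrib, le_abs]
    tauto
  have h4 := (card_le_card h3).trans (card_union_le _ _)
  have h5 := (Nat.cast_le (α := ℝ)).2 h4
  push_cast at h5
  linarith

/-- The average of `f` over the translates by `-V`. -/
noncomputable def avg (f : G → ℝ) (V : Finset G) (x : G) : ℝ := (∑ v ∈ V, f (x - v)) / #V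

omit [Fintype G] [DecidableEq G] in
lemma avg_nonneg {f : G → ℝ} (hf : ∀ x, 0 ≤ f x) (V : Finset G) (x : G) : 0 ≤ avg f V x := by
  unfold avg
  have := sum_nonneg fun v (_ : v ∈ V) => hf (x - v)
  positivity

omit [Fintype G] [DecidableEq G] in
lemma avg_le_one {f : G → ℝ} (hf : ∀ x, f x ≤ 1) (V : Finset G) (x : G) : avg f V x ≤ 1 := by
  unfold avg
  refine div_le_one_of_le₀ ?_ (by positivity)
  calc _ ≤ ∑ v ∈ V, (1 : ℝ) := sum_le_sum fun v _ => hf _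
    _ = _ := by simp

omit [Fintype G] in
lemma exists_good_samples {V : Finset G} (hV : V.Nonempty) {f : G → ℝ} (hf0 : ∀ x, 0 ≤ f x)
    (hf1 : ∀ x, f x ≤ 1) (R : Finset G) {ε : ℝ} (hε : 0 ≤ ε) (hε1 : ε ≤ 1) (n : ℕ) :
    ∃ L ⊆ Fintype.piFinset fun _ : Fin n => V, (#V : ℝ) ^ n ≤ 2 * #L ∧ ∀ a ∈ L,
      (#(R.filter fun x => n * ε ≤ |∑ i, (f (x - a i) - avg f V x)|) : ℝ) ≤
        4 * Real.exp (-(n * ε ^ 2 / 4)) * #R := by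
  set κ := Real.exp (-(n * ε ^ 2 / 4)) with hκ
  have hκ0 : 0 < κ := Real.exp_pos _
  have hVc : (0 : ℝ) < #V := by exact_mod_cast hV.card_pos
  set P := Fintype.piFinset fun _ : Fin n => V with hP
  have hPc : (#P : ℝ) = #V ^ n := by simp [hP]
  set bad : (Fin n → G) → ℝ := fun a =>
    (#(R.filter fun x => n * ε ≤ |∑ i, (f (x - a i) - avg f V x)|) : ℝ) with hbad
  refine ⟨P.filter fun a => bad a ≤ 4 * κ * #R, filter_subset _ _, ?_,
    fun a ha => (mem_filter.1 ha).2⟩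
  have htot : ∑ a ∈ P, bad a ≤ 2 * κ * #V ^ n * #R := by
    have : ∀ a, bad a = ∑ x ∈ R,
        if n * ε ≤ |∑ i, (f (x - a i) - avg f V x)| then (1 : ℝ) else 0 := by
      intro a; simp [hbad]
    simp_rw [this]
    rw [sum_comm]
    calc _ ≤ ∑ x ∈ R, 2 * κ * (#V : ℝ) ^ n := by
          refine sum_le_sum fun x _ => ?_
          have h1 := card_large_abs_sum_le (V := V) (h := fun v => f (x - v) - avg f V x) ?_ ?_
            hε hε1 n
          · refine le_trans (le_of_eq ?_) h1
            rw [card_filter]; push_cast; rfl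
          · intro v _
            rw [abs_le]
            have := hf0 (x - v); have := hf1 (x - v)
            have := avg_nonneg hf0 V x; have := avg_le_one hf1 V x
            constructor <;> linarith
          · rw [sum_sub_distrib]
            simp only [avg, sum_const, nsmul_eq_mul]
            field_simp
            ring
      _ = _ := by simp; ring
  by_contra hcon
  push Not at hcon
  have h2 : (#P : ℝ) = #(P.filter fun a => bad a ≤ 4 * κ * #R) +
      #(P.filter fun a => ¬ bad a ≤ 4 * κ * #R) := by
    exact_mod_cast (card_filter_add_card_filter_not _).symm
  have h3 : #(P.filter fun a => ¬ bad a ≤ 4 * κ * #R) * (4 * κ * #R) ≤ ∑ a ∈ P, bad a := by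
    calc _ = ∑ a ∈ P.filter fun a => ¬ bad a ≤ 4 * κ * #R, 4 * κ * (#R : ℝ) := by simp
      _ ≤ ∑ a ∈ P.filter fun a => ¬ bad a ≤ 4 * κ * #R, bad a :=
          sum_le_sum fun a ha => (not_le.1 (mem_filter.1 ha).2).le
      _ ≤ _ := sum_le_sum_of_subset_of_nonneg (filter_subset _ _) fun a _ _ => by
          simp only [hbad]; positivity
  rcases R.eq_empty_or_nonempty with rfl | hR
  · simp [hbad] at hcon
    have : (0 : ℝ) < #V ^ n := by positivity
    simp [hPc] at h2
    linarith
  have hRc : (0 : ℝ) < #R := by exact_mod_cast hR.card_pos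
  have h4 : (0 : ℝ) < κ * #R := by positivity
  rw [hPc] at h2
  nlinarith

omit [Fintype G] in
lemma exists_common_shift {V W E : Finset G} (hW : ∀ v ∈ V, ∀ t ∈ E, v - t ∈ W) {n : ℕ}
    {L : Finset (Fin n → G)} (hL : L ⊆ Fintype.piFinset fun _ => V) (hWne : W.Nonempty) :
    ∃ w : Fin n → G, #E * #L ≤ #(E.filter fun t => (fun i => w i + t) ∈ L) * #W ^ n := by
  set P := Fintype.piFinset fun _ : Fin n => W with hP
  have hPc : #P = #W ^ n := by simp [hP]
  have hPne : P.Nonempty := by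
    rw [← card_pos, hPc]; have := hWne.card_pos; positivity
  suffices h : ∑ _w ∈ P, #E * #L ≤ ∑ w ∈ P, #(E.filter fun t => (fun i => w i + t) ∈ L) * #W ^ n by
    obtain ⟨w, -, hw⟩ := exists_le_of_sum_le hPne h
    exact ⟨w, hw⟩
  rw [sum_const, smul_eq_mul, hPc, ← sum_mul, mul_comm]
  refine Nat.mul_le_mul_right _ ?_
  simp_rw [card_filter]
  rw [sum_comm]
  rw [← smul_eq_mul, ← sum_const]
  refine sum_le_sum fun t ht => ?_
  rw [← card_filter]
  refine card_le_card_of_injOn (fun a i => a i - t) ?_ ?_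
  · intro a ha
    have h1 := Fintype.mem_piFinset.1 (hL ha)
    simp only [coe_filter, Set.mem_ofPred_eq, hP, Fintype.mem_piFinset, sub_add_cancel]
    exact ⟨fun i => hW _ (h1 i) _ ht, ha⟩
  · intro a _ b _ hab
    funext i
    have := congrFun hab i
    simpa using this

omit [Fintype G] in
/-- Almost periods (Croot–Sisask). -/
lemma exists_almost_period {V W E : Finset G} (R : Finset G) (hV : V.Nonempty) (hWne : W.Nonempty)
    (hW : ∀ v ∈ V, ∀ t ∈ E, v - t ∈ W) {f : G → ℝ} (hf0 : ∀ x, 0 ≤ f x)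
    (hf1 : ∀ x, f x ≤ 1) {ε : ℝ} (hε : 0 ≤ ε) (hε1 : ε ≤ 1) {n : ℕ} (hn : 0 < n) :
    ∃ T ⊆ E, (#E : ℝ) * #V ^ n ≤ 2 * #T * #W ^ n ∧ ∀ t ∈ T, ∀ t' ∈ T, ∀ X ⊆ R,
      (∀ x ∈ X, x + (t' - t) ∈ R) → ∑ x ∈ X, |avg f V (x + (t' - t)) - avg f V x| ≤
        2 * ε * #X + 8 * Real.exp (-(n * ε ^ 2 / 4)) * #R := by
  obtain ⟨L, hL, hLc, hLb⟩ := exists_good_samples hV hf0 hf1 R hε hε1 n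
  obtain ⟨w, hw⟩ := exists_common_shift hW hL hWne
  refine ⟨E.filter fun t => (fun i => w i + t) ∈ L, filter_subset _ _, ?_, ?_⟩
  · have hw' : (#E : ℝ) * #L ≤ #(E.filter fun t => (fun i => w i + t) ∈ L) * #W ^ n := by
      exact_mod_cast hw
    nlinarith [Nat.cast_nonneg (α := ℝ) #E]
  intro t ht t' ht' X hX hX'
  set κ := Real.exp (-(n * ε ^ 2 / 4)) with hκ
  have hbt := hLb _ (mem_filter.1 ht).2
  have hbt' := hLb _ (mem_filter.1 ht').2
  set b1 : G → Prop := fun x => n * ε ≤ |∑ i, (f (x - (w i + t)) - avg f V x)| with hb1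
  set b2 : G → Prop := fun x => n * ε ≤ |∑ i, (f (x - (w i + t')) - avg f V x)| with hb2
  have hnR : (0 : ℝ) < n := by exact_mod_cast hn
  classical
  have hpt : ∀ x ∈ X, |avg f V (x + (t' - t)) - avg f V x| ≤
      2 * ε + ((if b1 x then 1 else 0) + (if b2 (x + (t' - t)) then 1 else 0)) := by
    intro x _
    have h1 : |avg f V (x + (t' - t)) - avg f V x| ≤ 1 := by
      rw [abs_le]
      have := avg_nonneg hf0 V x; have := avg_le_one hf1 V x
      have := avg_nonneg hf0 V (x + (t' - t)); have := avg_le_one hf1 V (x + (t' - t))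
      constructor <;> linarith
    by_cases c1 : b1 x
    · rw [if_pos c1]; split_ifs <;> linarith
    by_cases c2 : b2 (x + (t' - t))
    · rw [if_pos c2]; split_ifs; linarith
    rw [if_neg c1, if_neg c2]
    simp only [hb1, not_le, sum_sub_distrib, sum_const, card_univ, Fintype.card_fin,
      nsmul_eq_mul] at c1
    simp only [hb2, not_le, sum_sub_distrib, sum_const, card_univ, Fintype.card_fin,
      nsmul_eq_mul] at c2
    have h3 : ∀ i, x + (t' - t) - (w i + t') = x - (w i + t) := fun i => by abel
    simp_rw [h3] at c2
    rw [abs_lt] at c1 c2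
    rw [abs_le]
    constructor
    · refine le_of_mul_le_mul_left ?_ hnR
      linarith
    · refine le_of_mul_le_mul_left ?_ hnR
      linarith
  calc _ ≤ _ := sum_le_sum hpt
    _ = 2 * ε * #X + (#(X.filter b1) + #(X.filter fun x => b2 (x + (t' - t)))) := by
        simp [sum_add_distrib]; ring
    _ ≤ 2 * ε * #X + (#(R.filter b1) + #(R.filter b2)) := by
        have e1 : #(X.filter b1) ≤ #(R.filter b1) := card_le_card (filter_subset_filter _ hX)
        have e2 : #(X.filter fun x => b2 (x + (t' - t))) ≤ #(R.filter b2) := ?_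
        · gcongr
        refine card_le_card_of_injOn (fun x => x + (t' - t)) ?_ ?_
        · intro x hx
          simp only [coe_filter, Set.mem_ofPred_eq] at hx ⊢
          exact ⟨hX' x hx.1, hx.2⟩
        · intro x _ y _ hxy
          simpa using hxy
    _ ≤ _ := by
        have e1 : (#(R.filter b1) : ℝ) ≤ 4 * κ * #R := by convert hbt
        have e2 : (#(R.filter b2) : ℝ) ≤ 4 * κ * #R := by convert hbt'
        linarith

omit [Fintype G] [DecidableEq G] in
lemma sum_abs_iterate_le {T R X : Finset G} {g : G → ℝ} {M : ℝ}
    (hT : ∀ t ∈ T, ∀ t' ∈ T, ∀ Y ⊆ R, #Y ≤ #X → (∀ x ∈ Y, x + (t' - t) ∈ R) →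
      ∑ x ∈ Y, |g (x + (t' - t)) - g x| ≤ M) (k : ℕ)
    (hR : ∀ x ∈ X, ∀ j ≤ k, ∀ t t' : Fin j → G, (∀ i, t i ∈ T) → (∀ i, t' i ∈ T) →
      x + ∑ i, (t' i - t i) ∈ R) (t t' : Fin k → G) (ht : ∀ i, t i ∈ T) (ht' : ∀ i, t' i ∈ T) :
    ∑ x ∈ X, |g (x + ∑ i, (t' i - t i)) - g x| ≤ k * M := by
  induction k with
  | zero => simp
  | succ k ih =>
    have h1 := ih (fun x hx j hj => hR x hx j (hj.trans (Nat.le_succ k)))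
      (fun i => t i.castSucc) (fun i => t' i.castSucc) (fun i => ht _) (fun i => ht' _)
    set σ := ∑ i : Fin k, (t' i.castSucc - t i.castSucc) with hσ
    set τ := t' (Fin.last k) - t (Fin.last k) with hτ
    have hs : ∑ i, (t' i - t i) = σ + τ := Fin.sum_univ_castSucc _
    have hmap : ∀ F : G → ℝ, ∑ x ∈ X, F (x + σ) = ∑ y ∈ X.map (addRightEmbedding σ), F y := by
      intro F; simp
    have h2 := hT _ (ht (Fin.last k)) _ (ht' (Fin.last k)) (X.map (addRightEmbedding σ)) ?_
      (by simp) ?_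
    · rw [← hmap (fun y => |g (y + (t' (Fin.last k) - t (Fin.last k))) - g y|)] at h2
      rw [hs]
      push_cast
      calc _ ≤ ∑ x ∈ X, (|g (x + σ + τ) - g (x + σ)| + |g (x + σ) - g x|) := by
            refine sum_le_sum fun x _ => ?_
            rw [← add_assoc]
            exact abs_sub_le _ _ _
        _ ≤ _ := by rw [sum_add_distrib]; linarith
    · intro y hy
      simp only [mem_map, addRightEmbedding_apply] at hy
      obtain ⟨x, hx, rfl⟩ := hy
      exact hR x hx k (Nat.le_succ k) _ _ (fun i => ht _) (fun i => ht' _)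
    · intro y hy
      simp only [mem_map, addRightEmbedding_apply] at hy
      obtain ⟨x, hx, rfl⟩ := hy
      have h := hR x hx _ le_rfl _ _ ht ht'
      rwa [hs, ← add_assoc] at h

/-- Fourier transform of the indicator of `T`. -/
noncomputable def hat (T : Finset G) (ψ : AddChar G ℂ) : ℂ := ∑ x ∈ T, ψ x

def IsDissociated (E : Finset G) (Λ : Finset (AddChar G ℂ)) : Prop :=
  ∀ e : AddChar G ℂ → ℤ, (∀ l, e l ∈ ({-1, 0, 1} : Finset ℤ)) → (∃ l ∈ Λ, e l ≠ 0) →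
    2 * ‖hat E (∏ l ∈ Λ, l ^ e l)‖ ≤ #E

lemma norm_one_sub_mul_le {a b : ℂ} (ha : ‖a‖ = 1) : ‖1 - a * b‖ ≤ ‖1 - a‖ + ‖1 - b‖ := by
  calc ‖1 - a * b‖ = ‖(1 - a) + a * (1 - b)‖ := by congr 1; ring
    _ ≤ ‖1 - a‖ + ‖a * (1 - b)‖ := norm_add_le _ _
    _ = _ := by rw [norm_mul, ha, one_mul]

omit [DecidableEq G] in
lemma norm_one_sub_inv_apply (ψ : AddChar G ℂ) (y : G) : ‖1 - ψ⁻¹ y‖ = ‖1 - ψ y‖ := by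
  rw [AddChar.inv_apply', AddChar.inv_apply_eq_conj, ← Complex.norm_conj (1 - ψ y), map_sub,
    map_one]

omit [DecidableEq G] in
lemma norm_one_sub_zpow_le (ψ : AddChar G ℂ) {e : ℤ} (he : e ∈ ({-1, 0, 1} : Finset ℤ)) (y : G) :
    ‖1 - (ψ ^ e) y‖ ≤ ‖1 - ψ y‖ := by
  simp only [mem_insert, mem_singleton] at he
  rcases he with rfl | rfl | rfl
  · rw [zpow_neg_one, norm_one_sub_inv_apply]
  · simp
  · simp

omit [DecidableEq G] in
lemma norm_one_sub_prod_le (s : Finset (AddChar G ℂ)) (F : AddChar G ℂ → AddChar G ℂ) (y : G) :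
    ‖1 - (∏ l ∈ s, F l) y‖ ≤ ∑ l ∈ s, ‖1 - F l y‖ := by
  classical
  induction s using Finset.induction_on with
  | empty => simp
  | insert a s ha ih =>
    rw [prod_insert ha, sum_insert ha, AddChar.mul_apply]
    exact (norm_one_sub_mul_le (AddChar.norm_apply _ _)).trans (by gcongr)

lemma norm_one_sub_le_of_hat {E : Finset G} (hE : E.Nonempty) {θ : AddChar G ℂ}
    (hθ : (#E : ℝ) ≤ 2 * ‖hat E θ‖) {y : G} {η : ℝ}
    (hy : (#(E.filter fun x => x + y ∉ E) : ℝ) ≤ η * #E) : ‖1 - θ y‖ ≤ 4 * η := by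
  have hEc : (0 : ℝ) < #E := by exact_mod_cast hE.card_pos
  set E' := E.map (addRightEmbedding y) with hE'
  have h1 : hat E θ * θ y = ∑ x ∈ E', θ x := by
    rw [hE', sum_map, hat, sum_mul]
    simp [AddChar.map_add_eq_mul]
  have hc1 : #(E' \ E) = #(E.filter fun x => x + y ∉ E) := by
    rw [← card_map (addRightEmbedding y) (s := E.filter _)]
    congr 1
    ext z
    simp only [hE', mem_sdiff, mem_map, mem_filter, addRightEmbedding_apply]
    constructor
    · rintro ⟨⟨x, hx, rfl⟩, hz⟩; exact ⟨x, ⟨hx, hz⟩, rfl⟩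
    · rintro ⟨x, ⟨hx, hz⟩, rfl⟩; exact ⟨⟨x, hx, rfl⟩, hz⟩
  have hc2 : #(E \ E') = #(E' \ E) := by
    have h1 := card_sdiff_add_card_inter E E'
    have h2 := card_sdiff_add_card_inter E' E
    have h3 : #E' = #E := card_map _
    rw [inter_comm] at h2
    omega
  have hb : ∀ S : Finset G, ‖∑ x ∈ S, θ x‖ ≤ #S := by
    intro S
    refine (norm_sum_le _ _).trans ?_
    simp
  have h2 : hat E θ * (1 - θ y) = ∑ x ∈ E \ E', θ x - ∑ x ∈ E' \ E, θ x := by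
    rw [mul_sub, h1, mul_one, hat]
    have := sum_sdiff_sub_sum_sdiff (s₁ := E') (s₂ := E) (f := fun x => θ x)
    exact this.symm
  have h3 : ‖hat E θ‖ * ‖1 - θ y‖ ≤ 2 * (η * #E) := by
    rw [← norm_mul, h2]
    refine (norm_sub_le _ _).trans ?_
    have := hb (E \ E'); have := hb (E' \ E)
    rw [hc2] at *
    rw [hc1] at *
    linarith
  have h4 : (#E : ℝ) * ‖1 - θ y‖ ≤ #E * (4 * η) := by
    nlinarith [norm_nonneg (1 - θ y)]
  exact le_of_mul_le_mul_left h4 hEc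

/-- The coefficients of a Riesz factor. -/
noncomputable def rieszCoeff (c : ℂ) (e : ℤ) : ℂ :=
  if e = 0 then (Real.cosh (1 / 2) : ℂ) else
    if e = 1 then (Real.sinh (1 / 2) / 2 : ℂ) * c else (Real.sinh (1 / 2) / 2 : ℂ) * star c

omit [DecidableEq G] in
lemma sum_rieszCoeff (c : ℂ) (ψ : AddChar G ℂ) (x : G) :
    ((Real.cosh (1 / 2) + (c * ψ x).re * Real.sinh (1 / 2) : ℝ) : ℂ) =
      ∑ e ∈ ({-1, 0, 1} : Finset ℤ), rieszCoeff c e * (ψ ^ e) x := by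
  rw [sum_insert (by decide), sum_insert (by decide), sum_singleton]
  simp only [rieszCoeff, zpow_neg_one, AddChar.inv_apply', AddChar.inv_apply_eq_conj, zpow_zero,
    zpow_one]
  push_cast
  rw [Complex.re_eq_add_conj]
  simp
  ring

lemma sum_norm_rieszCoeff {c : ℂ} (hc : ‖c‖ ≤ 1) :
    ∑ e ∈ ({-1, 0, 1} : Finset ℤ), ‖rieszCoeff c e‖ ≤ 2 * Real.cosh (1 / 2) := by
  rw [sum_insert (by decide), sum_insert (by decide), sum_singleton]
  have hs : 0 < Real.sinh (1 / 2) := Real.sinh_pos_iff.2 (by norm_num)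
  have hc0 := Real.cosh_pos (1 / 2)
  have e0 : ‖rieszCoeff c 0‖ = Real.cosh (1 / 2) := by
    simp only [rieszCoeff, if_true, Complex.norm_real, Real.norm_eq_abs, abs_of_pos hc0]
  have e1 : ‖rieszCoeff c 1‖ = Real.sinh (1 / 2) / 2 * ‖c‖ := by
    rw [rieszCoeff, if_neg (by decide), if_pos rfl, norm_mul, norm_div, Complex.norm_real,
      Real.norm_eq_abs, abs_of_pos hs, Complex.norm_ofNat]
  have e2 : ‖rieszCoeff c (-1)‖ = Real.sinh (1 / 2) / 2 * ‖c‖ := by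
    rw [rieszCoeff, if_neg (by decide), if_neg (by decide), norm_mul, norm_div,
      Complex.norm_real, Real.norm_eq_abs, abs_of_pos hs, Complex.norm_ofNat, norm_star]
  rw [e0, e1, e2]
  have : Real.sinh (1 / 2) ≤ Real.cosh (1 / 2) := (Real.sinh_lt_cosh _).le
  nlinarith


omit [DecidableEq G] in
lemma prod_riesz {ι : Type*} [Fintype ι] [DecidableEq ι] (c : ι → ℂ) (l : ι → AddChar G ℂ) (x : G) :
    ((∏ i, (Real.cosh (1 / 2) + (c i * l i x).re * Real.sinh (1 / 2)) : ℝ) : ℂ) =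
      ∑ e ∈ Fintype.piFinset fun _ : ι => ({-1, 0, 1} : Finset ℤ),
        (∏ i, rieszCoeff (c i) (e i)) * (∏ i, l i ^ e i) x := by
  rw [Complex.ofReal_prod]
  simp_rw [sum_rieszCoeff]
  rw [prod_univ_sum]
  refine sum_congr rfl fun e _ => ?_
  rw [prod_mul_distrib]
  congr 1
  simp [AddChar.coe_prod]

omit [DecidableEq G] [Fintype G] in
lemma map_sum_eq_prod {ι : Type*} (θ : AddChar G ℂ) (s : Finset ι) (t : ι → G) :
    θ (∑ i ∈ s, t i) = ∏ i ∈ s, θ (t i) := by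
  classical
  induction s using Finset.induction_on with
  | empty => simp
  | insert a s ha ih => rw [sum_insert ha, prod_insert ha, AddChar.map_add_eq_mul, ih]

omit [DecidableEq G] in
omit [Fintype G] in
lemma sum_shift_eq (E : Finset G) (θ : AddChar G ℂ) (M : ℕ) (x : G) :
    ∑ t ∈ Fintype.piFinset fun _ : Fin M => E, θ (x + ∑ i, t i) = θ x * hat E θ ^ M := by
  have := prod_univ_sum (fun _ : Fin M => E) (fun _ v => θ v)
  simp only [prod_const, card_univ, Fintype.card_fin] at this
  rw [hat, this, mul_sum]
  refine sum_congr rfl fun t _ => ?_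
  rw [AddChar.map_add_eq_mul, map_sum_eq_prod]

omit [DecidableEq G] in
lemma sum_riesz_le {ι : Type*} [Fintype ι] [DecidableEq ι] {c : ι → ℂ} (hc : ∀ i, ‖c i‖ ≤ 1)
    {l : ι → AddChar G ℂ} {E F : Finset G}
    (hl : ∀ e : ι → ℤ, (∀ i, e i ∈ ({-1, 0, 1} : Finset ℤ)) → e ≠ 0 →
      2 * ‖hat E (∏ i, l i ^ e i)‖ ≤ #E) {M : ℕ} (hM : Fintype.card ι ≤ M) :
    ∑ t ∈ Fintype.piFinset fun _ : Fin M => E, ∑ x ∈ F,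
      ∏ i, (Real.cosh (1 / 2) + (c i * l i (x + ∑ j, t j)).re * Real.sinh (1 / 2))
      ≤ 2 * Real.cosh (1 / 2) ^ Fintype.card ι * #F * #E ^ M := by
  set C := Real.cosh (1 / 2) with hC
  have hC0 : 0 < C := Real.cosh_pos _
  set P := Fintype.piFinset fun _ : ι => ({-1, 0, 1} : Finset ℤ) with hP
  set m := Fintype.card ι with hm
  have key : ((∑ t ∈ Fintype.piFinset fun _ : Fin M => E, ∑ x ∈ F,
      ∏ i, (C + (c i * l i (x + ∑ j, t j)).re * Real.sinh (1 / 2)) : ℝ) : ℂ)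
      = ∑ e ∈ P, ∑ x ∈ F, (∏ i, rieszCoeff (c i) (e i)) *
          ((∏ i, l i ^ e i) x * hat E (∏ i, l i ^ e i) ^ M) := by
    rw [sum_comm, Complex.ofReal_sum, sum_comm (s := P)]
    refine sum_congr rfl fun x _ => ?_
    rw [Complex.ofReal_sum]
    simp_rw [hC, prod_riesz]
    rw [sum_comm]
    refine sum_congr rfl fun e _ => ?_
    rw [← mul_sum, sum_shift_eq]
  have hterm : ∀ e : ι → ℤ, ‖∑ x ∈ F, (∏ i, rieszCoeff (c i) (e i)) *
      ((∏ i, l i ^ e i) x * hat E (∏ i, l i ^ e i) ^ M)‖ ≤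
      (∏ i, ‖rieszCoeff (c i) (e i)‖) * (#F * ‖hat E (∏ i, l i ^ e i)‖ ^ M) := by
    intro e
    refine (norm_sum_le _ _).trans ?_
    simp only [norm_mul, norm_prod, norm_pow, AddChar.norm_apply, one_mul, sum_const, nsmul_eq_mul]
    apply le_of_eq; ring
  have h0P : (0 : ι → ℤ) ∈ P := by simp [hP]
  have hhat : ∀ θ : AddChar G ℂ, ‖hat E θ‖ ≤ #E := by
    intro θ
    refine (norm_sum_le _ _).trans ?_
    simp
  have hzero : ‖∑ x ∈ F, (∏ i, rieszCoeff (c i) ((0 : ι → ℤ) i)) *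
      ((∏ i, l i ^ (0 : ι → ℤ) i) x * hat E (∏ i, l i ^ (0 : ι → ℤ) i) ^ M)‖ ≤
      C ^ m * (#F * #E ^ M) := by
    refine (hterm 0).trans ?_
    have : ∀ i, ‖rieszCoeff (c i) ((0 : ι → ℤ) i)‖ = C := by
      intro i
      rw [rieszCoeff, Pi.zero_apply, if_pos rfl, Complex.norm_real, Real.norm_eq_abs,
        abs_of_pos hC0]
    simp_rw [this]
    rw [prod_const, card_univ]
    gcongr
    exact hhat _
  have hrest : ∑ e ∈ P.erase 0, ‖∑ x ∈ F, (∏ i, rieszCoeff (c i) (e i)) *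
      ((∏ i, l i ^ e i) x * hat E (∏ i, l i ^ e i) ^ M)‖ ≤ C ^ m * (#F * #E ^ M) := by
    calc _ ≤ ∑ e ∈ P.erase 0, (∏ i, ‖rieszCoeff (c i) (e i)‖) * (#F * (#E / 2) ^ M) := by
          refine sum_le_sum fun e he => (hterm e).trans ?_
          obtain ⟨h1, h2⟩ := mem_erase.1 he
          gcongr
          have := hl e (Fintype.mem_piFinset.1 h2) h1
          linarith
      _ ≤ ∑ e ∈ P, (∏ i, ‖rieszCoeff (c i) (e i)‖) * (#F * (#E / 2) ^ M) :=
          sum_le_sum_of_subset_of_nonneg (erase_subset _ _) fun e _ _ => by positivity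
      _ = (∏ i, ∑ e ∈ ({-1, 0, 1} : Finset ℤ), ‖rieszCoeff (c i) e‖) * (#F * (#E / 2) ^ M) := by
          rw [← sum_mul, prod_univ_sum]
      _ ≤ (∏ i : ι, 2 * C) * (#F * (#E / 2) ^ M) := by
          gcongr with i
          exact sum_norm_rieszCoeff (hc i)
      _ = C ^ m * (#F * #E ^ M) * (2 ^ m / 2 ^ M) := by
          rw [prod_const, card_univ, mul_pow, div_pow]; ring
      _ ≤ C ^ m * (#F * #E ^ M) * 1 := by
          gcongr
          rw [div_le_one (by positivity)]
          exact pow_le_pow_right₀ (by norm_num) hM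
      _ = _ := mul_one _
  calc _ ≤ ‖((∑ t ∈ Fintype.piFinset fun _ : Fin M => E, ∑ x ∈ F,
      ∏ i, (C + (c i * l i (x + ∑ j, t j)).re * Real.sinh (1 / 2)) : ℝ) : ℂ)‖ := by
        rw [Complex.norm_real]; exact le_abs_self _
    _ ≤ ∑ e ∈ P, ‖∑ x ∈ F, (∏ i, rieszCoeff (c i) (e i)) *
          ((∏ i, l i ^ e i) x * hat E (∏ i, l i ^ e i) ^ M)‖ := by
        rw [key]; exact norm_sum_le _ _
    _ ≤ C ^ m * (#F * #E ^ M) + C ^ m * (#F * #E ^ M) := by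
        rw [← add_sum_erase _ _ h0P]
        exact add_le_add hzero hrest
    _ = _ := by ring

omit [DecidableEq G] in
lemma card_dissociated_le {ι : Type*} [Fintype ι] [DecidableEq ι] {l : ι → AddChar G ℂ}
    {T E F : Finset G} (hE : E.Nonempty) (hT : T.Nonempty)
    (hl : ∀ e : ι → ℤ, (∀ i, e i ∈ ({-1, 0, 1} : Finset ℤ)) → e ≠ 0 →
      2 * ‖hat E (∏ i, l i ^ e i)‖ ≤ #E) {M : ℕ} (hM : Fintype.card ι ≤ M)
    (hF : ∀ x ∈ T, ∀ t : Fin M → G, (∀ i, t i ∈ E) → x - ∑ i, t i ∈ F)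
    (hspec : ∀ i, (#T : ℝ) ≤ 2 * ‖hat T (l i)‖) :
    Real.exp (Fintype.card ι / 8) * #T ≤ 2 * #F := by
  set m := Fintype.card ι with hm
  have hTc : (0 : ℝ) < #T := by exact_mod_cast hT.card_pos
  have hEc : (0 : ℝ) < (#E : ℝ) ^ M := by have := hE.card_pos; positivity
  have hc : ∀ z : ℂ, ∃ c : ℂ, ‖c‖ ≤ 1 ∧ (c * z).re = ‖z‖ := by
    intro z
    by_cases hz : z = 0
    · exact ⟨0, by simp, by simp [hz]⟩
    · have hz' : (‖z‖ : ℂ) ≠ 0 := by simpa using hz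
      refine ⟨star z / ‖z‖, by simp [hz], ?_⟩
      have : star z / ‖z‖ * z = (‖z‖ : ℂ) := by
        rw [div_mul_eq_mul_div, div_eq_iff hz']
        have := Complex.conj_mul' z
        rw [← pow_two]
        exact this
      rw [this, Complex.ofReal_re]
  choose c' hc1 hc2 using hc
  set c : ι → ℂ := fun i => c' (hat T (l i)) with hcdef
  set H : G → ℝ := fun x => ∏ i, (Real.cosh (1 / 2) + (c i * l i x).re * Real.sinh (1 / 2)) with hH
  set y : G → ℝ := fun x => ∑ i, (c i * l i x).re * (1 / 2) with hy
  have hexp : ∀ x, Real.exp (y x) ≤ H x := by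
    intro x
    rw [hy, Real.exp_sum, hH]
    refine prod_le_prod (fun i _ => (Real.exp_pos _).le) fun i _ => ?_
    refine Real.exp_mul_le_cosh_add_mul_sinh ?_ _
    refine (Complex.abs_re_le_norm _).trans ?_
    rw [norm_mul, AddChar.norm_apply, mul_one]
    exact hc1 _
  have hH0 : ∀ x, 0 ≤ H x := fun x => (Real.exp_pos _).le.trans (hexp x)
  have hsumy : #T * (m / 4 : ℝ) ≤ ∑ x ∈ T, y x := by
    rw [hy, sum_comm]
    have : ∀ i, (#T : ℝ) / 4 ≤ ∑ x ∈ T, (c i * l i x).re * (1 / 2) := by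
      intro i
      rw [← sum_mul, ← Complex.re_sum, ← mul_sum]
      have h1 : (c i * ∑ x ∈ T, l i x).re = ‖hat T (l i)‖ := hc2 _
      rw [h1]
      linarith [hspec i]
    calc #T * (m / 4 : ℝ) = ∑ i : ι, (#T : ℝ) / 4 := by
          rw [sum_const, card_univ, nsmul_eq_mul]; ring
      _ ≤ _ := sum_le_sum fun i _ => this i
  have hlow : Real.exp (m / 4) * #T ≤ ∑ x ∈ T, H x := by
    calc Real.exp (m / 4) * #T ≤ Real.exp (m / 4) * (#T + (∑ x ∈ T, y x - #T * (m / 4))) := by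
          gcongr; linarith
      _ = ∑ x ∈ T, Real.exp (m / 4) * ((y x - m / 4) + 1) := by
          rw [← mul_sum, sum_add_distrib, sum_sub_distrib]
          simp only [sum_const, nsmul_eq_mul]
          ring
      _ ≤ ∑ x ∈ T, Real.exp (y x) := by
          refine sum_le_sum fun x _ => ?_
          rw [show y x = m / 4 + (y x - m / 4) by ring, Real.exp_add]
          gcongr
          have := Real.add_one_le_exp (y x - m / 4)
          ring_nf at this ⊢
          linarith
      _ ≤ _ := sum_le_sum fun x _ => hexp x
  have hup := sum_riesz_le (c := c) (fun i => hc1 _) (F := F) hl hM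
  have hmid : (∑ x ∈ T, H x) * #E ^ M ≤ ∑ t ∈ Fintype.piFinset fun _ : Fin M => E, ∑ x ∈ F,
      H (x + ∑ j, t j) := by
    have : (∑ x ∈ T, H x) * #E ^ M = ∑ t ∈ Fintype.piFinset fun _ : Fin M => E, ∑ x ∈ T, H x := by
      simp; ring
    rw [this]
    refine sum_le_sum fun t ht => ?_
    rw [Fintype.mem_piFinset] at ht
    calc ∑ x ∈ T, H x = ∑ x ∈ T.map (addRightEmbedding (-∑ j, t j)), H (x + ∑ j, t j) := by
          rw [sum_map]; simp
      _ ≤ _ := by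
          refine sum_le_sum_of_subset_of_nonneg ?_ fun x _ _ => hH0 _
          intro x hx
          simp only [mem_map, addRightEmbedding_apply] at hx
          obtain ⟨z, hz, rfl⟩ := hx
          rw [← sub_eq_add_neg]
          exact hF z hz t ht
  have hcosh : Real.cosh (1 / 2) ^ m ≤ Real.exp (m / 8) := by
    calc _ ≤ (Real.exp ((1 / 2) ^ 2 / 2)) ^ m := by
          have := Real.cosh_pos (1 / 2)
          gcongr
          exact Real.cosh_le_exp_half_sq _
      _ = _ := by rw [← Real.exp_nat_mul]; congr 1; ring
  have h1 : Real.exp (m / 4) * #T * #E ^ M ≤ 2 * Real.exp (m / 8) * #F * #E ^ M := by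
    calc _ ≤ (∑ x ∈ T, H x) * #E ^ M := by gcongr
      _ ≤ _ := hmid
      _ ≤ _ := hup
      _ ≤ _ := by gcongr
  have h2 := le_of_mul_le_mul_right h1 hEc
  rw [show (m / 4 : ℝ) = m / 8 + m / 8 by ring, Real.exp_add] at h2
  refine le_of_mul_le_mul_left ?_ (Real.exp_pos (m / 8 : ℝ))
  linarith

/-- Chang's lemma relative to a sequence of nested sets. -/
lemma exists_spectrum_basis {T E F : Finset G} (hT : T.Nonempty) (hE : E.Nonempty) {M : ℕ}
    (hF : ∀ x ∈ T, ∀ t : Fin M → G, (∀ i, t i ∈ E) → x - ∑ i, t i ∈ F)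
    (hM : 2 * (#F : ℝ) < Real.exp (M / 8) * #T) :
    ∃ Λ : Finset (AddChar G ℂ), #Λ ≤ M ∧ ∀ y η r,
      (#(E.filter fun x => x + y ∉ E) : ℝ) ≤ η * #E → (∀ l ∈ Λ, ‖1 - l y‖ ≤ r) → 0 ≤ r → 0 ≤ η →
      ∀ ψ : AddChar G ℂ, (#T : ℝ) ≤ 2 * ‖hat T ψ‖ → ‖1 - ψ y‖ ≤ M * r + 4 * η := by
  classical
  set D := (univ : Finset (Finset (AddChar G ℂ))).filter fun Λ => #Λ ≤ M ∧ IsDissociated E Λ ∧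
    ∀ l ∈ Λ, (#T : ℝ) ≤ 2 * ‖hat T l‖ with hD
  have hDne : D.Nonempty := ⟨∅, by simp [hD, IsDissociated]⟩
  obtain ⟨Λ, hΛ, hmax⟩ := exists_max_image D card hDne
  simp only [hD, mem_filter, mem_univ, true_and] at hΛ hmax
  obtain ⟨hΛM, hΛd, hΛs⟩ := hΛ
  have hlt : #Λ < M := by
    refine lt_of_le_of_ne hΛM fun heq => ?_
    have h1 := card_dissociated_le (ι := Λ) (l := fun i => i.1) hE hT ?_
      (M := M) (by simp [heq]) hF (fun i => hΛs _ i.2)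
    · rw [Fintype.card_coe, heq] at h1
      linarith
    · intro e he hne
      obtain ⟨i, hi⟩ := Function.ne_iff.1 hne
      have h2 := hΛd (fun a => if h : a ∈ Λ then e ⟨a, h⟩ else 0) ?_ ⟨i.1, i.2, by simpa using hi⟩
      · convert h2 using 4
        rw [← prod_coe_sort Λ]
        refine prod_congr rfl fun j _ => ?_
        simp
      · intro a
        split_ifs
        · exact he _
        · simp
  refine ⟨Λ, hΛM, ?_⟩
  intro y η r hη hr hr0 hη0 ψ hψ
  have hsum : ∑ l ∈ Λ, ‖1 - l y‖ ≤ M * r := by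
    calc _ ≤ ∑ l ∈ Λ, r := sum_le_sum hr
      _ = #Λ * r := by simp
      _ ≤ _ := by gcongr
  by_cases hmem : ψ ∈ Λ
  · have := single_le_sum (f := fun l : AddChar G ℂ => ‖1 - l y‖) (fun l _ => norm_nonneg _) hmem
    linarith
  have hnd : ¬ IsDissociated E (insert ψ Λ) := by
    intro hd
    have := hmax (insert ψ Λ) ⟨by rw [card_insert_of_notMem hmem]; omega, hd, by
      intro l hl
      rcases mem_insert.1 hl with rfl | hl
      · exact hψ
      · exact hΛs l hl⟩
    rw [card_insert_of_notMem hmem] at this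
    omega
  unfold IsDissociated at hnd
  push Not at hnd
  obtain ⟨e, he, ⟨l₀, hl₀, hl₀e⟩, hlarge⟩ := hnd
  have heψ : e ψ ≠ 0 := by
    intro h0
    rw [prod_insert hmem, h0, zpow_zero, one_mul] at hlarge
    have := hΛd e he ⟨l₀, (mem_insert.1 hl₀).resolve_left (by rintro rfl; exact hl₀e h0), hl₀e⟩
    linarith
  set θ := ∏ l ∈ insert ψ Λ, l ^ e l with hθ
  have hθy := norm_one_sub_le_of_hat hE hlarge.le hη
  have hψe : ψ ^ e ψ = θ * ∏ l ∈ Λ, (l ^ e l)⁻¹ := by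
    rw [hθ, prod_insert hmem, prod_inv_distrib, mul_inv_cancel_right]
  have h1 : ‖1 - (ψ ^ e ψ) y‖ ≤ 4 * η + M * r := by
    rw [hψe, AddChar.mul_apply]
    refine (norm_one_sub_mul_le (AddChar.norm_apply _ _)).trans (add_le_add hθy ?_)
    refine (norm_one_sub_prod_le _ _ _).trans (le_trans ?_ hsum)
    refine sum_le_sum fun l _ => ?_
    rw [norm_one_sub_inv_apply]
    exact norm_one_sub_zpow_le _ (he l) _
  have h2 : ‖1 - (ψ ^ e ψ) y‖ = ‖1 - ψ y‖ := by
    have := he ψ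
    simp only [mem_insert, mem_singleton] at this
    rcases this with h | h | h
    · rw [h, zpow_neg_one, norm_one_sub_inv_apply]
    · exact absurd h heψ
    · rw [h, zpow_one]
  linarith

omit [DecidableEq G] in
lemma hat_inv (S : Finset G) (ψ : AddChar G ℂ) : hat S ψ⁻¹ = star (hat S ψ) := by
  simp only [hat, star_sum]
  refine sum_congr rfl fun x _ => ?_
  rw [AddChar.inv_apply', AddChar.inv_apply_eq_conj]
  rfl

omit [Fintype G] [DecidableEq G] in
lemma norm_hat_le [Finite G] (S : Finset G) (ψ : AddChar G ℂ) : ‖hat S ψ‖ ≤ #S := by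
  refine (norm_sum_le _ _).trans ?_
  simp

lemma sum_norm_hat_sq (S : Finset G) :
    ∑ ψ : AddChar G ℂ, ‖hat S ψ‖ ^ 2 = Fintype.card G * #S := by
  have h : ((∑ ψ : AddChar G ℂ, ‖hat S ψ‖ ^ 2 : ℝ) : ℂ) = (Fintype.card G * #S : ℂ) := by
    rw [Complex.ofReal_sum]
    calc ∑ ψ : AddChar G ℂ, ((‖hat S ψ‖ ^ 2 : ℝ) : ℂ)
        = ∑ ψ : AddChar G ℂ, ∑ x ∈ S, ∑ y ∈ S, ψ (x - y) := by
          refine sum_congr rfl fun ψ _ => ?_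
          push_cast
          rw [← Complex.mul_conj' (hat S ψ)]
          have : (starRingEnd ℂ) (hat S ψ) = hat S ψ⁻¹ := (hat_inv S ψ).symm
          rw [this, hat, hat, sum_mul_sum]
          refine sum_congr rfl fun x _ => sum_congr rfl fun y _ => ?_
          rw [AddChar.inv_apply, ← AddChar.map_add_eq_mul, sub_eq_add_neg]
      _ = ∑ x ∈ S, ∑ y ∈ S, ∑ ψ : AddChar G ℂ, ψ (x - y) := by
          rw [sum_comm]
          exact sum_congr rfl fun x _ => sum_comm
      _ = _ := by
          simp_rw [AddChar.sum_apply_eq_ite, sub_eq_zero]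
          simp [mul_comm]
  exact_mod_cast h

lemma card_mul_ind (S : Finset G) (w : G) :
    ((Fintype.card G * ind S w : ℝ) : ℂ) = ∑ ψ : AddChar G ℂ, hat S ψ⁻¹ * ψ w := by
  simp_rw [hat, sum_mul, AddChar.inv_apply, ← AddChar.map_add_eq_mul]
  rw [sum_comm]
  simp_rw [AddChar.sum_apply_eq_ite, neg_add_eq_zero]
  by_cases hw : w ∈ S <;> simp [ind, hw]

/-- The number of weighted representations used to smooth `S` over the almost periods. -/
noncomputable def smooth (S U V T : Finset G) (k : ℕ) (y : G) : ℝ :=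
  ∑ x ∈ U, ∑ a ∈ V, ∑ t ∈ Fintype.piFinset fun _ : Fin k => T,
    ∑ t' ∈ Fintype.piFinset fun _ : Fin k => T, ind S (x - a + ∑ i, (t' i - t i) + y)

lemma card_mul_smooth (S U V T : Finset G) (k : ℕ) (y : G) :
    ((Fintype.card G * smooth S U V T k y : ℝ) : ℂ) = ∑ ψ : AddChar G ℂ,
      hat S ψ⁻¹ * hat U ψ * hat V ψ⁻¹ * hat T ψ⁻¹ ^ k * hat T ψ ^ k * ψ y := by
  have hpow : ∀ ψ : AddChar G ℂ, hat T ψ ^ k =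
      ∑ t ∈ Fintype.piFinset fun _ : Fin k => T, ψ (∑ i, t i) := by
    intro ψ
    have := sum_shift_eq T ψ k 0
    simp only [zero_add, AddChar.map_zero_eq_one, one_mul] at this
    exact this.symm
  simp only [smooth, mul_sum]
  simp_rw [Complex.ofReal_sum, card_mul_ind]
  have : ∀ ψ : AddChar G ℂ, hat S ψ⁻¹ * hat U ψ * hat V ψ⁻¹ * hat T ψ⁻¹ ^ k * hat T ψ ^ k * ψ y
      = ∑ x ∈ U, ∑ a ∈ V, ∑ t ∈ Fintype.piFinset fun _ : Fin k => T,
        ∑ t' ∈ Fintype.piFinset fun _ : Fin k => T,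
          hat S ψ⁻¹ * ψ (x - a + ∑ i, (t' i - t i) + y) := by
    intro ψ
    rw [hpow, hpow]
    have e : ∀ (x a : G) (t t' : Fin k → G), hat S ψ⁻¹ * ψ (x - a + ∑ i, (t' i - t i) + y)
        = hat S ψ⁻¹ * ψ y * (ψ x * (ψ⁻¹ a * (ψ⁻¹ (∑ i, t i) * ψ (∑ i, t' i)))) := by
      intro x a t t'
      rw [AddChar.inv_apply, AddChar.inv_apply, sum_sub_distrib, sub_eq_add_neg, sub_eq_add_neg]
      simp only [AddChar.map_add_eq_mul]
      ring
    simp_rw [e, ← mul_sum, ← sum_mul]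
    simp only [hat]
    ring
  simp_rw [this]
  rw [sum_comm (s := univ)]
  refine sum_congr rfl fun x _ => ?_
  rw [sum_comm (s := univ)]
  refine sum_congr rfl fun a _ => ?_
  rw [sum_comm (s := univ)]
  refine sum_congr rfl fun t _ => ?_
  rw [sum_comm (s := univ)]

lemma abs_smooth_sub_le {S U V T R : Finset G} (hS : S ⊆ R) (hU : U ⊆ R) {k : ℕ} {c : ℝ}
    (hk : 2 ≤ c * 4 ^ k) {y : G}
    (hy : ∀ ψ : AddChar G ℂ, (#T : ℝ) ≤ 2 * ‖hat T ψ‖ → ‖1 - ψ y‖ ≤ c) :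
    |smooth S U V T k y - smooth S U V T k 0| ≤ c * #R * #V * #T ^ (2 * k) := by
  have hc : 0 ≤ c := by
    by_contra h
    have : (0 : ℝ) < 4 ^ k := by positivity
    nlinarith
  have hG : (0 : ℝ) < Fintype.card G := by
    have := Fintype.card_pos (α := G)
    exact_mod_cast this
  set Q : AddChar G ℂ → ℂ := fun ψ =>
    hat S ψ⁻¹ * hat U ψ * hat V ψ⁻¹ * hat T ψ⁻¹ ^ k * hat T ψ ^ k with hQ
  have key : ((Fintype.card G * (smooth S U V T k y - smooth S U V T k 0) : ℝ) : ℂ) =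
      ∑ ψ : AddChar G ℂ, Q ψ * (ψ y - 1) := by
    rw [mul_sub, Complex.ofReal_sub, card_mul_smooth, card_mul_smooth, ← sum_sub_distrib]
    refine sum_congr rfl fun ψ _ => ?_
    rw [AddChar.map_zero_eq_one]; ring
  have hinv : ∀ (X : Finset G) (ψ : AddChar G ℂ), ‖hat X ψ⁻¹‖ = ‖hat X ψ‖ := by
    intro X ψ; rw [hat_inv, norm_star]
  have hterm : ∀ ψ : AddChar G ℂ, ‖Q ψ * (ψ y - 1)‖ ≤
      (c * #V * #T ^ (2 * k)) * ((‖hat S ψ‖ ^ 2 + ‖hat U ψ‖ ^ 2) / 2) := by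
    intro ψ
    have h1 : ‖hat T ψ‖ ^ (2 * k) * ‖1 - ψ y‖ ≤ c * #T ^ (2 * k) := by
      by_cases hs : (#T : ℝ) ≤ 2 * ‖hat T ψ‖
      · rw [mul_comm c]
        gcongr
        · exact norm_hat_le _ _
        · exact hy ψ hs
      · have h2 : ‖hat T ψ‖ ≤ #T / 2 := by linarith
        have h3 : ‖1 - ψ y‖ ≤ 2 := by
          refine (norm_sub_le _ _).trans ?_
          rw [AddChar.norm_apply, norm_one]; norm_num
        calc ‖hat T ψ‖ ^ (2 * k) * ‖1 - ψ y‖ ≤ (#T / 2) ^ (2 * k) * 2 := by gcongr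
          _ = #T ^ (2 * k) / 4 ^ k * 2 := by
              rw [div_pow, pow_mul 2 2 k]; norm_num
          _ ≤ #T ^ (2 * k) / 4 ^ k * (c * 4 ^ k) := by gcongr
          _ = _ := by field_simp
    have h4 : ‖hat S ψ‖ * ‖hat U ψ‖ ≤ (‖hat S ψ‖ ^ 2 + ‖hat U ψ‖ ^ 2) / 2 := by
      nlinarith [sq_nonneg (‖hat S ψ‖ - ‖hat U ψ‖)]
    calc ‖Q ψ * (ψ y - 1)‖ = (‖hat T ψ‖ ^ (2 * k) * ‖1 - ψ y‖) * ‖hat V ψ‖ *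
          (‖hat S ψ‖ * ‖hat U ψ‖) := by
          rw [hQ, norm_sub_rev 1]
          simp only [norm_mul, norm_pow, hinv]
          ring
      _ ≤ (c * #T ^ (2 * k)) * #V * ((‖hat S ψ‖ ^ 2 + ‖hat U ψ‖ ^ 2) / 2) := by
          gcongr
          exact norm_hat_le _ _
      _ = _ := by ring
  have h5 : Fintype.card G * |smooth S U V T k y - smooth S U V T k 0| ≤
      Fintype.card G * (c * #R * #V * #T ^ (2 * k)) := by
    calc _ = ‖((Fintype.card G * (smooth S U V T k y - smooth S U V T k 0) : ℝ) : ℂ)‖ := by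
          rw [Complex.norm_real, Real.norm_eq_abs, abs_mul, abs_of_pos hG]
      _ ≤ ∑ ψ : AddChar G ℂ, ‖Q ψ * (ψ y - 1)‖ := by rw [key]; exact norm_sum_le _ _
      _ ≤ ∑ ψ : AddChar G ℂ, (c * #V * #T ^ (2 * k)) * ((‖hat S ψ‖ ^ 2 + ‖hat U ψ‖ ^ 2) / 2) :=
          sum_le_sum fun ψ _ => hterm ψ
      _ = (c * #V * #T ^ (2 * k)) * ((Fintype.card G * #S + Fintype.card G * #U) / 2) := by
          rw [← mul_sum, ← sum_div, sum_add_distrib, sum_norm_hat_sq, sum_norm_hat_sq]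
      _ ≤ (c * #V * #T ^ (2 * k)) * ((Fintype.card G * #R + Fintype.card G * #R) / 2) := by
          gcongr
      _ = _ := by ring
  exact le_of_mul_le_mul_left h5 hG

open Classical in
lemma exists_translate_mem {U V T R Y : Finset G} (hU : U.Nonempty) (hV : V.Nonempty)
    (hT : T.Nonempty) (hUR : U ⊆ R) (S : Set G) {k : ℕ} {c δ : ℝ} (hk : 2 ≤ c * 4 ^ k)
    (hy : ∀ y ∈ Y, ∀ ψ : AddChar G ℂ, (#T : ℝ) ≤ 2 * ‖hat T ψ‖ → ‖1 - ψ y‖ ≤ c)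
    (hc : c * #R ≤ δ * #U)
    (hR : ∀ x ∈ U, ∀ a ∈ V, ∀ t t' : Fin k → G, (∀ i, t i ∈ T) → (∀ i, t' i ∈ T) →
      x - a + ∑ i, (t' i - t i) ∈ R)
    (h0 : ∀ t t' : Fin k → G, (∀ i, t i ∈ T) → (∀ i, t' i ∈ T) → (1 - 2 * δ) * #U ≤
      ∑ x ∈ U, avg (fun w => if w ∈ S then 1 else 0) V (x + ∑ i, (t' i - t i))) :
    ∃ z, (1 - 3 * δ) * #Y ≤ #(Y.filter fun y => z + y ∈ S) := by
  have hUc : (0 : ℝ) < #U := by exact_mod_cast hU.card_pos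
  have hVc : (0 : ℝ) < #V := by exact_mod_cast hV.card_pos
  have hTc : (0 : ℝ) < #T := by exact_mod_cast hT.card_pos
  set S' := R.filter fun w => w ∈ S with hS'
  set P := Fintype.piFinset fun _ : Fin k => T with hP
  have hPc : (#P : ℝ) = #T ^ k := by simp [hP]
  have hzero : (1 - 2 * δ) * #U * #V * #T ^ (2 * k) ≤ smooth S' U V T k 0 := by
    have h1 : smooth S' U V T k 0 = ∑ t ∈ P, ∑ t' ∈ P, #V * ∑ x ∈ U,
        avg (fun w => if w ∈ S then 1 else 0) V (x + ∑ i, (t' i - t i)) := by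
      have h2 : smooth S' U V T k 0 = ∑ x ∈ U, ∑ a ∈ V, ∑ t ∈ P, ∑ t' ∈ P,
          if x + ∑ i, (t' i - t i) - a ∈ S then (1 : ℝ) else 0 := by
        unfold smooth
        refine sum_congr rfl fun x hx => sum_congr rfl fun a ha => sum_congr rfl fun t ht =>
          sum_congr rfl fun t' ht' => ?_
        have := hR x hx a ha t t' (Fintype.mem_piFinset.1 ht) (Fintype.mem_piFinset.1 ht')
        rw [add_zero, show x + ∑ i, (t' i - t i) - a = x - a + ∑ i, (t' i - t i) by abel]
        simp only [ind, hS', mem_filter, this, true_and]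
      rw [h2]
      have h3 : ∀ x ∈ U, ∑ a ∈ V, ∑ t ∈ P, ∑ t' ∈ P,
          (if x + ∑ i, (t' i - t i) - a ∈ S then (1 : ℝ) else 0) = ∑ t ∈ P, ∑ t' ∈ P, #V *
            avg (fun w => if w ∈ S then 1 else 0) V (x + ∑ i, (t' i - t i)) := by
        intro x _
        rw [sum_comm]
        refine sum_congr rfl fun t _ => ?_
        rw [sum_comm]
        refine sum_congr rfl fun t' _ => ?_
        unfold avg
        field_simp
      rw [sum_congr rfl h3, sum_comm]
      refine sum_congr rfl fun t _ => ?_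
      rw [sum_comm]
      refine sum_congr rfl fun t' _ => ?_
      rw [mul_sum]
    rw [h1]
    calc _ = ∑ t ∈ P, ∑ t' ∈ P, #V * ((1 - 2 * δ) * #U) := by
          simp only [sum_const, nsmul_eq_mul, hPc]
          ring
      _ ≤ _ := by
          gcongr with t ht t' ht'
          exact h0 t t' (Fintype.mem_piFinset.1 ht) (Fintype.mem_piFinset.1 ht')
  have hyb : ∀ y ∈ Y, (1 - 3 * δ) * #U * #V * #T ^ (2 * k) ≤ smooth S' U V T k y := by
    intro y hyY
    have h1 := abs_smooth_sub_le (S := S') (V := V) (filter_subset _ _) hUR hk (hy y hyY)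
    have h2 : c * #R * #V * #T ^ (2 * k) ≤ δ * #U * #V * #T ^ (2 * k) := by gcongr
    have h3 := (abs_le.1 h1).1
    linarith
  have hsum : ∑ y ∈ Y, smooth S' U V T k y = ∑ i ∈ U ×ˢ V ×ˢ P ×ˢ P, ∑ y ∈ Y,
      ind S' (i.1 - i.2.1 + ∑ j, (i.2.2.2 j - i.2.2.1 j) + y) := by
    rw [sum_comm]
    refine sum_congr rfl fun y _ => ?_
    rw [sum_product]
    unfold smooth
    refine sum_congr rfl fun x _ => ?_
    rw [sum_product]
    refine sum_congr rfl fun a _ => ?_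
    rw [sum_product]
  have hne : (U ×ˢ V ×ˢ P ×ˢ P).Nonempty := by
    have : P.Nonempty := by simp [hP, hT]
    exact hU.product (hV.product (this.product this))
  obtain ⟨i, -, hi⟩ : ∃ i ∈ U ×ˢ V ×ˢ P ×ˢ P, (1 - 3 * δ) * #Y ≤
      ∑ y ∈ Y, ind S' (i.1 - i.2.1 + ∑ j, (i.2.2.2 j - i.2.2.1 j) + y) := by
    refine exists_le_of_sum_le hne ?_
    rw [← hsum, sum_const, nsmul_eq_mul, card_product, card_product, card_product]
    push_cast
    rw [hPc]
    calc _ = ∑ y ∈ Y, (1 - 3 * δ) * #U * #V * #T ^ (2 * k) := by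
          rw [sum_const, nsmul_eq_mul]; ring
      _ ≤ _ := sum_le_sum hyb
  refine ⟨i.1 - i.2.1 + ∑ j, (i.2.2.2 j - i.2.2.1 j), hi.trans ?_⟩
  rw [card_filter]
  push_cast
  refine sum_le_sum fun y _ => ?_
  unfold ind
  split_ifs with h1 h2
  · rfl
  · exact absurd (mem_filter.1 h1).2 h2
  · norm_num
  · rfl

open Classical in
/-- Many elements of a translate of `Y` being popular differences of `A` forces `A` to be dense on
some translate of `Y`. -/
lemma exists_dense_translate {A Y : Finset G} (hA : A.Nonempty) {β b ξ : ℝ} (hb : 0 ≤ b)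
    (hβ : (#A : ℝ) = β * b) {z : G}
    (hz : ξ * #Y ≤ #(Y.filter fun y => z + y ∈ popular A (β ^ 2 * b))) :
    ∃ x, (1 + 1 / 128) * β * (ξ * #Y) ≤ #(Y.filter fun y => x + y ∈ A) := by
  have hAc : (0 : ℝ) < #A := by exact_mod_cast hA.card_pos
  have h1 : (1 + 1 / 128) * (β ^ 2 * b) * (ξ * #Y) ≤ ∑ y ∈ Y, corr (ind A) (z + y) := by
    calc _ ≤ (1 + 1 / 128) * (β ^ 2 * b) * #(Y.filter fun y => z + y ∈ popular A (β ^ 2 * b)) := by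
          gcongr
      _ = ∑ y ∈ Y.filter fun y => z + y ∈ popular A (β ^ 2 * b), (1 + 1 / 128) * (β ^ 2 * b) := by
          simp; ring
      _ ≤ ∑ y ∈ Y.filter fun y => z + y ∈ popular A (β ^ 2 * b), corr (ind A) (z + y) :=
          sum_le_sum fun y hy => (mem_filter.1 hy).2
      _ ≤ _ := sum_le_sum_of_subset_of_nonneg (filter_subset _ _) fun y _ _ => corr_ind_nonneg _ _
  have h2 : ∑ y ∈ Y, corr (ind A) (z + y) = ∑ x ∈ A, (#(Y.filter fun y => x + z + y ∈ A) : ℝ) := by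
    unfold corr
    simp_rw [sum_ind_mul]
    rw [sum_comm]
    refine sum_congr rfl fun x _ => ?_
    rw [card_filter]
    push_cast
    refine sum_congr rfl fun y _ => ?_
    rw [ind, add_assoc]
  obtain ⟨x, -, hx⟩ : ∃ x ∈ A, (1 + 1 / 128) * β * (ξ * #Y) ≤
      #(Y.filter fun y => x + z + y ∈ A) := by
    refine exists_le_of_sum_le hA ?_
    rw [← h2, sum_const, nsmul_eq_mul, hβ]
    refine le_trans (le_of_eq ?_) h1
    ring
  exact ⟨_, hx⟩

omit [AddCommGroup G] [Fintype G] [DecidableEq G] in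
lemma card_le_of_mul_le {U V E₁ E₂ : Finset G} (hU : U ⊆ E₁) (hV : V ⊆ E₂) (h₁ : E₁.Nonempty)
    (h₂ : E₂.Nonempty) {ω : ℝ} (h : ω * (#E₁ * #E₂) ≤ (#U : ℝ) * #V) :
    ω * #E₁ ≤ #U ∧ ω * #E₂ ≤ #V := by
  have c1 : (0 : ℝ) < #E₁ := by exact_mod_cast h₁.card_pos
  have c2 : (0 : ℝ) < #E₂ := by exact_mod_cast h₂.card_pos
  have hU' : (#U : ℝ) ≤ #E₁ := by exact_mod_cast card_le_card hU
  have hV' : (#V : ℝ) ≤ #E₂ := by exact_mod_cast card_le_card hV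
  constructor
  · refine le_of_mul_le_mul_right ?_ c2
    nlinarith [Nat.cast_nonneg (α := ℝ) #U]
  · refine le_of_mul_le_mul_left ?_ c1
    nlinarith [Nat.cast_nonneg (α := ℝ) #V]

open Classical in
/-- Almost periods of a dense sum structure and the characters controlling them. -/
lemma exists_characters {U V E₁ E₂ E₃ E₄ W R F : Finset G} (hU : U ⊆ E₁) (hV : V ⊆ E₂)
    (h₁ : E₁.Nonempty) (h₂ : E₂.Nonempty) (h₃ : E₃.Nonempty) (h₄ : E₄.Nonempty)
    {ω : ℝ} (hω : 0 < ω)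
    (hUV : ω * (#E₁ * #E₂) ≤ (#U : ℝ) * #V) {S : Set G} {δ : ℝ} (hδ : 0 < δ)
    (hS : (1 - δ) * (#U * #V) ≤ ∑ u ∈ U, ∑ v ∈ V, if u - v ∈ S then (1 : ℝ) else 0)
    (hW : ∀ v ∈ E₂, ∀ t ∈ E₃, v - t ∈ W) (hWc : (#W : ℝ) ≤ 2 * #E₂)
    (hRc : (#R : ℝ) ≤ 2 * #E₁)
    {k : ℕ}
    (hR : ∀ x ∈ E₁, ∀ a ∈ insert 0 E₂, ∀ j ≤ k, ∀ t t' : Fin j → G, (∀ i, t i ∈ E₃) →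
      (∀ i, t' i ∈ E₃) → x - a + ∑ i, (t' i - t i) ∈ R)
    {m : ℕ} (hF : ∀ x ∈ E₃, ∀ t : Fin m → G, (∀ i, t i ∈ E₄) → x - ∑ i, t i ∈ F)
    (hFc : (#F : ℝ) ≤ 2 * #E₃)
    {ε : ℝ} (hε : 0 ≤ ε) (hε1 : ε ≤ 1) {n : ℕ} (hn : 0 < n)
    (hkε : k * (2 * ε + 16 / ω * Real.exp (-(n * ε ^ 2 / 4))) ≤ δ)
    (hm : 8 * (2 / ω) ^ n < Real.exp (m / 8)) {c : ℝ} (hck : 2 ≤ c * 4 ^ k)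
    (hcω : 2 * c ≤ δ * ω) :
    ∃ Λ : Finset (AddChar G ℂ), #Λ ≤ m ∧ ∀ (Y : Finset G) (η r : ℝ), 0 ≤ r → 0 ≤ η →
      (∀ y ∈ Y, (#(E₄.filter fun x => x + y ∉ E₄) : ℝ) ≤ η * #E₄) →
      (∀ y ∈ Y, ∀ l ∈ Λ, ‖1 - l y‖ ≤ r) → m * r + 4 * η ≤ c →
      ∃ z, (1 - 3 * δ) * #Y ≤ #(Y.filter fun y => z + y ∈ S) := by
  have c1 : (0 : ℝ) < #E₁ := by exact_mod_cast h₁.card_pos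
  have c2 : (0 : ℝ) < #E₂ := by exact_mod_cast h₂.card_pos
  have c3 : (0 : ℝ) < #E₃ := by exact_mod_cast h₃.card_pos
  obtain ⟨hUc, hVc⟩ := card_le_of_mul_le hU hV h₁ h₂ hUV
  have hU0 : (0 : ℝ) < #U := lt_of_lt_of_le (by positivity) hUc
  have hV0 : (0 : ℝ) < #V := lt_of_lt_of_le (by positivity) hVc
  have hUne : U.Nonempty := by rw [← card_pos]; exact_mod_cast hU0
  have hVne : V.Nonempty := by rw [← card_pos]; exact_mod_cast hV0
  have hWne : W.Nonempty := by
    obtain ⟨v, hv⟩ := h₂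
    obtain ⟨t, ht⟩ := h₃
    exact ⟨_, hW v hv t ht⟩
  have hWc0 : (0 : ℝ) < #W := by exact_mod_cast hWne.card_pos
  set f : G → ℝ := fun w => if w ∈ S then 1 else 0 with hf
  have hf0 : ∀ x, 0 ≤ f x := fun x => by simp only [hf]; split_ifs <;> norm_num
  have hf1 : ∀ x, f x ≤ 1 := fun x => by simp only [hf]; split_ifs <;> norm_num
  obtain ⟨T, hTE, hTc, hTa⟩ := exists_almost_period R hVne hWne (E := E₃)
    (fun v hv t ht => hW v (hV hv) t ht) hf0 hf1 hε hε1 hn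
  have hTlow : (#E₃ : ℝ) * (ω / 2) ^ n ≤ 2 * #T := by
    have h1 : (ω / 2) * #W ≤ #V := by nlinarith
    have h2 : (ω / 2) ^ n * (#W : ℝ) ^ n ≤ #V ^ n := by
      rw [← mul_pow]; gcongr
    refine le_of_mul_le_mul_right ?_ (pow_pos hWc0 n)
    calc _ = #E₃ * ((ω / 2) ^ n * (#W : ℝ) ^ n) := by ring
      _ ≤ #E₃ * #V ^ n := by gcongr
      _ ≤ _ := hTc
  have hT0 : (0 : ℝ) < #T := by
    have : (0 : ℝ) < #E₃ * (ω / 2) ^ n := by positivity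
    linarith
  have hTne : T.Nonempty := by rw [← card_pos]; exact_mod_cast hT0
  have hUR : U ⊆ R := by
    intro x hx
    have := hR x (hU hx) 0 (mem_insert_self _ _) 0 (Nat.zero_le _) (fun _ => 0) (fun _ => 0)
      (fun i => i.elim0) (fun i => i.elim0)
    simpa using this
  have hR0 : ∀ x ∈ U, ∀ j ≤ k, ∀ t t' : Fin j → G, (∀ i, t i ∈ T) → (∀ i, t' i ∈ T) →
      x + ∑ i, (t' i - t i) ∈ R := by
    intro x hx j hj t t' ht ht'
    have := hR x (hU hx) 0 (mem_insert_self _ _) j hj t t' (fun i => hTE (ht i))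
      (fun i => hTE (ht' i))
    simpa using this
  have hexp := Real.exp_pos (-(n * ε ^ 2 / 4))
  obtain ⟨Λ, hΛ, hΛs⟩ := exists_spectrum_basis hTne h₄ (M := m)
    (fun x hx t ht => hF x (hTE hx) t ht) (by
      have h1 : (2 / ω) ^ n * (ω / 2) ^ n = 1 := by
        rw [← mul_pow, div_mul_div_cancel₀ hω.ne', div_self two_ne_zero, one_pow]
      have h2 : (0 : ℝ) < (2 / ω) ^ n := by positivity
      calc 2 * (#F : ℝ) ≤ 4 * #E₃ := by linarith
        _ = 4 * (2 / ω) ^ n * (#E₃ * (ω / 2) ^ n) := by linear_combination (-4 * (#E₃ : ℝ)) * h1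
        _ ≤ 4 * (2 / ω) ^ n * (2 * #T) := by gcongr
        _ = (8 * (2 / ω) ^ n) * #T := by ring
        _ < _ := by gcongr)
  refine ⟨Λ, hΛ, fun Y η r hr0 hη0 hYη hYr hmr => ?_⟩
  refine exists_translate_mem (R := R) (c := c) (k := k) (δ := δ) hUne hVne hTne hUR S hck
    ?_ ?_ ?_ ?_
  · exact fun y hy ψ hψ => (hΛs y η r (hYη y hy) (hYr y hy) hr0 hη0 ψ hψ).trans hmr
  · have hc0 : 0 ≤ c := by
      by_contra hneg
      have : (0 : ℝ) < 4 ^ k := by positivity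
      nlinarith
    calc c * #R ≤ c * (2 * #E₁) := by gcongr
      _ = 2 * c * #E₁ := by ring
      _ ≤ δ * ω * #E₁ := by gcongr
      _ = δ * (ω * #E₁) := by ring
      _ ≤ _ := by gcongr
  · exact fun x hx a ha t t' ht ht' => hR x (hU hx) a (mem_insert_of_mem (hV ha)) k le_rfl t t'
      (fun i => hTE (ht i)) (fun i => hTE (ht' i))
  · intro t t' ht ht'
    have h1 := sum_abs_iterate_le (T := T) (R := R) (X := U) (g := avg f V)
      (M := 2 * ε * #U + 8 * Real.exp (-(n * ε ^ 2 / 4)) * #R)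
      (fun t ht t' ht' Y hY hYc hYR => (hTa t ht t' ht' Y hY hYR).trans (by gcongr))
      k hR0 t t' ht ht'
    have h2 : k * (2 * ε * #U + 8 * Real.exp (-(n * ε ^ 2 / 4)) * #R) ≤ δ * #U := by
      have h3 : (#R : ℝ) ≤ 2 / ω * #U := by
        rw [div_mul_eq_mul_div, le_div_iff₀ hω]
        nlinarith
      calc _ ≤ k * (2 * ε * #U + 8 * Real.exp (-(n * ε ^ 2 / 4)) * (2 / ω * #U)) := by gcongr
        _ = (k * (2 * ε + 16 / ω * Real.exp (-(n * ε ^ 2 / 4)))) * #U := by ring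
        _ ≤ _ := by gcongr
    have h4 : (1 - δ) * #U ≤ ∑ x ∈ U, avg f V x := by
      unfold avg
      rw [← sum_div, le_div_iff₀ hV0]
      refine le_trans (le_of_eq ?_) hS
      ring
    have h5 : ∑ x ∈ U, avg f V x - ∑ x ∈ U, avg f V (x + ∑ i, (t' i - t i)) ≤
        ∑ x ∈ U, |avg f V (x + ∑ i, (t' i - t i)) - avg f V x| := by
      rw [← sum_sub_distrib]
      refine sum_le_sum fun x _ => ?_
      rw [abs_sub_comm]
      exact le_abs_self _
    linarith

open Classical in
/-- The density increment in terms of abstract nested sets. -/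
lemma exists_increment {A B C Tt E₁ E₂ E₃ E₄ W R F Z : Finset G} (hAB : A ⊆ B) (hA : A.Nonempty)
    {η δ γ : ℝ} (hδ : 0 < δ) (hδ1 : δ ≤ 1) (hηβ : 256 * η ≤ #A / #B)
    (hC : ∑ w ∈ C, conv (ind A) w ≤ 1 / 2 * ((#A / #B : ℝ) ^ 2 * #B) * #C)
    (hCB : ∀ w ∈ C, (#(B.filter fun x => w - x ∉ B) : ℝ) ≤ η * #B)
    (hT : ∀ w ∈ C, ∀ i ∈ E₁ ×ˢ E₂, ∀ j ∈ E₁ ×ˢ E₂, w - (i.1 + i.2) + (j.1 + j.2) ∈ Tt)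
    (hCT : γ * #Tt ≤ #C) (hT0 : Tt.Nonempty)
    (hJ : ∀ i ∈ E₁ ×ˢ E₂, ∀ j ∈ E₁ ×ˢ E₂,
      (#(B.filter fun x => x + (i.1 + i.2 - (j.1 + j.2)) ∉ B) : ℝ) ≤ η * #B)
    {p : ℕ} (hp : Even p) (hpγ : 3 ≤ 2 ^ p * (γ * δ))
    (hZ : ∀ a ∈ A, ∀ v ∈ E₂, a - v ∈ Z) (hZc : (#Z : ℝ) ≤ 2 * #B)
    (h₁ : E₁.Nonempty) (h₂ : E₂.Nonempty) (h₃ : E₃.Nonempty) (h₄ : E₄.Nonempty)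
    {ω : ℝ} (hω : 0 < ω) (hωβ : ω ≤ ((#A / #B : ℝ) ^ 2 / 2) ^ (64 * p))
    (hW : ∀ v ∈ E₂, ∀ t ∈ E₃, v - t ∈ W) (hWc : (#W : ℝ) ≤ 2 * #E₂)
    (hRc : (#R : ℝ) ≤ 2 * #E₁)
    {k : ℕ}
    (hR : ∀ x ∈ E₁, ∀ a ∈ insert 0 E₂, ∀ j ≤ k, ∀ t t' : Fin j → G, (∀ i, t i ∈ E₃) →
      (∀ i, t' i ∈ E₃) → x - a + ∑ i, (t' i - t i) ∈ R)
    {m : ℕ} (hF : ∀ x ∈ E₃, ∀ t : Fin m → G, (∀ i, t i ∈ E₄) → x - ∑ i, t i ∈ F)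
    (hFc : (#F : ℝ) ≤ 2 * #E₃)
    {ε : ℝ} (hε : 0 ≤ ε) (hε1 : ε ≤ 1) {n : ℕ} (hn : 0 < n)
    (hkε : k * (2 * ε + 16 / ω * Real.exp (-(n * ε ^ 2 / 4))) ≤ δ)
    (hm : 8 * (2 / ω) ^ n < Real.exp (m / 8)) {c : ℝ} (hck : 2 ≤ c * 4 ^ k)
    (hcω : 2 * c ≤ δ * ω) :
    ∃ Λ : Finset (AddChar G ℂ), #Λ ≤ m ∧ ∀ (Y : Finset G) (η r : ℝ), 0 ≤ r → 0 ≤ η →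
      (∀ y ∈ Y, (#(E₄.filter fun x => x + y ∉ E₄) : ℝ) ≤ η * #E₄) →
      (∀ y ∈ Y, ∀ l ∈ Λ, ‖1 - l y‖ ≤ r) → m * r + 4 * η ≤ c →
      ∃ x, (1 + 1 / 128) * (#A / #B) * ((1 - 3 * δ) * #Y) ≤ #(Y.filter fun y => x + y ∈ A) := by
  have hb : (0 : ℝ) < #B := by exact_mod_cast (hA.mono hAB).card_pos
  have ha : (0 : ℝ) < #A := by exact_mod_cast hA.card_pos
  have h := card_sq_le_sum_popular (E₁ ×ˢ E₂) (fun i => i.1 + i.2) hAB hA hδ hδ1 hηβ hC hCB hT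
    hCT hT0 hJ hp hpγ
  set β : ℝ := #A / #B with hβ
  have hβ0 : 0 < β := by positivity
  obtain ⟨s, U, hU, V, hV, hUV, hS⟩ := exists_sift (κ := β ^ 2 / 2) h₁ h₂ hZ (by positivity)
    (by positivity) (by
      calc β ^ 2 / 2 * #Z ≤ β ^ 2 / 2 * (2 * #B) := by gcongr
        _ = _ := by ring) _ (popular A (β ^ 2 * #B)) hδ h
  obtain ⟨Λ, hΛ, hΛs⟩ := exists_characters (S := {w | w + s ∈ popular A (β ^ 2 * #B)}) hU hV
    h₁ h₂ h₃ h₄ hω (le_trans (by gcongr) hUV) hδ hS hW hWc hRc hR hF hFc hε hε1 hn hkε hm hck hcω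
  refine ⟨Λ, hΛ, fun Y η r hr0 hη0 hYη hYr hmr => ?_⟩
  obtain ⟨z, hz⟩ := hΛs Y η r hr0 hη0 hYη hYr hmr
  refine exists_dense_translate hA (b := #B) hb.le (by rw [hβ]; field_simp) (z := z + s) ?_
  refine hz.trans (le_of_eq ?_)
  congr 2
  ext y
  simp only [mem_filter, Set.mem_ofPred_eq]
  rw [show z + y + s = z + s + y by abel]

open Classical in
/-- The Bohr set with frequency set `Γ` and radius `ρ`. -/
noncomputable def bohr (Γ : Finset (AddChar G ℂ)) (ρ : ℝ) : Finset G :=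
  univ.filter fun x => ∀ ψ ∈ Γ, ‖1 - ψ x‖ ≤ ρ

omit [DecidableEq G] in
lemma mem_bohr {Γ : Finset (AddChar G ℂ)} {ρ : ℝ} {x : G} :
    x ∈ bohr Γ ρ ↔ ∀ ψ ∈ Γ, ‖1 - ψ x‖ ≤ ρ := by simp [bohr]

omit [DecidableEq G] in
lemma zero_mem_bohr (Γ : Finset (AddChar G ℂ)) {ρ : ℝ} (hρ : 0 ≤ ρ) : 0 ∈ bohr Γ ρ := by
  simp [mem_bohr, hρ]

omit [DecidableEq G] in
lemma bohr_nonempty (Γ : Finset (AddChar G ℂ)) {ρ : ℝ} (hρ : 0 ≤ ρ) : (bohr Γ ρ).Nonempty :=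
  ⟨0, zero_mem_bohr Γ hρ⟩

omit [DecidableEq G] in
lemma bohr_mono (Γ : Finset (AddChar G ℂ)) {ρ σ : ℝ} (h : ρ ≤ σ) : bohr Γ ρ ⊆ bohr Γ σ :=
  fun _ hx => mem_bohr.2 fun ψ hψ => (mem_bohr.1 hx ψ hψ).trans h

omit [DecidableEq G] in
lemma neg_mem_bohr {Γ : Finset (AddChar G ℂ)} {ρ : ℝ} {x : G} (hx : x ∈ bohr Γ ρ) :
    -x ∈ bohr Γ ρ := by
  refine mem_bohr.2 fun ψ hψ => ?_
  rw [← AddChar.inv_apply, norm_one_sub_inv_apply]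
  exact mem_bohr.1 hx ψ hψ

omit [DecidableEq G] in
lemma add_mem_bohr {Γ : Finset (AddChar G ℂ)} {ρ σ : ℝ} {x y : G} (hx : x ∈ bohr Γ ρ)
    (hy : y ∈ bohr Γ σ) : x + y ∈ bohr Γ (ρ + σ) := by
  refine mem_bohr.2 fun ψ hψ => ?_
  rw [AddChar.map_add_eq_mul]
  exact (norm_one_sub_mul_le (AddChar.norm_apply _ _)).trans
    (add_le_add (mem_bohr.1 hx ψ hψ) (mem_bohr.1 hy ψ hψ))

omit [DecidableEq G] in
lemma sub_mem_bohr {Γ : Finset (AddChar G ℂ)} {ρ σ : ℝ} {x y : G} (hx : x ∈ bohr Γ ρ)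
    (hy : y ∈ bohr Γ σ) : x - y ∈ bohr Γ (ρ + σ) := by
  rw [sub_eq_add_neg]
  exact add_mem_bohr hx (neg_mem_bohr hy)

omit [DecidableEq G] in
lemma sum_mem_bohr {Γ : Finset (AddChar G ℂ)} {ρ : ℝ} {j : ℕ} {t : Fin j → G}
    (ht : ∀ i, t i ∈ bohr Γ ρ) : ∑ i, t i ∈ bohr Γ (j * ρ) := by
  refine mem_bohr.2 fun ψ hψ => ?_
  rw [map_sum_eq_prod]
  induction j with
  | zero => simp
  | succ j ih =>
    rw [Fin.prod_univ_castSucc]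
    have h1 : ‖∏ i : Fin j, ψ (t i.castSucc)‖ = 1 := by simp
    have h2 := ih (t := fun i => t i.castSucc) (fun i => ht _)
    have h3 := mem_bohr.1 (ht (Fin.last j)) ψ hψ
    refine (norm_one_sub_mul_le h1).trans ?_
    push_cast
    linarith

omit [DecidableEq G] in
lemma norm_sub_le_of_floor {s : ℕ} (hs : 0 < s) {z w : ℂ} (hre : ⌊s * z.re⌋ = ⌊s * w.re⌋)
    (him : ⌊s * z.im⌋ = ⌊s * w.im⌋) : ‖z - w‖ ≤ 2 / s := by
  have hs' : (0 : ℝ) < s := by exact_mod_cast hs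
  have key : ∀ a b : ℝ, ⌊s * a⌋ = ⌊s * b⌋ → |a - b| ≤ 1 / s := by
    intro a b h
    have := Int.abs_sub_lt_one_of_floor_eq_floor h
    rw [← mul_sub, abs_mul, abs_of_pos hs'] at this
    rw [le_div_iff₀' hs']
    exact this.le
  have h1 := key _ _ hre
  have h2 := key _ _ him
  calc ‖z - w‖ ≤ |(z - w).re| + |(z - w).im| := Complex.norm_le_abs_re_add_abs_im _
    _ ≤ 1 / s + 1 / s := by
        rw [Complex.sub_re, Complex.sub_im]; exact add_le_add h1 h2
    _ = _ := by ring

omit [DecidableEq G] in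
lemma card_le_mul_card_bohr (Γ : Finset (AddChar G ℂ)) {s : ℕ} (hs : 0 < s) {ρ : ℝ}
    (hρ : 2 / s ≤ ρ) : Fintype.card G ≤ (2 * s + 1) ^ (2 * #Γ) * #(bohr Γ ρ) := by
  classical
  have hs' : (0 : ℝ) < s := by exact_mod_cast hs
  set I := Icc (-(s : ℤ)) s with hI
  have hIc : #I = 2 * s + 1 := by simp [hI]; omega
  set cell : G → (Γ → ℤ × ℤ) := fun x ψ => (⌊s * (ψ.1 x).re⌋, ⌊s * (ψ.1 x).im⌋) with hcell
  set P := Fintype.piFinset fun _ : Γ => I ×ˢ I with hP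
  have hPc : #P = (2 * s + 1) ^ (2 * #Γ) := by
    simp only [hP, Fintype.card_piFinset, card_product, hIc, prod_const, card_univ,
      Fintype.card_coe]
    rw [pow_mul, pow_two]
  have hfl : ∀ a : ℝ, |a| ≤ 1 → ⌊s * a⌋ ∈ I := by
    intro a ha
    rw [abs_le] at ha
    rw [hI, mem_Icc]
    constructor
    · rw [Int.le_floor]; push_cast; nlinarith
    · have : (⌊s * a⌋ : ℝ) ≤ s := (Int.floor_le _).trans (by nlinarith)
      exact_mod_cast this
  have hmaps : ∀ x ∈ (univ : Finset G), cell x ∈ P := by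
    intro x _
    rw [hP, Fintype.mem_piFinset]
    intro ψ
    have h1 : ‖ψ.1 x‖ = 1 := AddChar.norm_apply _ _
    exact mem_product.2 ⟨hfl _ (h1 ▸ Complex.abs_re_le_norm _),
      hfl _ (h1 ▸ Complex.abs_im_le_norm _)⟩
  have hfib : ∀ c ∈ P, #(univ.filter fun x => cell x = c) ≤ #(bohr Γ ρ) := by
    intro c _
    rcases (univ.filter fun x => cell x = c).eq_empty_or_nonempty with h | ⟨x₀, hx₀⟩
    · rw [h]; simp
    · refine card_le_card_of_injOn (fun x => x - x₀) ?_ (fun x _ y _ h => by simpa using h)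
      intro x hx
      simp only [coe_filter, mem_univ, true_and, Set.mem_ofPred_eq, mem_filter] at hx hx₀
      rw [mem_coe, mem_bohr]
      intro ψ hψ
      have h1 := congrFun (hx.trans hx₀.symm) ⟨ψ, hψ⟩
      simp only [hcell, Prod.mk.injEq] at h1
      have h2 := norm_sub_le_of_floor hs h1.1 h1.2
      refine le_trans (le_of_eq ?_) (h2.trans hρ)
      have h3 : ψ x = ψ (x - x₀) * ψ x₀ := by rw [← AddChar.map_add_eq_mul]; simp
      have h4 : ‖ψ x₀‖ = 1 := AddChar.norm_apply _ _
      rw [h3, show ψ (x - x₀) * ψ x₀ - ψ x₀ = (ψ (x - x₀) - 1) * ψ x₀ by ring, norm_mul, h4,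
        mul_one, norm_sub_rev]
  calc Fintype.card G = #(univ : Finset G) := card_univ.symm
    _ ≤ #(bohr Γ ρ) * #P := by
        have := card_le_mul_card_image_of_maps_to hmaps _ hfib
        exact this
    _ = _ := by rw [hPc, mul_comm]

omit [DecidableEq G] in
lemma card_le_two_pow_mul_card_bohr (Γ : Finset (AddChar G ℂ)) {j : ℕ} {ρ : ℝ}
    (hρ : (1 / 2) ^ j ≤ ρ) : Fintype.card G ≤ 2 ^ ((2 * j + 6) * #Γ) * #(bohr Γ ρ) := by
  have h := card_le_mul_card_bohr Γ (s := 2 ^ (j + 1)) (by positivity) (ρ := ρ) (by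
    refine le_trans (le_of_eq ?_) hρ
    push_cast
    rw [pow_succ]
    field_simp
    rw [← mul_pow]; norm_num)
  refine h.trans (Nat.mul_le_mul_right _ ?_)
  rw [pow_mul (2 * 2 ^ (j + 1) + 1), pow_mul 2]
  refine Nat.pow_le_pow_left ?_ _
  have : 1 ≤ 2 ^ j := Nat.one_le_two_pow
  have h2 : 2 * 2 ^ (j + 1) + 1 ≤ 2 ^ (j + 3) := by
    rw [pow_add, pow_add]; omega
  calc _ ≤ (2 ^ (j + 3)) ^ 2 := Nat.pow_le_pow_left h2 2
    _ = _ := by rw [← pow_mul]; congr 1; ring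

/-- `ρ` is a regular radius: enlarging it by the factor `1 + κ` increases the size of the Bohr set
by a factor at most `1 + η`. -/
def IsRegular (Γ : Finset (AddChar G ℂ)) (η κ ρ : ℝ) : Prop :=
  (#(bohr Γ ((1 + κ) * ρ)) : ℝ) ≤ (1 + η) * #(bohr Γ ρ)

omit [DecidableEq G] in
lemma exists_isRegular (Γ : Finset (AddChar G ℂ)) {Q h : ℕ} (hQ : 0 < Q) (hh : 0 < h) {σ : ℝ}
    (hσ : 0 ≤ σ) (hcard : Fintype.card G ≤ 2 ^ Q * #(bohr Γ (σ / 2))) :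
    ∃ ρ, σ / 2 ≤ ρ ∧ ρ ≤ σ ∧ IsRegular Γ (1 / h) (1 / (2 * (h * Q))) ρ := by
  have hh' : (0 : ℝ) < h := by exact_mod_cast hh
  have hQ' : (0 : ℝ) < Q := by exact_mod_cast hQ
  by_contra hcon
  push Not at hcon
  set N := h * Q with hN
  have hN0 : 0 < N := by positivity
  have hN' : (N : ℝ) = h * Q := by rw [hN]; push_cast; rfl
  have hNp : (0 : ℝ) < N := by exact_mod_cast hN0
  set r : ℕ → ℝ := fun i => σ / 2 * (1 + i / N) with hr
  have hstep : ∀ i < N, (1 + 1 / h : ℝ) * #(bohr Γ (r i)) < #(bohr Γ (r (i + 1))) := by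
    intro i hi
    have hiN : (i : ℝ) / N ≤ 1 := by
      rw [div_le_one hNp]; exact_mod_cast hi.le
    have hi0 : (0 : ℝ) ≤ i / N := by positivity
    have h1 := hcon (r i) (by simp only [hr]; nlinarith) (by simp only [hr]; nlinarith)
    unfold IsRegular at h1
    push Not at h1
    refine h1.trans_le ?_
    have : (1 + 1 / (2 * (h * Q : ℝ))) * r i ≤ r (i + 1) := by
      rw [← hN']
      simp only [hr]
      have e : (1 + 1 / (2 * N : ℝ)) * (1 + i / N) ≤ 1 + ((i + 1 : ℕ) : ℝ) / N := by
        have : (1 / (2 * N : ℝ)) * (1 + i / N) ≤ 1 / (2 * N) * 2 := by gcongr; linarith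
        have e2 : (1 / (2 * N : ℝ)) * 2 = 1 / N := by field_simp
        push_cast
        rw [add_div]
        linarith
      have := mul_le_mul_of_nonneg_left e (by linarith : 0 ≤ σ / 2)
      linarith
    exact_mod_cast card_le_card (bohr_mono Γ this)
  have hind : ∀ i ≤ N, 0 < i → (1 + 1 / h : ℝ) ^ i * #(bohr Γ (r 0)) < #(bohr Γ (r i)) := by
    intro i
    induction i with
    | zero => intro _ h0; exact absurd h0 (lt_irrefl _)
    | succ i ih =>
      intro hi _
      rcases Nat.eq_zero_or_pos i with rfl | hi0
      · simpa using hstep 0 hi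
      · have h1 := ih (by omega) hi0
        have h2 := hstep i (by omega)
        refine lt_of_le_of_lt ?_ h2
        rw [pow_succ', mul_assoc]
        gcongr
  have h1 := hind N le_rfl hN0
  have h2 : (2 : ℝ) ^ Q ≤ (1 + 1 / h : ℝ) ^ N := by
    rw [hN, pow_mul]
    gcongr
    have := one_add_mul_le_pow (a := (1 / h : ℝ)) (by
      have : (0 : ℝ) ≤ 1 / h := by positivity
      linarith) h
    refine le_trans (le_of_eq ?_) this
    field_simp
    norm_num
  have h3 : r 0 = σ / 2 := by simp [hr]
  have h4 : (Fintype.card G : ℝ) ≤ 2 ^ Q * #(bohr Γ (σ / 2)) := by exact_mod_cast hcard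
  have h5 : (#(bohr Γ (r N)) : ℝ) ≤ Fintype.card G := by exact_mod_cast card_le_univ _
  rw [h3] at h1
  have h6 : (2 : ℝ) ^ Q * #(bohr Γ (σ / 2)) ≤ (1 + 1 / h : ℝ) ^ N * #(bohr Γ (σ / 2)) := by gcongr
  linarith

lemma IsRegular.card_filter_add_le {Γ : Finset (AddChar G ℂ)} {η κ ρ : ℝ} (h : IsRegular Γ η κ ρ)
    (hκρ : 0 ≤ κ * ρ) {y : G} (hy : y ∈ bohr Γ (κ * ρ)) :
    (#((bohr Γ ρ).filter fun x => x + y ∉ bohr Γ ρ) : ℝ) ≤ η * #(bohr Γ ρ) := by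
  have hsub : bohr Γ ρ ⊆ bohr Γ ((1 + κ) * ρ) := bohr_mono Γ (by linarith)
  have h1 : #((bohr Γ ρ).filter fun x => x + y ∉ bohr Γ ρ) ≤
      #(bohr Γ ((1 + κ) * ρ) \ bohr Γ ρ) := by
    refine card_le_card_of_injOn (fun x => x + y) ?_ (fun a _ b _ hab => by simpa using hab)
    intro x hx
    simp only [coe_filter, Set.mem_ofPred_eq] at hx
    simp only [coe_sdiff, Set.mem_sdiff, mem_coe]
    refine ⟨?_, hx.2⟩
    rw [show (1 + κ) * ρ = ρ + κ * ρ by ring]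
    exact add_mem_bohr hx.1 hy
  have h2 := card_sdiff_add_card_eq_card hsub
  have h3 : (#(bohr Γ ((1 + κ) * ρ) \ bohr Γ ρ) : ℝ) + #(bohr Γ ρ) = #(bohr Γ ((1 + κ) * ρ)) := by
    exact_mod_cast h2
  have h4 : (#((bohr Γ ρ).filter fun x => x + y ∉ bohr Γ ρ) : ℝ) ≤
      #(bohr Γ ((1 + κ) * ρ) \ bohr Γ ρ) := by exact_mod_cast h1
  unfold IsRegular at h
  linarith

lemma IsRegular.card_filter_sub_le {Γ : Finset (AddChar G ℂ)} {η κ ρ : ℝ} (h : IsRegular Γ η κ ρ)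
    (hκρ : 0 ≤ κ * ρ) {y : G} (hy : y ∈ bohr Γ (κ * ρ)) :
    (#((bohr Γ ρ).filter fun x => y - x ∉ bohr Γ ρ) : ℝ) ≤ η * #(bohr Γ ρ) := by
  refine le_trans (le_of_eq ?_) (h.card_filter_add_le hκρ (neg_mem_bohr hy))
  congr 2
  ext x
  simp only [mem_filter, and_congr_right_iff, not_iff_not]
  intro _
  rw [show x + -y = -(y - x) by abel]
  exact ⟨neg_mem_bohr, fun h => by simpa using neg_mem_bohr h⟩

open Classical in
/-- The frequency set of the dilate of a Bohr set by the automorphism `D`. -/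
noncomputable def dilate (D : G ≃+ G) (Γ : Finset (AddChar G ℂ)) : Finset (AddChar G ℂ) :=
  Γ.image fun ψ => ψ.compAddMonoidHom D.symm.toAddMonoidHom

omit [Fintype G] [DecidableEq G] in
lemma card_dilate_le (D : G ≃+ G) (Γ : Finset (AddChar G ℂ)) : #(dilate D Γ) ≤ #Γ :=
  card_image_le

omit [DecidableEq G] in
lemma mem_bohr_dilate {D : G ≃+ G} {Γ : Finset (AddChar G ℂ)} {ρ : ℝ} {x : G} :
    x ∈ bohr (dilate D Γ) ρ ↔ D.symm x ∈ bohr Γ ρ := by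
  simp [mem_bohr, dilate]

omit [DecidableEq G] in
lemma apply_mem_bohr_dilate {D : G ≃+ G} {Γ : Finset (AddChar G ℂ)} {ρ : ℝ} {x : G} :
    D x ∈ bohr (dilate D Γ) ρ ↔ x ∈ bohr Γ ρ := by
  simp [mem_bohr_dilate]

omit [DecidableEq G] in
lemma card_bohr_dilate (D : G ≃+ G) (Γ : Finset (AddChar G ℂ)) (ρ : ℝ) :
    #(bohr (dilate D Γ) ρ) = #(bohr Γ ρ) := by
  symm
  exact card_bij (fun x _ => D x) (fun x hx => apply_mem_bohr_dilate.2 hx)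
    (fun x _ y _ h => D.injective h) fun y hy => ⟨D.symm y, mem_bohr_dilate.1 hy, by simp⟩

omit [DecidableEq G] in
lemma IsRegular.dilate {Γ : Finset (AddChar G ℂ)} {η κ ρ : ℝ} (h : IsRegular Γ η κ ρ)
    (D : G ≃+ G) : IsRegular (dilate D Γ) η κ ρ := by
  unfold IsRegular at *
  rwa [card_bohr_dilate, card_bohr_dilate]

omit [DecidableEq G] in
lemma bohr_dilate_subset {D : G ≃+ G} (hD : ∀ x, D x = x + x) (Γ : Finset (AddChar G ℂ))
    (ρ : ℝ) : bohr (dilate D Γ) ρ ⊆ bohr Γ (2 * ρ) := by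
  intro x hx
  have h := mem_bohr_dilate.1 hx
  have := add_mem_bohr h h
  rwa [← hD, AddEquiv.apply_symm_apply, ← two_mul] at this

open Classical in
lemma exists_bohr_increment {D : G ≃+ G} (hD : ∀ x, D x = x + x) {Γ : Finset (AddChar G ℂ)}
    {η κ : ℝ} (hη : 0 ≤ η) (hη1 : η ≤ 1) (hκ : 0 ≤ κ)
    {ρ₁ ρ₂ ρ₃ ρ₄ ρ₅ ρ₆ : ℝ} (hr₁ : IsRegular Γ η κ ρ₁) (hr₂ : IsRegular Γ η κ ρ₂)
    (hr₃ : IsRegular Γ η κ ρ₃) (hr₄ : IsRegular Γ η κ ρ₄) (hr₅ : IsRegular Γ η κ ρ₅)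
    (hr₆ : IsRegular Γ η κ ρ₆) (hp₁ : 0 ≤ ρ₁) (hp₂ : 0 ≤ ρ₂) (hp₃ : 0 ≤ ρ₃) (hp₄ : 0 ≤ ρ₄)
    (hp₅ : 0 ≤ ρ₅) (hp₆ : 0 ≤ ρ₆) {k m : ℕ}
    (h21 : 2 * ρ₂ ≤ κ * ρ₁) (h32 : 2 * ρ₃ + 2 * ρ₄ ≤ κ * ρ₂)
    (h41 : 2 * (2 * ρ₃ + 2 * ρ₄) ≤ κ * ρ₁) (h53 : ρ₄ + 2 * k * ρ₅ ≤ κ * ρ₃)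
    (h54 : ρ₅ ≤ κ * ρ₄) (h65 : m * ρ₆ ≤ κ * ρ₅)
    {A C : Finset G} (hA : A ⊆ bohr Γ ρ₁) (hA0 : A.Nonempty) (hC : C ⊆ bohr Γ ρ₂)
    (hfew : ∑ w ∈ C, conv (ind A) (w + w) ≤
      1 / 2 * ((#A / #(bohr Γ ρ₁) : ℝ) ^ 2 * #(bohr Γ ρ₁)) * #C)
    {δ γ : ℝ} (hδ : 0 < δ) (hδ1 : δ ≤ 1) (hηβ : 256 * η ≤ #A / #(bohr Γ ρ₁))
    (hCγ : γ * (2 * #(bohr Γ ρ₂)) ≤ #C) (hγ : 0 ≤ γ)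
    {p : ℕ} (hp : Even p) (hpγ : 3 ≤ 2 ^ p * (γ * δ))
    {ω : ℝ} (hω : 0 < ω) (hωβ : ω ≤ ((#A / #(bohr Γ ρ₁) : ℝ) ^ 2 / 2) ^ (64 * p))
    {ε : ℝ} (hε : 0 ≤ ε) (hε1 : ε ≤ 1) {n : ℕ} (hn : 0 < n)
    (hkε : k * (2 * ε + 16 / ω * Real.exp (-(n * ε ^ 2 / 4))) ≤ δ)
    (hm : 8 * (2 / ω) ^ n < Real.exp (m / 8)) {c : ℝ} (hck : 2 ≤ c * 4 ^ k)
    (hcω : 2 * c ≤ δ * ω) :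
    ∃ Γ' : Finset (AddChar G ℂ), #Γ' ≤ #Γ + m ∧ ∀ ρ : ℝ, 0 ≤ ρ → ρ ≤ κ * ρ₆ →
      m * ρ + 4 * η ≤ c →
      ∃ x, (1 + 1 / 128) * (#A / #(bohr Γ ρ₁)) * ((1 - 3 * δ) * #(bohr Γ' ρ)) ≤
        #((bohr Γ' ρ).filter fun y => x + y ∈ A) := by
  set H := dilate D Γ with hH
  have hHle : ∀ σ τ : ℝ, 2 * σ ≤ τ → bohr H σ ⊆ bohr Γ τ := fun σ τ h =>
    (bohr_dilate_subset hD Γ σ).trans (bohr_mono Γ h)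
  have two : ∀ (Δ : Finset (AddChar G ℂ)) (σ : ℝ), IsRegular Δ η κ σ →
      (#(bohr Δ ((1 + κ) * σ)) : ℝ) ≤ 2 * #(bohr Δ σ) := by
    intro Δ σ h
    unfold IsRegular at h
    refine h.trans ?_
    gcongr
    linarith
  have hDC : #(C.image D) = #C := card_image_of_injective _ D.injective
  have hCmem : ∀ w ∈ C.image D, w ∈ bohr H ρ₂ := by
    intro w hw
    obtain ⟨v, hv, rfl⟩ := mem_image.1 hw
    exact apply_mem_bohr_dilate.2 (hC hv)
  have hpair : ∀ i ∈ bohr H ρ₃ ×ˢ bohr H ρ₄, i.1 + i.2 ∈ bohr H (ρ₃ + ρ₄) := by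
    intro i hi
    exact add_mem_bohr (mem_product.1 hi).1 (mem_product.1 hi).2
  obtain ⟨Λ, hΛ, hΛ'⟩ := exists_increment (A := A) (B := bohr Γ ρ₁) (C := C.image D)
    (Tt := bohr H ((1 + κ) * ρ₂)) (E₁ := bohr H ρ₃) (E₂ := bohr H ρ₄) (E₃ := bohr H ρ₅)
    (E₄ := bohr H ρ₆) (W := bohr H ((1 + κ) * ρ₄)) (R := bohr H ((1 + κ) * ρ₃))
    (F := bohr H ((1 + κ) * ρ₅)) (Z := bohr Γ ((1 + κ) * ρ₁)) hA hA0 (η := η) (δ := δ) (γ := γ)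
    hδ hδ1 hηβ
    (by
      rw [hDC, sum_image (fun x _ y _ h => D.injective h)]
      simpa only [hD] using hfew)
    (fun w hw => hr₁.card_filter_sub_le (by positivity) (hHle _ _ h21 (hCmem w hw)))
    (by
      intro w hw i hi j hj
      have := add_mem_bohr (sub_mem_bohr (hCmem w hw) (hpair i hi)) (hpair j hj)
      exact bohr_mono H (by linarith) this)
    (by
      rw [hDC]
      refine le_trans ?_ hCγ
      refine mul_le_mul_of_nonneg_left ?_ hγ
      rw [← card_bohr_dilate D Γ]
      exact two H _ (hr₂.dilate D))
    (bohr_nonempty H (by positivity))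
    (by
      intro i hi j hj
      exact hr₁.card_filter_add_le (by positivity)
        (hHle _ _ (by linarith) (sub_mem_bohr (hpair i hi) (hpair j hj))))
    hp hpγ
    (by
      intro a ha v hv
      have := sub_mem_bohr (hA ha) (hHle _ _ le_rfl hv)
      exact bohr_mono Γ (by linarith) this)
    (two _ _ hr₁) (bohr_nonempty H hp₃) (bohr_nonempty H hp₄) (bohr_nonempty H hp₅)
    (bohr_nonempty H hp₆) hω hωβ
    (by
      intro v hv t ht
      exact bohr_mono H (by linarith) (sub_mem_bohr hv ht))
    (two _ _ (hr₄.dilate D)) (two _ _ (hr₃.dilate D)) (k := k)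
    (by
      intro x hx a ha j hj t t' ht ht'
      have ha' : a ∈ bohr H ρ₄ := by
        rcases mem_insert.1 ha with rfl | h
        · exact zero_mem_bohr H hp₄
        · exact h
      have h1 : ∑ i, (t' i - t i) ∈ bohr H (j * (ρ₅ + ρ₅)) :=
        sum_mem_bohr fun i => sub_mem_bohr (ht' i) (ht i)
      refine bohr_mono H ?_ (add_mem_bohr (sub_mem_bohr hx ha') h1)
      have : (j : ℝ) * (ρ₅ + ρ₅) ≤ k * (ρ₅ + ρ₅) := by gcongr
      linarith)
    (m := m)
    (by
      intro x hx t ht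
      exact bohr_mono H (by linarith) (sub_mem_bohr hx (sum_mem_bohr ht)))
    (two _ _ (hr₅.dilate D)) hε hε1 hn hkε hm hck hcω
  refine ⟨H ∪ Λ, ?_, ?_⟩
  · calc _ ≤ #H + #Λ := card_union_le _ _
      _ ≤ _ := add_le_add (card_dilate_le D Γ) hΛ
  · intro ρ hρ hρ6 hc
    refine hΛ' (bohr (H ∪ Λ) ρ) η ρ hρ hη ?_ ?_ hc
    · intro y hy
      refine (hr₆.dilate D).card_filter_add_le (by positivity) (mem_bohr.2 fun ψ hψ => ?_)
      exact (mem_bohr.1 hy ψ (mem_union_left _ hψ)).trans hρ6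
    · intro y hy l hl
      exact mem_bohr.1 hy l (mem_union_right _ hl)

lemma exists_translate_add_density {A S B₁ B₂ : Finset G} (hS : S.Nonempty) (h₁ : B₁.Nonempty)
    (h₂ : B₂.Nonempty) (hS₁ : ∀ a ∈ A, ∀ u ∈ B₁, a - u ∈ S) (hS₂ : ∀ a ∈ A, ∀ u ∈ B₂, a - u ∈ S) :
    ∃ x, (2 * #A / #S : ℝ) ≤ #(B₁.filter fun u => x + u ∈ A) / #B₁ +
      #(B₂.filter fun u => x + u ∈ A) / #B₂ := by
  have key : ∀ E : Finset G, E.Nonempty → (∀ a ∈ A, ∀ u ∈ E, a - u ∈ S) →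
      ∑ x ∈ S, (#(E.filter fun u => x + u ∈ A) / #E : ℝ) = #A := by
    intro E hE hES
    have hE' : (0 : ℝ) < #E := by exact_mod_cast hE.card_pos
    rw [← sum_div, div_eq_iff hE'.ne', ← Nat.cast_sum]
    norm_cast
    have h := sum_card_bipartiteAbove_eq_sum_card_bipartiteBelow (s := S) (t := E)
      fun x u => x + u ∈ A
    simp only [bipartiteAbove, bipartiteBelow] at h
    rw [h, mul_comm, ← smul_eq_mul, ← sum_const]
    refine sum_congr rfl fun u hu => ?_
    refine card_bij (fun x _ => x + u) (fun x hx => ?_) (fun x _ y _ h => by simpa using h)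
      (fun a ha => ⟨a - u, ?_, by simp⟩)
    · exact (mem_filter.1 hx).2
    · simp [hES a ha u hu, ha]
  have hS' : (0 : ℝ) < #S := by exact_mod_cast hS.card_pos
  by_contra! hcon
  have h := sum_lt_sum_of_nonempty hS fun x _ => hcon x
  rw [sum_add_distrib, key B₁ h₁ hS₁, key B₂ h₂ hS₂, sum_const, nsmul_eq_mul] at h
  have : (#S : ℝ) * (2 * #A / #S) = 2 * #A := by field_simp
  linarith

/-- The three-term progressions in `A`. -/
def progressions (A : Finset G) : Finset (G × G × G) :=
  (A ×ˢ A ×ˢ A).filter fun t => t.1 + t.2.1 = t.2.2 + t.2.2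

lemma sum_conv_le_card_progressions (A B₁ B₂ : Finset G) (x : G) :
    ∑ w ∈ B₂.filter (fun u => x + u ∈ A), conv (ind (B₁.filter fun u => x + u ∈ A)) (w + w) ≤
      #(progressions A) := by
  set A₁ := B₁.filter fun u => x + u ∈ A
  set C := B₂.filter fun u => x + u ∈ A
  have h : ∑ w ∈ C, conv (ind A₁) (w + w) =
      #((C ×ˢ univ).filter fun t : G × G => t.2 ∈ A₁ ∧ t.1 + t.1 - t.2 ∈ A₁) := by
    rw [card_filter, sum_product]
    push_cast
    refine sum_congr rfl fun w _ => sum_congr rfl fun u _ => ?_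
    unfold ind
    by_cases h1 : u ∈ A₁ <;> by_cases h2 : w + w - u ∈ A₁ <;> simp [h1, h2]
  rw [h]
  norm_cast
  refine card_le_card_of_injOn (fun t => (x + t.2, x + (t.1 + t.1 - t.2), x + t.1)) ?_ ?_
  · rintro ⟨w, u⟩ ht
    simp only [coe_filter, mem_product, mem_univ, and_true, Set.mem_ofPred_eq] at ht
    simp only [progressions, coe_filter, mem_product, Set.mem_ofPred_eq]
    refine ⟨⟨(mem_filter.1 ht.2.1).2, (mem_filter.1 ht.2.2).2, (mem_filter.1 ht.1).2⟩, by abel⟩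
  · rintro ⟨w, u⟩ _ ⟨w', u'⟩ _ h
    simp only [Prod.mk.injEq, add_right_inj] at h
    simp [h.1, h.2.2]

lemma exists_radii {P : ℝ → Prop} {σ₀ : ℝ} (hP : ∀ σ, σ₀ ≤ σ / 2 → 0 ≤ σ →
    ∃ ρ, σ / 2 ≤ ρ ∧ ρ ≤ σ ∧ P ρ) {κ ρ : ℝ} (hκ : 0 < κ) (hκ1 : κ ≤ 1) (hρ : 0 < ρ) {k m : ℕ}
    (hk : 0 < k) (hm : 0 < m) (hσ₀ : σ₀ ≤ κ ^ 6 / (8192 * k * m) * ρ) :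
    ∃ ρ₁ ρ₂ ρ₃ ρ₄ ρ₅ ρ₆ : ℝ, (P ρ₁ ∧ P ρ₂ ∧ P ρ₃ ∧ P ρ₄ ∧ P ρ₅ ∧ P ρ₆) ∧ 0 < ρ₆ ∧
      ρ₆ ≤ ρ₅ ∧ ρ₅ ≤ ρ₄ ∧ ρ₄ ≤ ρ₃ ∧ ρ₃ ≤ ρ₂ ∧ ρ₂ ≤ ρ₁ ∧ ρ₁ ≤ κ * ρ ∧
      κ ^ 6 / (8192 * k * m) * ρ ≤ ρ₆ ∧
      2 * ρ₂ ≤ κ * ρ₁ ∧ 2 * ρ₃ + 2 * ρ₄ ≤ κ * ρ₂ ∧ 2 * (2 * ρ₃ + 2 * ρ₄) ≤ κ * ρ₁ ∧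
      ρ₄ + 2 * k * ρ₅ ≤ κ * ρ₃ ∧ ρ₅ ≤ κ * ρ₄ ∧ m * ρ₆ ≤ κ * ρ₅ := by
  have hk' : (1 : ℝ) ≤ k := by exact_mod_cast hk
  have hm' : (1 : ℝ) ≤ m := by exact_mod_cast hm
  have hle : ∀ {x : ℝ}, 0 < x → κ * x ≤ x := fun hx => by nlinarith
  have d5 : κ ^ 6 / (8192 * k * m) ≤ κ ^ 5 / (4096 * k) := by
    rw [div_le_div_iff₀ (by positivity) (by positivity)]
    have : κ ^ 6 ≤ κ ^ 5 := pow_le_pow_of_le_one hκ.le hκ1 (by norm_num)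
    have h2 : (4096 * k : ℝ) ≤ 8192 * k * m := by nlinarith
    gcongr
  have d4 : κ ^ 5 / (4096 * k) ≤ κ ^ 4 / 512 := by
    rw [div_le_div_iff₀ (by positivity) (by positivity)]
    have : κ ^ 5 ≤ κ ^ 4 := pow_le_pow_of_le_one hκ.le hκ1 (by norm_num)
    have h2 : (512 : ℝ) ≤ 4096 * k := by nlinarith
    gcongr
  have d3 : κ ^ 4 / 512 ≤ κ ^ 3 / 128 := by
    have : κ ^ 4 ≤ κ ^ 3 := pow_le_pow_of_le_one hκ.le hκ1 (by norm_num)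
    have : 0 < κ ^ 3 := by positivity
    linarith
  have d2 : κ ^ 3 / 128 ≤ κ ^ 2 / 8 := by
    have : κ ^ 3 ≤ κ ^ 2 := pow_le_pow_of_le_one hκ.le hκ1 (by norm_num)
    have : 0 < κ ^ 2 := by positivity
    linarith
  have d1 : κ ^ 2 / 8 ≤ κ / 2 := by nlinarith
  have d5 := mul_le_mul_of_nonneg_right d5 hρ.le
  have d4 := mul_le_mul_of_nonneg_right d4 hρ.le
  have d3 := mul_le_mul_of_nonneg_right d3 hρ.le
  have d2 := mul_le_mul_of_nonneg_right d2 hρ.le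
  have d1 := mul_le_mul_of_nonneg_right d1 hρ.le
  obtain ⟨ρ₁, l1, u1, p1⟩ := hP (κ * ρ) (by linarith) (by positivity)
  have n1 : 0 < ρ₁ := lt_of_lt_of_le (by positivity) l1
  have b1 : κ / 2 * ρ ≤ ρ₁ := by linarith
  have b2 : κ ^ 2 / 8 * ρ ≤ κ * ρ₁ / 2 / 2 := by
    have := mul_le_mul_of_nonneg_left b1 hκ.le; nlinarith
  obtain ⟨ρ₂, l2, u2, p2⟩ := hP (κ * ρ₁ / 2) (by linarith) (by positivity)
  have n2 : 0 < ρ₂ := lt_of_lt_of_le (by positivity) l2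
  have b3 : κ ^ 3 / 128 * ρ ≤ κ * ρ₂ / 8 / 2 := by
    have := mul_le_mul_of_nonneg_left (b2.trans l2) hκ.le; nlinarith
  obtain ⟨ρ₃, l3, u3, p3⟩ := hP (κ * ρ₂ / 8) (by linarith) (by positivity)
  have n3 : 0 < ρ₃ := lt_of_lt_of_le (by positivity) l3
  have b4 : κ ^ 4 / 512 * ρ ≤ κ * ρ₃ / 2 / 2 := by
    have := mul_le_mul_of_nonneg_left (b3.trans l3) hκ.le; nlinarith
  obtain ⟨ρ₄, l4, u4, p4⟩ := hP (κ * ρ₃ / 2) (by linarith) (by positivity)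
  have n4 : 0 < ρ₄ := lt_of_lt_of_le (by positivity) l4
  have b5 : κ ^ 5 / (4096 * k) * ρ ≤ κ * ρ₄ / (4 * k) / 2 := by
    have h := mul_le_mul_of_nonneg_left (b4.trans l4) (show 0 ≤ κ / (8 * k) by positivity)
    refine le_trans (le_of_eq ?_) (h.trans (le_of_eq ?_)) <;> field_simp <;> norm_num
  obtain ⟨ρ₅, l5, u5, p5⟩ := hP (κ * ρ₄ / (4 * k)) (by linarith) (by positivity)
  have n5 : 0 < ρ₅ := lt_of_lt_of_le (by positivity) l5
  have b6 : κ ^ 6 / (8192 * k * m) * ρ ≤ κ * ρ₅ / m / 2 := by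
    have h := mul_le_mul_of_nonneg_left (b5.trans l5) (show 0 ≤ κ / (2 * m) by positivity)
    refine le_trans (le_of_eq ?_) (h.trans (le_of_eq ?_)) <;> field_simp
    norm_num
  obtain ⟨ρ₆, l6, u6, p6⟩ := hP (κ * ρ₅ / m) (by linarith) (by positivity)
  have n6 : 0 < ρ₆ := lt_of_lt_of_le (by positivity) l6
  rw [le_div_iff₀ (by positivity)] at u5 u6
  have e1 := hle n1
  have e2 := hle n2
  have e3 := hle n3
  have e4 := hle n4
  have e5 := hle n5
  have f5 : ρ₅ ≤ ρ₅ * k := le_mul_of_one_le_right n5.le hk'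
  have f6 : ρ₆ ≤ ρ₆ * m := le_mul_of_one_le_right n6.le hm'
  refine ⟨ρ₁, ρ₂, ρ₃, ρ₄, ρ₅, ρ₆, ⟨p1, p2, p3, p4, p5, p6⟩, n6, by linarith, by linarith,
    by linarith, by linarith, by linarith, u1, b6.trans l6, by linarith, by linarith,
    by linarith, by linarith, by linarith, by linarith⟩

set_option maxHeartbeats 800000 in
lemma exists_step {D : G ≃+ G} (hD : ∀ x, D x = x + x) {Γ : Finset (AddChar G ℂ)} {A : Finset G}
    {Q h k m n p : ℕ} (hQ : 0 < Q) (hh : 0 < h) (hk : 0 < k) (hm : 0 < m) (hn : 0 < n)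
    (hp : Even p) {α ω ε c σ₀ ρ : ℝ} (hα : 0 < α) (hηα : 512 * (1 / h : ℝ) ≤ α)
    (hpα : 3 ≤ 2 ^ p * (α / 4 * (1 / 2048))) (hω : 0 < ω) (hωα : ω ≤ (α ^ 2 / 8) ^ (64 * p))
    (hε : 0 ≤ ε) (hε1 : ε ≤ 1)
    (hkε : k * (2 * ε + 16 / ω * Real.exp (-(n * ε ^ 2 / 4))) ≤ 1 / 2048)
    (hmω : 8 * (2 / ω) ^ n < Real.exp (m / 8)) (hck : 2 ≤ c * 4 ^ k)
    (hcω : 2 * c ≤ 1 / 2048 * ω) (hc : 0 < c) (hc1 : c ≤ 1) (hηc : 8 * (1 / h : ℝ) ≤ c)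
    (hη : 2048 * (1 / h : ℝ) ≤ 1)
    (hρ : 0 < ρ) (hρ1 : ρ ≤ 1)
    (hσ₀ : σ₀ ≤ (1 / (2 * (h * Q)) : ℝ) ^ 7 * c / (32768 * k * m ^ 2) * ρ)
    (hcard : ∀ Γ' : Finset (AddChar G ℂ), #Γ' ≤ #Γ + m → ∀ σ, σ₀ ≤ σ →
      Fintype.card G ≤ 2 ^ Q * #(bohr Γ' σ))
    (hreg : IsRegular Γ (1 / h) (1 / (2 * (h * Q))) ρ)
    (hA : ∃ x, α * #(bohr Γ ρ) ≤ #((bohr Γ ρ).filter fun u => x + u ∈ A)) :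
    α ^ 3 / 16 * (Fintype.card G / 2 ^ Q) ^ 2 ≤ #(progressions A) ∨
    ∃ (Γ' : Finset (AddChar G ℂ)) (ρ' : ℝ), #Γ' ≤ #Γ + m ∧
      (1 / (2 * (h * Q)) : ℝ) ^ 7 * c / (32768 * k * m ^ 2) * ρ ≤ ρ' ∧ ρ' ≤ 1 ∧
      IsRegular Γ' (1 / h) (1 / (2 * (h * Q))) ρ' ∧
      ∃ x, (1 + 1 / 1024) * α * #(bohr Γ' ρ') ≤ #((bohr Γ' ρ').filter fun u => x + u ∈ A) := by
  classical
  have hh' : (1 : ℝ) ≤ h := by exact_mod_cast hh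
  have hQ' : (1 : ℝ) ≤ Q := by exact_mod_cast hQ
  have hk' : (1 : ℝ) ≤ k := by exact_mod_cast hk
  have hm' : (1 : ℝ) ≤ m := by exact_mod_cast hm
  have hη0 : (0 : ℝ) < 1 / h := by positivity
  have hκ : (0 : ℝ) < 1 / (2 * (h * Q)) := by positivity
  have hκ1 : (1 / (2 * (h * Q)) : ℝ) ≤ 1 := by
    rw [div_le_one (by positivity)]; nlinarith
  have pick : ∀ Γ' : Finset (AddChar G ℂ), #Γ' ≤ #Γ + m → ∀ σ, σ₀ ≤ σ / 2 → 0 ≤ σ →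
      ∃ ρ, σ / 2 ≤ ρ ∧ ρ ≤ σ ∧ IsRegular Γ' (1 / h) (1 / (2 * (h * Q))) ρ :=
    fun Γ' hΓ' σ hσ hσ0 => exists_isRegular Γ' hQ hh hσ0 (hcard Γ' hΓ' _ hσ)
  generalize (1 / h : ℝ) = η at *
  generalize (1 / (2 * (h * Q)) : ℝ) = κ at *
  have hκρ : κ * ρ ≤ 1 := mul_le_one₀ hκ1 hρ.le hρ1
  have hθ : κ ^ 7 * c / (32768 * k * m ^ 2) = κ * c / (4 * m) * (κ ^ 6 / (8192 * k * m)) := by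
    field_simp; norm_num
  have hθ1 : κ * c / (4 * m) ≤ 1 := by
    rw [div_le_one (by positivity)]; linarith [mul_le_one₀ hκ1 hc.le hc1]
  have hθ6 : κ ^ 7 * c / (32768 * k * m ^ 2) * ρ ≤ κ ^ 6 / (8192 * k * m) * ρ := by
    rw [hθ]
    gcongr
    exact mul_le_of_le_one_left (by positivity) hθ1
  obtain ⟨ρ₁, ρ₂, ρ₃, ρ₄, ρ₅, ρ₆, ⟨p1, p2, p3, p4, p5, p6⟩, n6, g6, g5, g4, g3, g2, g1, b6, h21,
    h32, h41, h53, h54, h65⟩ := exists_radii (pick Γ (by omega)) hκ hκ1 hρ hk hm (hσ₀.trans hθ6)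
  obtain ⟨x₀, hx₀⟩ := hA
  set B := bohr Γ ρ with hB
  set B₁ := bohr Γ ρ₁ with hB1
  set B₂ := bohr Γ ρ₂ with hB2
  have hB0 : (0 : ℝ) < #B := by exact_mod_cast (bohr_nonempty Γ hρ.le).card_pos
  have hB10 : (0 : ℝ) < #B₁ := by exact_mod_cast (bohr_nonempty Γ (by linarith)).card_pos
  have hB20 : (0 : ℝ) < #B₂ := by exact_mod_cast (bohr_nonempty Γ (by linarith)).card_pos
  have hS : ∀ τ ≤ κ * ρ, ∀ a ∈ B.filter (fun u => x₀ + u ∈ A), ∀ u ∈ bohr Γ τ,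
      a - u ∈ bohr Γ ((1 + κ) * ρ) := fun τ hτ a ha u hu =>
    bohr_mono Γ (by linarith) (sub_mem_bohr (mem_filter.1 ha).1 hu)
  obtain ⟨x, hx⟩ := exists_translate_add_density (bohr_nonempty Γ (by positivity))
    (bohr_nonempty Γ (by linarith)) (bohr_nonempty Γ (by linarith)) (hS ρ₁ g1)
    (hS ρ₂ (by linarith))
  have hmono : ∀ E : Finset G, (#(E.filter fun u => x + u ∈ B.filter fun u => x₀ + u ∈ A) : ℝ) ≤
      #(E.filter fun u => x₀ + x + u ∈ A) := by
    intro E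
    norm_cast
    refine card_le_card fun u hu => ?_
    simp only [mem_filter] at hu ⊢
    exact ⟨hu.1, by rw [add_assoc]; exact hu.2.2⟩
  set A₁ := B₁.filter fun u => x₀ + x + u ∈ A with hA1
  set C₀ := B₂.filter fun u => x₀ + x + u ∈ A with hC0
  have hsum : 2 * α * (1 - η) ≤ (#A₁ / #B₁ : ℝ) + #C₀ / #B₂ := by
    refine le_trans ?_ (hx.trans (add_le_add
      (div_le_div_of_nonneg_right (hmono _) hB10.le)
      (div_le_div_of_nonneg_right (hmono _) hB20.le)))
    have hS0 : (0 : ℝ) < #(bohr Γ ((1 + κ) * ρ)) := by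
      exact_mod_cast (bohr_nonempty Γ (by positivity)).card_pos
    rw [le_div_iff₀ hS0]
    unfold IsRegular at hreg
    calc 2 * α * (1 - η) * #(bohr Γ ((1 + κ) * ρ))
        ≤ 2 * α * (1 - η) * ((1 + η) * #B) := by
          have : 0 ≤ 1 - η := by linarith
          gcongr
      _ = 2 * (α * #B) - 2 * α * η ^ 2 * #B := by ring
      _ ≤ 2 * (α * #B) := by
          have : 0 ≤ 2 * α * η ^ 2 * #B := by positivity
          linarith
      _ ≤ _ := by gcongr
  by_cases hd1 : (1 + 1 / 1024) * α ≤ #A₁ / #B₁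
  · right
    exact ⟨Γ, ρ₁, by omega, by linarith, by linarith, p1, x₀ + x,
      (le_div_iff₀ hB10).1 hd1⟩
  by_cases hd2 : (1 + 1 / 1024) * α ≤ #C₀ / #B₂
  · right
    exact ⟨Γ, ρ₂, by omega, by linarith, by linarith, p2, x₀ + x,
      (le_div_iff₀ hB20).1 hd2⟩
  push Not at hd1 hd2
  have hηα' : 2048 * η * α ≤ 1 * α := by gcongr
  have hβ1 : (1 - 2 / 1024) * α ≤ #A₁ / #B₁ := by linarith
  have hβ2 : (1 - 2 / 1024) * α ≤ #C₀ / #B₂ := by linarith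
  have hβ1' : α / 2 ≤ #A₁ / #B₁ := by linarith
  have hβ2' : α / 2 ≤ #C₀ / #B₂ := by linarith
  have hC0' : α / 2 * #B₂ ≤ #C₀ := (le_div_iff₀ hB20).1 hβ2'
  by_cases hfew : ∑ w ∈ C₀, conv (ind A₁) (w + w) ≤ 1 / 2 * ((#A₁ / #B₁ : ℝ) ^ 2 * #B₁) * #C₀
  swap
  · left
    push Not at hfew
    have h1 := hfew.le.trans (sum_conv_le_card_progressions A B₁ B₂ (x₀ + x))
    have hG : ∀ τ, κ ^ 7 * c / (32768 * k * m ^ 2) * ρ ≤ τ →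
        (Fintype.card G / 2 ^ Q : ℝ) ≤ #(bohr Γ τ) := by
      intro τ hτ
      rw [div_le_iff₀' (by positivity)]
      exact_mod_cast hcard Γ (by omega) τ (hσ₀.trans hτ)
    refine le_trans ?_ h1
    calc α ^ 3 / 16 * (Fintype.card G / 2 ^ Q : ℝ) ^ 2
        = α ^ 3 / 16 * ((Fintype.card G / 2 ^ Q) * (Fintype.card G / 2 ^ Q)) := by ring
      _ ≤ α ^ 3 / 16 * (#B₁ * #B₂) := by
          gcongr
          · exact hG _ (by linarith)
          · exact hG _ (by linarith)
      _ = 1 / 2 * ((α / 2) ^ 2 * #B₁) * (α / 2 * #B₂) := by ring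
      _ ≤ _ := by gcongr
  right
  have hA10 : A₁.Nonempty := by
    rw [nonempty_iff_ne_empty]
    intro h0
    rw [h0] at hβ1'
    simp at hβ1'
    linarith
  have hωβ : ω ≤ ((#A₁ / #B₁ : ℝ) ^ 2 / 2) ^ (64 * p) := by
    refine hωα.trans (pow_le_pow_left₀ (by positivity) ?_ _)
    have := pow_le_pow_left₀ (by positivity) hβ1' 2
    linarith
  obtain ⟨Γ', hΓ', hinc⟩ := exists_bohr_increment (A := A₁) (C := C₀) hD (by linarith)
    (by linarith) hκ.le p1 p2 p3 p4 p5 p6 (by linarith) (by linarith) (by linarith) (by linarith) (by linarith) n6.le h21 h32 h41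
    h53 h54 h65 (filter_subset _ _) hA10 (filter_subset _ _) hfew (δ := 1 / 2048) (γ := α / 4)
    (by norm_num) (by norm_num) (by linarith) (by linarith) (by positivity) hp hpα hω
    hωβ hε hε1 hn hkε hmω hck hcω
  have hstart : κ ^ 7 * c / (32768 * k * m ^ 2) * ρ ≤ κ * ρ₆ * c / (2 * m) / 2 := by
    rw [hθ]
    calc κ * c / (4 * m) * (κ ^ 6 / (8192 * k * m)) * ρ
        = κ * c / (4 * m) * (κ ^ 6 / (8192 * k * m) * ρ) := by ring
      _ ≤ κ * c / (4 * m) * ρ₆ := by gcongr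
      _ = _ := by ring
  obtain ⟨ρ', l', u', p'⟩ := pick Γ' hΓ' (κ * ρ₆ * c / (2 * m)) (hσ₀.trans hstart) (by positivity)
  have hρ6 : ρ₆ ≤ 1 := by linarith
  have hρ'c : m * ρ' ≤ c / 2 := by
    rw [le_div_iff₀ (by positivity)] at u'
    have : κ * ρ₆ * c ≤ 1 * 1 * c := by gcongr
    linarith
  have hρ'6 : ρ' ≤ κ * ρ₆ := by
    refine u'.trans ?_
    rw [div_le_iff₀ (by positivity)]
    have : 0 < κ * ρ₆ := by positivity
    have h2 : c ≤ 2 * m := by linarith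
    exact mul_le_mul_of_nonneg_left h2 this.le
  have hρ'0 : 0 ≤ ρ' := le_trans (by positivity) l'
  obtain ⟨y, hy⟩ := hinc ρ' hρ'0 hρ'6 (by linarith)
  refine ⟨Γ', ρ', hΓ', hstart.trans l', by linarith [mul_le_one₀ hκ1 n6.le hρ6], p', x₀ + x + y, ?_⟩
  have hsub : (#((bohr Γ' ρ').filter fun u => y + u ∈ A₁) : ℝ) ≤
      #((bohr Γ' ρ').filter fun u => x₀ + x + y + u ∈ A) := by
    norm_cast
    refine card_le_card fun u hu => ?_
    simp only [hA1, mem_filter] at hu ⊢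
    exact ⟨hu.1, by rw [add_assoc (x₀ + x)]; exact hu.2.2⟩
  refine le_trans ?_ (hy.trans hsub)
  rw [← mul_assoc]
  exact mul_le_mul_of_nonneg_right (by linarith) (Nat.cast_nonneg _)

lemma le_card_progressions_of_parameters {D : G ≃+ G} (hD : ∀ x, D x = x + x) {A : Finset G}
    {Q h k m n p S : ℕ} (hQ : 0 < Q) (hh : 0 < h) (hk : 0 < k) (hm : 0 < m) (hn : 0 < n)
    (hp : Even p) {α ω ε c θ : ℝ} (hα : 0 < α) (hηα : 512 * (1 / h : ℝ) ≤ α)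
    (hpα : 3 ≤ 2 ^ p * (α / 4 * (1 / 2048))) (hω : 0 < ω) (hωα : ω ≤ (α ^ 2 / 8) ^ (64 * p))
    (hε : 0 ≤ ε) (hε1 : ε ≤ 1)
    (hkε : k * (2 * ε + 16 / ω * Real.exp (-(n * ε ^ 2 / 4))) ≤ 1 / 2048)
    (hmω : 8 * (2 / ω) ^ n < Real.exp (m / 8)) (hck : 2 ≤ c * 4 ^ k)
    (hcω : 2 * c ≤ 1 / 2048 * ω) (hc : 0 < c) (hc1 : c ≤ 1) (hηc : 8 * (1 / h : ℝ) ≤ c)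
    (hη : 2048 * (1 / h : ℝ) ≤ 1) (hθ0 : 0 < θ) (hθ1 : θ ≤ 1)
    (hθ : θ ≤ (1 / (2 * (h * Q)) : ℝ) ^ 7 * c / (32768 * k * m ^ 2))
    (hcard : ∀ Γ : Finset (AddChar G ℂ), #Γ ≤ S * m → ∀ σ, θ ^ S ≤ σ →
      Fintype.card G ≤ 2 ^ Q * #(bohr Γ σ))
    (hA : α * Fintype.card G ≤ #A) (hS : 1 < (1 + 1 / 1024) ^ S * α) :
    α ^ 3 / 16 * (Fintype.card G / 2 ^ Q) ^ 2 ≤ #(progressions A) := by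
  by_contra hcon
  have hind : ∀ s ≤ S, ∃ (Γ : Finset (AddChar G ℂ)) (ρ : ℝ), #Γ ≤ s * m ∧ θ ^ s ≤ ρ ∧ ρ ≤ 1 ∧
      IsRegular Γ (1 / h) (1 / (2 * (h * Q))) ρ ∧
      ∃ x, (1 + 1 / 1024) ^ s * α * #(bohr Γ ρ) ≤ #((bohr Γ ρ).filter fun u => x + u ∈ A) := by
    intro s
    induction s with
    | zero =>
      intro _
      have hb : ∀ ρ : ℝ, bohr (∅ : Finset (AddChar G ℂ)) ρ = univ := fun ρ => by
        ext; simp [mem_bohr]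
      refine ⟨∅, 1, by simp, by simp, le_rfl, ?_, 0, ?_⟩
      · unfold IsRegular
        rw [hb, hb]
        refine le_mul_of_one_le_left (by positivity) ?_
        have : (0 : ℝ) ≤ 1 / h := by positivity
        linarith
      · rw [hb, card_univ]
        simpa using hA
    | succ s ih =>
      intro hs
      obtain ⟨Γ, ρ, hΓ, hρ, hρ1, hreg, hx⟩ := ih (by omega)
      have hρ0 : 0 < ρ := lt_of_lt_of_le (by positivity) hρ
      have hrank : #Γ + m ≤ S * m := by
        calc _ ≤ s * m + m := by omega
          _ = (s + 1) * m := by ring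
          _ ≤ _ := Nat.mul_le_mul_right _ hs
      have hle : α ≤ (1 + 1 / 1024) ^ s * α :=
        le_mul_of_one_le_left hα.le (one_le_pow₀ (by norm_num))
      have hθρ : θ ^ (s + 1) ≤ (1 / (2 * (h * Q)) : ℝ) ^ 7 * c / (32768 * k * m ^ 2) * ρ := by
        rw [pow_succ']
        exact mul_le_mul hθ hρ (by positivity) (by positivity)
      rcases exists_step hD hQ hh hk hm hn hp (α := (1 + 1 / 1024) ^ s * α) (σ₀ := θ ^ S)
        (by positivity) (hηα.trans hle) (hpα.trans (by gcongr)) hω (hωα.trans (by gcongr)) hε hε1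
        hkε hmω hck hcω hc hc1 hηc hη hρ0 hρ1
        ((pow_le_pow_of_le_one hθ0.le hθ1 hs).trans hθρ)
        (fun Γ' hΓ' => hcard Γ' (hΓ'.trans hrank)) hreg hx with hmany | ⟨Γ', ρ', h1, h2, h3, h4, h5⟩
      · refine absurd (le_trans ?_ hmany) hcon
        gcongr
      · refine ⟨Γ', ρ', ?_, hθρ.trans h2, h3, h4, ?_⟩
        · calc _ ≤ #Γ + m := h1
            _ ≤ s * m + m := by omega
            _ = _ := by ring
        · rw [pow_succ' (1 + 1 / 1024 : ℝ), mul_assoc (1 + 1 / 1024 : ℝ)]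
          exact h5
  obtain ⟨Γ, ρ, -, hρ, -, -, x, hx⟩ := hind S le_rfl
  have h1 : (#((bohr Γ ρ).filter fun u => x + u ∈ A) : ℝ) ≤ #(bohr Γ ρ) := by
    exact_mod_cast card_filter_le _ _
  have h2 : (0 : ℝ) < #(bohr Γ ρ) := by
    exact_mod_cast (bohr_nonempty Γ (le_trans (by positivity) hρ)).card_pos
  have := mul_lt_mul_of_pos_right hS h2
  linarith

lemma cast_sq_le_two_pow (d : ℕ) : (d : ℝ) ^ 2 ≤ 2 ^ (d ^ 2) := by
  have := (Nat.lt_two_pow_self (n := d ^ 2)).le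
  exact_mod_cast this

lemma parameter_error_le {d : ℕ} (hd : 1 ≤ d) :
    ((4096 * d ^ 2 : ℕ) : ℝ) * (2 * (1 / (2 ^ 25 * d ^ 2)) + 16 / (1 / 2) ^ (5120 * d ^ 2) *
      Real.exp (-((2 ^ 65 * d ^ 6 : ℕ) * (1 / (2 ^ 25 * d ^ 2)) ^ 2 / 4))) ≤ 1 / 2048 := by
  have hd' : (1 : ℝ) ≤ d := by exact_mod_cast hd
  have e1 : ((2 ^ 65 * d ^ 6 : ℕ) : ℝ) * (1 / (2 ^ 25 * d ^ 2)) ^ 2 / 4 =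
      ((8192 * d ^ 2 : ℕ) : ℝ) * 1 := by
    push_cast
    field_simp
    norm_num
  rw [e1, Real.exp_neg, Real.exp_nat_mul]
  have h2 : (2 : ℝ) ^ (8192 * d ^ 2) ≤ Real.exp 1 ^ (8192 * d ^ 2) := by
    gcongr
    linarith [Real.add_one_le_exp 1]
  have h3 : 16 / (1 / 2 : ℝ) ^ (5120 * d ^ 2) * (Real.exp 1 ^ (8192 * d ^ 2))⁻¹ ≤
      1 / (2 ^ 24 * d ^ 2) := by
    calc _ ≤ 16 / (1 / 2 : ℝ) ^ (5120 * d ^ 2) * (2 ^ (8192 * d ^ 2))⁻¹ := by gcongr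
      _ = 16 * 2 ^ (5120 * d ^ 2) / 2 ^ (8192 * d ^ 2) := by
          rw [one_div, inv_pow, div_inv_eq_mul, ← div_eq_mul_inv]
      _ ≤ _ := by
          rw [div_le_div_iff₀ (by positivity) (by positivity)]
          calc 16 * (2 : ℝ) ^ (5120 * d ^ 2) * (2 ^ 24 * d ^ 2)
              ≤ 16 * (2 : ℝ) ^ (5120 * d ^ 2) * (2 ^ 24 * 2 ^ (d ^ 2)) := by
                gcongr; exact cast_sq_le_two_pow d
            _ = 2 ^ (28 + 5120 * d ^ 2 + d ^ 2) := by
                rw [pow_add, pow_add]; ring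
            _ ≤ 2 ^ (8192 * d ^ 2) := by
                refine pow_le_pow_right₀ (by norm_num) ?_
                have := Nat.one_le_pow 2 d hd
                omega
            _ = _ := (one_mul _).symm
  calc _ ≤ ((4096 * d ^ 2 : ℕ) : ℝ) * (2 * (1 / (2 ^ 25 * d ^ 2)) + 1 / (2 ^ 24 * d ^ 2)) := by
        gcongr
    _ = _ := by
        push_cast
        field_simp
        norm_num

lemma parameter_rank_lt {d : ℕ} (hd : 1 ≤ d) :
    8 * (2 / (1 / 2 : ℝ) ^ (5120 * d ^ 2)) ^ (2 ^ 65 * d ^ 6) <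
      Real.exp ((2 ^ 82 * d ^ 8 : ℕ) / 8) := by
  have e1 : ((2 ^ 82 * d ^ 8 : ℕ) : ℝ) / 8 = ((2 ^ 79 * d ^ 8 : ℕ) : ℝ) * 1 := by
    push_cast
    ring
  rw [e1, Real.exp_nat_mul]
  have h1 : 8 * (2 / (1 / 2 : ℝ) ^ (5120 * d ^ 2)) ^ (2 ^ 65 * d ^ 6) =
      2 ^ (3 + (5120 * d ^ 2 + 1) * (2 ^ 65 * d ^ 6)) := by
    rw [one_div, inv_pow, div_inv_eq_mul, ← pow_succ', ← pow_mul, pow_add]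
    norm_num
  rw [h1]
  have h2 : (2 : ℝ) ^ (2 ^ 79 * d ^ 8) ≤ Real.exp 1 ^ (2 ^ 79 * d ^ 8) := by
    gcongr
    linarith [Real.add_one_le_exp 1]
  refine lt_of_lt_of_le (pow_lt_pow_right₀ (by norm_num) ?_) h2
  have h6 := Nat.one_le_pow 6 d hd
  have h8 : d ^ 6 ≤ d ^ 8 := Nat.pow_le_pow_right hd (by norm_num)
  have h7 : (5120 * d ^ 2 + 1) * (2 ^ 65 * d ^ 6) =
      2 ^ 65 * 5120 * d ^ 8 + 2 ^ 65 * d ^ 6 := by ring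
  rw [h7]
  omega

lemma parameter_radius_le {d : ℕ} (hd : 1 ≤ d) :
    (1 / 2 : ℝ) ^ (2 ^ 18 * d ^ 2) ≤
      (1 / (2 * ((2 ^ (2 ^ 14 * d ^ 2) : ℕ) * (2 ^ 124 * d ^ 12 : ℕ))) : ℝ) ^ 7 *
        (1 / 2) ^ (8191 * d ^ 2) / (32768 * (4096 * d ^ 2 : ℕ) * (2 ^ 82 * d ^ 8 : ℕ) ^ 2) := by
  have hd' : (1 : ℝ) ≤ d := by exact_mod_cast hd
  have e1 := Nat.one_le_pow 2 d hd
  have hdd := cast_sq_le_two_pow d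
  set e := d ^ 2 with he
  have h12 : (d : ℝ) ^ 12 ≤ 2 ^ (6 * e) := by
    calc (d : ℝ) ^ 12 = (d ^ 2) ^ 6 := by ring
      _ ≤ (2 ^ e) ^ 6 := by gcongr
      _ = _ := by rw [← pow_mul, mul_comm]
  have h18 : (d : ℝ) ^ 18 ≤ 2 ^ (9 * e) := by
    calc (d : ℝ) ^ 18 = (d ^ 2) ^ 9 := by ring
      _ ≤ (2 ^ e) ^ 9 := by gcongr
      _ = _ := by rw [← pow_mul, mul_comm]
  have hκ : (1 / 2 : ℝ) ^ (2 ^ 15 * e) ≤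
      1 / (2 * ((2 ^ (2 ^ 14 * e) : ℕ) * (2 ^ 124 * d ^ 12 : ℕ))) := by
    rw [one_div_pow]
    refine one_div_le_one_div_of_le (by positivity) ?_
    simp only [Nat.cast_mul, Nat.cast_pow, Nat.cast_ofNat]
    calc (2 : ℝ) * (2 ^ (2 ^ 14 * e) * (2 ^ 124 * d ^ 12))
        ≤ 2 * (2 ^ (2 ^ 14 * e) * (2 ^ 124 * 2 ^ (6 * e))) := by gcongr
      _ = 2 ^ (1 + (2 ^ 14 * e + (124 + 6 * e))) := by rw [pow_add, pow_add, pow_add, pow_one]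
      _ ≤ _ := pow_le_pow_right₀ (by norm_num) (by omega)
  have hkm : (32768 * (4096 * e : ℕ) * (2 ^ 82 * d ^ 8 : ℕ) ^ 2 : ℝ) ≤ 2 ^ (200 * e) := by
    calc (32768 * (4096 * e : ℕ) * (2 ^ 82 * d ^ 8 : ℕ) ^ 2 : ℝ) = 2 ^ 191 * d ^ 18 := by
          rw [he]; push_cast; ring
      _ ≤ 2 ^ 191 * 2 ^ (9 * e) := by gcongr
      _ = 2 ^ (191 + 9 * e) := by rw [pow_add]
      _ ≤ _ := pow_le_pow_right₀ (by norm_num) (by omega)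
  have hpos : (0 : ℝ) < 32768 * (4096 * e : ℕ) * (2 ^ 82 * d ^ 8 : ℕ) ^ 2 := by positivity
  rw [le_div_iff₀ hpos]
  calc (1 / 2 : ℝ) ^ (2 ^ 18 * e) * (32768 * (4096 * e : ℕ) * (2 ^ 82 * d ^ 8 : ℕ) ^ 2)
      ≤ (1 / 2 : ℝ) ^ (2 ^ 15 * e * 7 + 8191 * e + 200 * e) * 2 ^ (200 * e) :=
        mul_le_mul (pow_le_pow_of_le_one (by norm_num) (by norm_num) (by omega)) hkm
          hpos.le (by positivity)
    _ = ((1 / 2 : ℝ) ^ (2 ^ 15 * e)) ^ 7 * (1 / 2) ^ (8191 * e) := by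
        rw [pow_add, pow_add, mul_assoc, ← mul_pow, pow_mul]
        norm_num
    _ ≤ _ := by gcongr

/-- Many three-term progressions in a dense subset of a finite abelian group of odd order. -/
theorem le_card_progressions {D : G ≃+ G} (hD : ∀ x, D x = x + x) {d : ℕ} (hd : 1 ≤ d)
    {A : Finset G} (hA : (1 / 2 : ℝ) ^ d * Fintype.card G ≤ #A) :
    (1 / 2 : ℝ) ^ (2 ^ 126 * d ^ 12) * (Fintype.card G : ℝ) ^ 2 ≤ #(progressions A) := by
  have hd' : (1 : ℝ) ≤ d := by exact_mod_cast hd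
  have e2 := Nat.one_le_pow 2 d hd
  have hde : d ≤ d ^ 2 := Nat.le_self_pow (by norm_num) d
  have hh : (1 / (2 ^ (2 ^ 14 * d ^ 2) : ℕ) : ℝ) = (1 / 2) ^ (2 ^ 14 * d ^ 2) := by
    rw [Nat.cast_pow, Nat.cast_ofNat, one_div_pow]
  have hhalf : ∀ {i j : ℕ}, i ≤ j → (1 / 2 : ℝ) ^ j ≤ (1 / 2) ^ i := fun h =>
    pow_le_pow_of_le_one (by norm_num) (by norm_num) h
  have key := le_card_progressions_of_parameters hD (A := A) (Q := 2 ^ 124 * d ^ 12)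
    (h := 2 ^ (2 ^ 14 * d ^ 2)) (k := 4096 * d ^ 2) (m := 2 ^ 82 * d ^ 8) (n := 2 ^ 65 * d ^ 6)
    (p := 16 * d) (S := 2 ^ 11 * d) (α := (1 / 2) ^ d) (ω := (1 / 2) ^ (5120 * d ^ 2))
    (ε := 1 / (2 ^ 25 * d ^ 2)) (c := (1 / 2) ^ (8191 * d ^ 2)) (θ := (1 / 2) ^ (2 ^ 18 * d ^ 2))
    (by positivity) (by positivity) (by positivity) (by positivity) (by positivity)
    ⟨8 * d, by ring⟩ (by positivity)
    (by
      rw [hh]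
      calc 512 * (1 / 2 : ℝ) ^ (2 ^ 14 * d ^ 2) ≤ 512 * (1 / 2) ^ (9 + d) := by
            gcongr ?_ * ?_
            exact hhalf (by omega)
        _ = _ := by rw [pow_add, ← mul_assoc]; norm_num)
    (by
      calc (3 : ℝ) ≤ 2 ^ (15 * 1) * (1 / 8192) := by norm_num
        _ ≤ 2 ^ (15 * d) * (1 / 8192) := by gcongr; norm_num
        _ = 2 ^ (15 * d) * (2 ^ d * (1 / 2) ^ d) * (1 / 8192) := by rw [← mul_pow]; norm_num
        _ = 2 ^ (16 * d) * ((1 / 2) ^ d / 4 * (1 / 2048)) := by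
          rw [show 16 * d = 15 * d + d by ring, pow_add]; ring)
    (by positivity)
    (by
      have h8 : ((1 / 2 : ℝ) ^ d) ^ 2 / 8 = (1 / 2) ^ (d * 2 + 3) := by
        rw [pow_add, pow_mul]; norm_num; ring
      rw [h8, ← pow_mul]
      refine hhalf ?_
      nlinarith)
    (by positivity)
    (by
      rw [div_le_one (by positivity)]
      have := one_le_pow₀ hd' (n := 2)
      linarith)
    (parameter_error_le hd) (parameter_rank_lt hd)
    (by
      rw [show (4 : ℝ) = 2 ^ 2 by norm_num, ← pow_mul,
        show 2 * (4096 * d ^ 2) = 8191 * d ^ 2 + d ^ 2 by ring, pow_add, ← mul_assoc, ← mul_pow]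
      norm_num
      calc (2 : ℝ) = 2 ^ 1 := by norm_num
        _ ≤ 2 ^ (d ^ 2) := pow_le_pow_right₀ (by norm_num) e2)
    (by
      calc 2 * (1 / 2 : ℝ) ^ (8191 * d ^ 2) ≤ 2 * (1 / 2) ^ (5120 * d ^ 2 + 12) := by
            gcongr ?_ * ?_
            exact hhalf (by omega)
        _ = _ := by rw [pow_add]; ring)
    (by positivity) (pow_le_one₀ (by norm_num) (by norm_num))
    (by
      rw [hh]
      calc 8 * (1 / 2 : ℝ) ^ (2 ^ 14 * d ^ 2) ≤ 8 * (1 / 2) ^ (8191 * d ^ 2 + 3) := by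
            gcongr ?_ * ?_
            exact hhalf (by omega)
        _ = _ := by rw [pow_add]; ring)
    (by
      rw [hh]
      calc 2048 * (1 / 2 : ℝ) ^ (2 ^ 14 * d ^ 2) ≤ 2048 * (1 / 2) ^ 11 := by
            gcongr ?_ * ?_
            exact hhalf (by omega)
        _ = 1 := by norm_num)
    (by positivity) (pow_le_one₀ (by norm_num) (by norm_num)) (parameter_radius_le hd)
    (by
      intro Γ hΓ σ hσ
      rw [← pow_mul] at hσ
      refine (card_le_two_pow_mul_card_bohr Γ hσ).trans (Nat.mul_le_mul_right _ ?_)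
      refine Nat.pow_le_pow_right (by norm_num) ?_
      have h3 := Nat.one_le_pow 3 d hd
      calc (2 * (2 ^ 18 * d ^ 2 * (2 ^ 11 * d)) + 6) * #Γ
          ≤ (2 ^ 31 * d ^ 3) * (2 ^ 11 * d * (2 ^ 82 * d ^ 8)) := by
            refine Nat.mul_le_mul ?_ hΓ
            have : 2 ^ 18 * d ^ 2 * (2 ^ 11 * d) = 2 ^ 29 * d ^ 3 := by ring
            omega
        _ = _ := by ring)
    hA
    (by
      have h3 : (3 : ℝ) ≤ (1 + 1 / 1024) ^ 2 ^ 11 := by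
        have := one_add_mul_le_pow (a := (1 / 1024 : ℝ)) (by norm_num) (2 ^ 11)
        refine le_trans (le_of_eq ?_) this
        norm_num
      rw [pow_mul, ← mul_pow]
      refine one_lt_pow₀ ?_ (by omega)
      calc (1 : ℝ) < 3 * (1 / 2) := by norm_num
        _ ≤ _ := by gcongr)
  have hexp : 3 * d + 4 + 2 * (2 ^ 124 * d ^ 12) ≤ 2 ^ 126 * d ^ 12 := by
    have : d ≤ d ^ 12 := Nat.le_self_pow (by norm_num) d
    omega
  refine le_trans (mul_le_mul_of_nonneg_right (hhalf hexp) (sq_nonneg _)) (le_trans ?_ key)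
  refine le_of_eq ?_
  generalize 2 ^ 124 * d ^ 12 = Q
  rw [pow_add, pow_add, mul_comm 3 d, mul_comm 2 Q, pow_mul, pow_mul, one_div_pow (2 : ℝ) Q]
  ring

lemma card_progressions_image_le {N : ℕ} {A : Finset ℕ} (hA : A ⊆ Icc 1 N) :
    #(progressions (A.image ((↑) : ℕ → ZMod (2 * N + 1)))) ≤
      #((A ×ˢ A ×ˢ A).filter fun t => t.1 + t.2.1 = 2 * t.2.2) := by
  refine (card_le_card ?_).trans (card_image_le (f := fun t : ℕ × ℕ × ℕ =>
    ((t.1, t.2.1, t.2.2) : ZMod (2 * N + 1) × ZMod (2 * N + 1) × ZMod (2 * N + 1))))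
  rintro ⟨x, y, z⟩ h
  simp only [progressions, mem_filter, mem_product, mem_image] at h
  obtain ⟨⟨⟨a, ha, rfl⟩, ⟨b, hb, rfl⟩, ⟨c, hc, rfl⟩⟩, h⟩ := h
  simp only [mem_image, mem_filter, mem_product, Prod.exists]
  refine ⟨a, b, c, ⟨⟨ha, hb, hc⟩, ?_⟩, rfl⟩
  have ha' := mem_Icc.1 (hA ha)
  have hb' := mem_Icc.1 (hA hb)
  have hc' := mem_Icc.1 (hA hc)
  rw [← Nat.cast_add, ← Nat.cast_add, ZMod.natCast_eq_natCast_iff',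
    Nat.mod_eq_of_lt (by omega), Nat.mod_eq_of_lt (by omega)] at h
  omega

lemma card_image_natCast {N : ℕ} {A : Finset ℕ} (hA : A ⊆ Icc 1 N) :
    #(A.image ((↑) : ℕ → ZMod (2 * N + 1))) = #A := by
  refine card_image_of_injOn fun a ha b hb h => ?_
  have ha' := mem_Icc.1 (hA ha)
  have hb' := mem_Icc.1 (hA hb)
  rwa [ZMod.natCast_eq_natCast_iff', Nat.mod_eq_of_lt (by omega), Nat.mod_eq_of_lt (by omega)] at h

lemma exists_doubling_equiv (N : ℕ) :
    ∃ D : ZMod (2 * N + 1) ≃+ ZMod (2 * N + 1), ∀ x, D x = x + x := by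
  have hinj : Function.Injective (nsmulAddMonoidHom 2 : ZMod (2 * N + 1) →+ ZMod (2 * N + 1)) := by
    rw [injective_iff_map_eq_zero]
    intro x hx
    have h0 : (2 * N + 1 : ZMod (2 * N + 1)) = 0 := by exact_mod_cast ZMod.natCast_self (2 * N + 1)
    have hx' : 2 * x = 0 := by simpa using hx
    linear_combination x * h0 - N * hx'
  exact ⟨AddEquiv.ofBijective _ (Finite.injective_iff_bijective.1 hinj), fun x => two_nsmul x⟩

end KelleyMeka

/-- There is an absolute constant `C ≥ 1` such that for every `N ≥ 1`, every real `d ≥ 1`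
and every `A ⊆ {1,…,N}` with `|A| ≥ 2^{-d}·N`, the number of triples `(x,y,z) ∈ A³` with
`x + y = 2z` is at least `2^{-C·d^{12}} · N²`. -/
theorem many_three_term_APs_integers :
    ∃ C : ℝ, 1 ≤ C ∧ ∀ N : ℕ, 1 ≤ N → ∀ d : ℝ, 1 ≤ d → ∀ A : Finset ℕ,
      A ⊆ Finset.Icc 1 N →
      (2:ℝ) ^ (-d) * N ≤ A.card →
      (2:ℝ) ^ (-(C * d ^ 12)) * (N:ℝ) ^ 2 ≤
        (((A ×ˢ A ×ˢ A).filter fun t => t.1 + t.2.1 = 2 * t.2.2).card : ℝ) := by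
  refine ⟨2 ^ 150, by norm_num, fun N hN d hd A hA hAd => ?_⟩
  have hN' : (1 : ℝ) ≤ N := by exact_mod_cast hN
  obtain ⟨D, hD⟩ := KelleyMeka.exists_doubling_equiv N
  have hceil := (Nat.ceil_lt_add_one (by linarith : 0 ≤ d)).le
  have hle := Nat.le_ceil d
  have hcard : (Fintype.card (ZMod (2 * N + 1)) : ℝ) = 2 * N + 1 := by
    rw [ZMod.card]; push_cast; rfl
  have h := KelleyMeka.le_card_progressions hD (d := ⌈d⌉₊ + 2) (by omega)
    (A := A.image ((↑) : ℕ → ZMod (2 * N + 1))) (by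
      rw [KelleyMeka.card_image_natCast hA, hcard]
      refine le_trans ?_ hAd
      have h1 : (1 / 2 : ℝ) ^ ⌈d⌉₊ ≤ 2 ^ (-d) := by
        rw [one_div, inv_pow, Real.rpow_neg (by norm_num), ← Real.rpow_natCast]
        gcongr
        norm_num
      calc (1 / 2 : ℝ) ^ (⌈d⌉₊ + 2) * (2 * N + 1)
          ≤ (1 / 2 : ℝ) ^ (⌈d⌉₊ + 2) * (4 * N) := by gcongr; linarith
        _ = (1 / 2 : ℝ) ^ ⌈d⌉₊ * N := by rw [pow_add]; ring
        _ ≤ _ := by gcongr)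
  refine le_trans ?_ (h.trans (by exact_mod_cast KelleyMeka.card_progressions_image_le hA))
  rw [hcard]
  gcongr
  · have hpow : ∀ M : ℕ, (1 / 2 : ℝ) ^ M = 2 ^ (-(M : ℝ)) := fun M => by
      rw [Real.rpow_neg (by norm_num), Real.rpow_natCast, one_div, inv_pow]
    rw [hpow]
    refine Real.rpow_le_rpow_of_exponent_le (by norm_num) (neg_le_neg ?_)
    rw [Nat.cast_mul, Nat.cast_pow, Nat.cast_pow, Nat.cast_ofNat]
    calc (2 : ℝ) ^ 126 * ((⌈d⌉₊ + 2 : ℕ) : ℝ) ^ 12 ≤ 2 ^ 126 * (4 * d) ^ 12 := by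
          gcongr
          push_cast
          linarith
      _ = _ := by ring
  · linarith
end

section
/- Let G be a finite abelian group, let A, B ⊆ G be nonempty, let ε ∈ (0, 1/4], let k ≥ 2 be an even integer, and set m := ⌈k/ε⌉. Suppose ‖A ⋆ A‖_m ≤ 1 + ε and ‖B ⋆ B‖_m ≤ 1 + ε, where A and B also denote the density functions of these sets. Then ‖A * B − 1‖_k ≤ 2ε. Moreover, for every nonempty C ⊆ G with |C| ≥ 2^{−k}·|G|, one has |⟨A * B, C⟩ − 1| ≤ 4ε, where C also denotes the density function of the set C. -/
/-- The density function of a set `A ⊆ G`: `(|G|/|A|)·1_A`. -/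
noncomputable def dens {G : Type*} [Fintype G] [DecidableEq G] (A : Finset G) : G → ℝ :=
  fun x => if x ∈ A then (Fintype.card G : ℝ) / (A.card : ℝ) else 0

/-- Convolution: `(f * g)(x) = E_{y∈G} f(y)·g(x − y)`. -/
noncomputable def convC {G : Type*} [AddCommGroup G] [Fintype G] (f g : G → ℝ) : G → ℝ :=
  fun x => (∑ y, f y * g (x - y)) / (Fintype.card G : ℝ)

/-- Cross-correlation: `(f ⋆ g)(x) = E_{y∈G} f(y)·g(x + y)`. -/
noncomputable def starC {G : Type*} [AddCommGroup G] [Fintype G] (f g : G → ℝ) : G → ℝ :=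
  fun x => (∑ y, f y * g (x + y)) / (Fintype.card G : ℝ)

/-- The normalized `k`-norm: `‖f‖_k = (E_{x∈G} |f(x)|^k)^{1/k}`. -/
noncomputable def knorm {G : Type*} [Fintype G] (k : ℕ) (f : G → ℝ) : ℝ :=
  ((∑ x, |f x| ^ k) / (Fintype.card G : ℝ)) ^ ((1:ℝ)/(k:ℝ))

/-- Normalized inner product: `⟨f, g⟩ = E_{x∈G} f(x)·g(x)`. -/
noncomputable def inn {G : Type*} [Fintype G] (f g : G → ℝ) : ℝ :=
  (∑ x, f x * g x) / (Fintype.card G : ℝ)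

open Finset in
/-- Expanding the power of a bilinear kernel as a sum over tuples decouples the two kernels. -/
theorem sum_sum_pow_eq_sum_mul {α β γ : Type*} [Fintype α] [Fintype β] [Fintype γ]
    (u : α → γ → ℝ) (v : β → γ → ℝ) (k : ℕ) :
    ∑ x, ∑ z, (∑ y, u x y * v z y) ^ k =
      ∑ y : Fin k → γ, (∑ x, ∏ i, u x (y i)) * (∑ z, ∏ i, v z (y i)) := by
  simp_rw [Fintype.sum_pow, Finset.prod_mul_distrib, Finset.sum_mul_sum]
  rw [Finset.sum_comm' (t' := univ) (s' := fun _ => univ) (by simp)]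
  conv_lhs => enter [2, z]; rw [Finset.sum_comm]
  rw [Finset.sum_comm]
  refine Finset.sum_congr rfl fun y _ => ?_
  rw [Finset.sum_comm]

section Convolution

variable {G : Type*} [AddCommGroup G] [Fintype G]

theorem card_mul_sum_corr_pow (f : G → ℝ) (k : ℕ) :
    (Fintype.card G : ℝ) * ∑ x, (∑ y, f y * f (x + y)) ^ k =
      ∑ y : Fin k → G, (∑ x, ∏ i, f (x + y i)) ^ 2 := by
  simp_rw [sq]
  rw [← sum_sum_pow_eq_sum_mul (fun x y => f (x + y)) (fun x y => f (x + y)), ← nsmul_eq_mul,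
    ← Finset.card_univ, ← Finset.sum_const]
  refine Finset.sum_congr rfl fun z _ => ?_
  refine Fintype.sum_equiv (Equiv.addRight z) _ _ fun x => ?_
  congr 1
  refine Fintype.sum_equiv (Equiv.subRight z) _ _ fun y => ?_
  simp only [Equiv.coe_addRight, Equiv.subRight_apply]
  congr 2 <;> abel

theorem card_mul_sum_corr_pow_reflected (f : G → ℝ) (k : ℕ) :
    (Fintype.card G : ℝ) * ∑ x, (∑ y, f y * f (x + y)) ^ k =
      ∑ y : Fin k → G, (∑ x, ∏ i, f (x - y i)) ^ 2 := by
  rw [card_mul_sum_corr_pow]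
  refine Fintype.sum_equiv (Equiv.neg _) _ _ fun y => ?_
  simp

theorem card_mul_sum_conv_pow (f g : G → ℝ) (k : ℕ) :
    (Fintype.card G : ℝ) * ∑ x, (∑ y, f y * g (x - y)) ^ k =
      ∑ y : Fin k → G, (∑ x, ∏ i, f (x + y i)) * (∑ x, ∏ i, g (x - y i)) := by
  rw [← sum_sum_pow_eq_sum_mul (fun x y => f (x + y)) (fun x y => g (x - y)), ← nsmul_eq_mul,
    ← Finset.card_univ, ← Finset.sum_const]
  refine Finset.sum_congr rfl fun z _ => ?_
  refine Fintype.sum_equiv (Equiv.subRight z) _ _ fun x => ?_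
  congr 1
  refine Fintype.sum_equiv (Equiv.subRight z) _ _ fun y => ?_
  simp only [Equiv.subRight_apply]
  congr 2 <;> abel

/-- All moments of an autocorrelation are nonnegative. -/
theorem sum_starC_self_pow_nonneg (f : G → ℝ) (k : ℕ) : 0 ≤ ∑ x, starC f f x ^ k := by
  have hN : (0 : ℝ) < Fintype.card G := by exact_mod_cast Fintype.card_pos
  have h : 0 ≤ (Fintype.card G : ℝ) * ∑ x, (∑ y, f y * f (x + y)) ^ k := by
    rw [card_mul_sum_corr_pow]
    positivity
  simp only [starC, div_pow, ← Finset.sum_div]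
  exact div_nonneg (nonneg_of_mul_nonneg_right h hN) (by positivity)

/-- Moments of a convolution are controlled by the moments of the two autocorrelations. -/
theorem sum_convC_pow_sq_le (f g : G → ℝ) (k : ℕ) :
    (∑ x, convC f g x ^ k) ^ 2 ≤ (∑ x, starC f f x ^ k) * ∑ x, starC g g x ^ k := by
  have hN : (0 : ℝ) < Fintype.card G := by exact_mod_cast Fintype.card_pos
  have h := Finset.sum_mul_sq_le_sq_mul_sq Finset.univ
    (fun y : Fin k → G => ∑ x, ∏ i, f (x + y i)) (fun y => ∑ x, ∏ i, g (x - y i))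
  rw [← card_mul_sum_corr_pow, ← card_mul_sum_corr_pow_reflected, ← card_mul_sum_conv_pow,
    mul_pow, mul_mul_mul_comm, ← sq] at h
  have h' := le_of_mul_le_mul_left h (by positivity)
  simp only [convC, starC, div_pow, ← Finset.sum_div]
  rw [div_mul_div_comm, ← sq]
  gcongr

variable [DecidableEq G]

theorem sum_dens {A : Finset G} (hA : A.Nonempty) : ∑ x, dens A x = Fintype.card G := by
  have : (A.card : ℝ) ≠ 0 := by exact_mod_cast hA.card_pos.ne'
  simp only [dens, Finset.sum_ite_mem, Finset.univ_inter, Finset.sum_const, nsmul_eq_mul]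
  field_simp

theorem starC_dens_sub_one {A : Finset G} (hA : A.Nonempty) (x : G) :
    starC (fun y => dens A y - 1) (fun y => dens A y - 1) x = starC (dens A) (dens A) x - 1 := by
  have hN : (Fintype.card G : ℝ) ≠ 0 := by exact_mod_cast Fintype.card_pos.ne'
  have h : ∑ y, dens A (x + y) = Fintype.card G :=
    (Fintype.sum_equiv (Equiv.addLeft x) _ _ fun _ => rfl).trans (sum_dens hA)
  simp only [starC, sub_mul, mul_sub, Finset.sum_sub_distrib, h, sum_dens hA, mul_one, one_mul,
    Finset.sum_const, Finset.card_univ, nsmul_eq_mul]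
  field_simp
  ring

theorem convC_dens_sub_one {A B : Finset G} (hA : A.Nonempty) (hB : B.Nonempty) (x : G) :
    convC (fun y => dens A y - 1) (fun y => dens B y - 1) x = convC (dens A) (dens B) x - 1 := by
  have hN : (Fintype.card G : ℝ) ≠ 0 := by exact_mod_cast Fintype.card_pos.ne'
  have h : ∑ y, dens B (x - y) = Fintype.card G :=
    (Fintype.sum_equiv (Equiv.subLeft x) _ _ fun _ => rfl).trans (sum_dens hB)
  simp only [convC, sub_mul, mul_sub, Finset.sum_sub_distrib, h, sum_dens hA, mul_one, one_mul,
    Finset.sum_const, Finset.card_univ, nsmul_eq_mul]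
  field_simp
  ring

end Convolution

theorem knorm_le_iff {G : Type*} [Fintype G] [Nonempty G] {k : ℕ} (hk : k ≠ 0) (f : G → ℝ)
    {c : ℝ} (hc : 0 ≤ c) :
    knorm k f ≤ c ↔ ∑ x, |f x| ^ k ≤ c ^ k * Fintype.card G := by
  have hN : (0 : ℝ) < Fintype.card G := by exact_mod_cast Fintype.card_pos
  rw [knorm, one_div, Real.rpow_inv_le_iff_of_pos (by positivity) hc (by positivity),
    Real.rpow_natCast, div_le_iff₀ hN]

theorem one_add_inv_pow_le_exp_one (m : ℕ) : (1 + 1 / (m : ℝ)) ^ m ≤ Real.exp 1 := by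
  rcases Nat.eq_zero_or_pos m with rfl | hm
  · simp
  calc (1 + 1 / (m : ℝ)) ^ m ≤ Real.exp (1 / m) ^ m := by
        gcongr
        linarith [Real.add_one_le_exp (1 / (m : ℝ))]
    _ = Real.exp 1 := by
        rw [← Real.exp_nat_mul]
        congr 1
        field_simp

theorem one_add_two_div_pow_le {m : ℕ} (hm : 8 ≤ m) :
    (1 + 2 / (m : ℝ)) ^ m ≤ m.choose 2 * (2 * (2 / m)) ^ 2 := by
  have hm' : (8 : ℝ) ≤ m := by exact_mod_cast hm
  have hchoose : (m.choose 2 : ℝ) * (2 * (2 / m)) ^ 2 = 8 * (1 - 1 / m) := by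
    rw [Nat.cast_choose_two]
    field_simp
    ring
  rw [hchoose]
  rcases lt_or_ge m 14 with h | h
  · interval_cases m <;> norm_num
  · have h14 : (14 : ℝ) ≤ m := by exact_mod_cast h
    have hexp : (1 + 2 / (m : ℝ)) ^ m ≤ Real.exp 1 ^ 2 := by
      calc (1 + 2 / (m : ℝ)) ^ m ≤ Real.exp (2 / m) ^ m := by
            gcongr
            linarith [Real.add_one_le_exp (2 / (m : ℝ))]
        _ = Real.exp 1 ^ 2 := by
            rw [← Real.exp_nat_mul, ← Real.exp_nat_mul]
            congr 1
            field_simp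
            norm_num
    have h1 : 1 / (m : ℝ) ≤ 1 / 14 := by gcongr
    have h2 : Real.exp 1 ^ 2 ≤ 7.4 := by
      refine (pow_le_pow_left₀ (Real.exp_pos 1).le Real.exp_one_lt_d9.le 2).trans ?_
      norm_num
    linarith

theorem one_add_quadratic_le_pow {x : ℝ} (hx : 0 ≤ x) (n : ℕ) :
    1 + n * x + n * (n - 1) / 2 * x ^ 2 ≤ (1 + x) ^ n := by
  induction n with
  | zero => simp
  | succ n ih =>
    rw [pow_succ]
    refine le_trans ?_ (mul_le_mul_of_nonneg_right ih (by positivity))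
    have hn : (0 : ℝ) ≤ n * (n - 1) := by
      rcases n with _ | n
      · simp
      · push_cast
        rw [add_sub_cancel_right]
        positivity
    have : 0 ≤ (n : ℝ) * (n - 1) * x ^ 3 := by positivity
    push_cast
    linarith

theorem nine_fourths_mul_pow_le {k : ℕ} (hk : 2 ≤ k) :
    9 / 4 * (k : ℝ) ^ k ≤ ((k : ℝ) + 1) ^ k := by
  have hk0 : (2 : ℝ) ≤ k := by exact_mod_cast hk
  have h := one_add_quadratic_le_pow (x := 1 / (k : ℝ)) (by positivity) k
  have h2 : 1 / (k : ℝ) ≤ 1 / 2 := by gcongr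
  have h3 : 1 + k * (1 / (k : ℝ)) + k * (k - 1) / 2 * (1 / (k : ℝ)) ^ 2 =
      5 / 2 - 1 / 2 * (1 / k) := by
    field_simp
    ring
  calc 9 / 4 * (k : ℝ) ^ k ≤ (1 + 1 / (k : ℝ)) ^ k * (k : ℝ) ^ k := by
        gcongr
        linarith
    _ = ((k : ℝ) + 1) ^ k := by
        rw [← mul_pow]
        congr 1
        field_simp

theorem one_add_div_pow_le {k m : ℕ} (hk : 2 ≤ k) (hm : 4 * k ≤ m) :
    (1 + (k : ℝ) / m) ^ m ≤ m.choose k * (2 * (k / m)) ^ k := by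
  induction k, hk using Nat.le_induction with
  | base => exact_mod_cast one_add_two_div_pow_le hm
  | succ k hk ih =>
    specialize ih (by omega)
    have hk0 : (2 : ℝ) ≤ k := by exact_mod_cast hk
    have hmk : 4 * ((k : ℝ) + 1) ≤ m := by exact_mod_cast hm
    have hm0 : (0 : ℝ) < m := by linarith
    have hratio : (1 + ((k + 1 : ℕ) : ℝ) / m) ^ m ≤ 3 * (1 + (k : ℝ) / m) ^ m := by
      calc (1 + ((k + 1 : ℕ) : ℝ) / m) ^ m
          ≤ ((1 + 1 / (m : ℝ)) * (1 + (k : ℝ) / m)) ^ m := by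
            gcongr
            have : 0 ≤ 1 / (m : ℝ) * (k / m) := by positivity
            push_cast
            rw [add_div]
            linarith
        _ = (1 + 1 / (m : ℝ)) ^ m * (1 + (k : ℝ) / m) ^ m := mul_pow _ _ _
        _ ≤ 3 * (1 + (k : ℝ) / m) ^ m := by
            gcongr
            linarith [one_add_inv_pow_le_exp_one m, Real.exp_one_lt_d9]
    have hchoose : (m.choose (k + 1) : ℝ) * (k + 1) = m.choose k * (m - k) := by
      have := Nat.choose_succ_right_eq m k
      rw [← Nat.cast_sub (by omega)]
      exact_mod_cast this
    refine hratio.trans ((mul_le_mul_of_nonneg_left ih (by norm_num)).trans ?_)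
    have key : (m.choose (k + 1) : ℝ) * (2 * (((k + 1 : ℕ) : ℝ) / m)) ^ (k + 1) =
        m.choose k * (2 / m) ^ k * (((k : ℝ) + 1) ^ k * (2 * ((m - k) / m))) := by
      push_cast
      calc _ = ((m.choose (k + 1) : ℝ) * (k + 1)) * (2 / m) ^ k * ((k + 1) ^ k * (2 / m)) := by
            rw [show 2 * (((k : ℝ) + 1) / m) = 2 / m * (k + 1) by ring, mul_pow]
            ring
        _ = _ := by
            rw [hchoose]
            ring
    have hfrac : 3 / 4 ≤ ((m : ℝ) - k) / m := by
      rw [le_div_iff₀ hm0]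
      linarith
    rw [key, show 2 * ((k : ℝ) / m) = 2 / m * k by ring, mul_pow]
    calc 3 * ((m.choose k : ℝ) * ((2 / m) ^ k * (k : ℝ) ^ k))
        = m.choose k * (2 / m) ^ k * (3 * (k : ℝ) ^ k) := by ring
      _ ≤ m.choose k * (2 / m) ^ k * ((9 / 4 * (k : ℝ) ^ k) * (2 * (3 / 4))) := by
          refine mul_le_mul_of_nonneg_left ?_ (by positivity)
          have : (0 : ℝ) ≤ (k : ℝ) ^ k := by positivity
          linarith
      _ ≤ _ := by
          gcongr
          exact nine_fourths_mul_pow_le hk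

theorem one_add_pow_ceil_le {ε : ℝ} (hε0 : 0 < ε) (hε : ε ≤ 1 / 4) {k : ℕ} (hk : 2 ≤ k) :
    (1 + ε) ^ ⌈(k : ℝ) / ε⌉₊ ≤ (⌈(k : ℝ) / ε⌉₊.choose k : ℝ) * (2 * ε) ^ k := by
  have hk0 : (2 : ℝ) ≤ k := by exact_mod_cast hk
  have hlo := Nat.le_ceil ((k : ℝ) / ε)
  have hhi := Nat.ceil_lt_add_one (a := (k : ℝ) / ε) (by positivity)
  set m := ⌈(k : ℝ) / ε⌉₊
  rw [div_le_iff₀ hε0] at hlo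
  have hhi' : ((m : ℝ) - 1) * ε < k := by
    rw [← lt_div_iff₀ hε0]
    linarith
  have hm4 : 4 * (k : ℝ) ≤ m := by nlinarith
  have hm0 : (0 : ℝ) < m := by linarith
  obtain ⟨r, hr⟩ : ∃ r, r = (k : ℝ) / m := ⟨_, rfl⟩
  have hr0 : 0 < r := hr ▸ by positivity
  have hmr : (m : ℝ) * r = k := by rw [hr]; field_simp
  have hrε : r ≤ ε := by
    rw [hr, div_le_iff₀ hm0]
    linarith
  have hεr : ε ≤ r * (1 + r) := by
    have h1 : 1 ≤ (m - 1) * r := by nlinarith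
    have h2 : (m - 1) * ε ≤ (m - 1) * (r * (1 + r)) := by nlinarith
    exact le_of_mul_le_mul_left h2 (by linarith)
  have hbase : (1 + r) ^ m ≤ m.choose k * (2 * r) ^ k := by
    rw [hr]
    exact one_add_div_pow_le hk (by exact_mod_cast hm4)
  have hgrow : (1 + ε) ^ m ≤ (1 + r) ^ m * (ε / r) ^ k := by
    have h1 : (1 + ε) / (1 + r) ≤ Real.exp ((ε - r) / (1 + r)) := by
      refine le_trans (le_of_eq ?_) (Real.add_one_le_exp _)
      field_simp
      ring
    have h2 : Real.exp ((ε - r) / (r * (1 + r))) ≤ ε / r := by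
      rw [← Real.le_log_iff_exp_le (by positivity)]
      refine le_trans ?_ (Real.one_sub_inv_le_log_of_pos (by positivity))
      rw [inv_div, one_sub_div hε0.ne']
      gcongr
    calc (1 + ε) ^ m = (1 + r) ^ m * ((1 + ε) / (1 + r)) ^ m := by
          rw [← mul_pow]
          congr 1
          field_simp
      _ ≤ (1 + r) ^ m * Real.exp ((ε - r) / (1 + r)) ^ m := by gcongr
      _ = (1 + r) ^ m * Real.exp ((ε - r) / (r * (1 + r))) ^ k := by
          rw [← Real.exp_nat_mul, ← Real.exp_nat_mul, ← hmr]
          congr 2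
          field_simp
      _ ≤ _ := by gcongr
  calc (1 + ε) ^ m ≤ (1 + r) ^ m * (ε / r) ^ k := hgrow
    _ ≤ m.choose k * (2 * r) ^ k * (ε / r) ^ k := by gcongr
    _ = m.choose k * (2 * ε) ^ k := by
        rw [mul_assoc, ← mul_pow]
        congr 2
        field_simp

/-- A self-regular set has an autocorrelation that is close to `1` in `k`-norm. -/
theorem sum_starC_dens_sub_one_pow_le {G : Type*} [AddCommGroup G] [Fintype G] [DecidableEq G]
    {A : Finset G} (hA : A.Nonempty) {ε : ℝ} (hε0 : 0 < ε) (hε : ε ≤ 1 / 4) {k : ℕ} (hk : 2 ≤ k)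
    (hAA : knorm ⌈(k : ℝ) / ε⌉₊ (starC (dens A) (dens A)) ≤ 1 + ε) :
    ∑ x, (starC (dens A) (dens A) x - 1) ^ k ≤ (2 * ε) ^ k * Fintype.card G := by
  have hk0 : (2 : ℝ) ≤ k := by exact_mod_cast hk
  have hnum := one_add_pow_ceil_le hε0 hε hk
  have hkm : k ≤ ⌈(k : ℝ) / ε⌉₊ := by
    refine Nat.cast_le.mp (le_trans ?_ (Nat.le_ceil ((k : ℝ) / ε)))
    rw [le_div_iff₀ hε0]
    nlinarith
  set m := ⌈(k : ℝ) / ε⌉₊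
  rw [knorm_le_iff (by omega) _ (by positivity)] at hAA
  have hmom (j : ℕ) : 0 ≤ ∑ x, (starC (dens A) (dens A) x - 1) ^ j := by
    have := sum_starC_self_pow_nonneg (fun y => dens A y - 1) j
    simpa only [starC_dens_sub_one hA] using this
  have hchoose : (0 : ℝ) < m.choose k := by exact_mod_cast Nat.choose_pos hkm
  refine le_of_mul_le_mul_left ?_ hchoose
  calc (m.choose k : ℝ) * ∑ x, (starC (dens A) (dens A) x - 1) ^ k
      ≤ ∑ j ∈ Finset.range (m + 1),
          (m.choose j : ℝ) * ∑ x, (starC (dens A) (dens A) x - 1) ^ j :=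
        Finset.single_le_sum
          (f := fun j => (m.choose j : ℝ) * ∑ x, (starC (dens A) (dens A) x - 1) ^ j)
          (fun j _ => mul_nonneg (by positivity) (hmom j)) (Finset.mem_range.2 (by omega))
    _ = ∑ x, starC (dens A) (dens A) x ^ m := by
        simp_rw [Finset.mul_sum]
        rw [Finset.sum_comm]
        refine Finset.sum_congr rfl fun x _ => ?_
        conv_rhs => rw [← sub_add_cancel (starC (dens A) (dens A) x) 1, add_pow]
        exact Finset.sum_congr rfl fun j _ => by ring
    _ ≤ ∑ x, |starC (dens A) (dens A) x| ^ m :=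
        Finset.sum_le_sum fun x _ => (le_abs_self _).trans_eq (abs_pow _ _)
    _ ≤ (1 + ε) ^ m * Fintype.card G := hAA
    _ ≤ m.choose k * (2 * ε) ^ k * Fintype.card G := by gcongr
    _ = _ := mul_assoc _ _ _

/-- Hölder's inequality against the density function of a set of density at least `2 ^ (-k)`. -/
theorem abs_inn_dens_le {G : Type*} [Fintype G] [DecidableEq G] (F : G → ℝ) {k : ℕ} (hk : k ≠ 0)
    {C : Finset G} (hC : C.Nonempty)
    (hCG : (2 : ℝ) ^ (-(k : ℝ)) * (Fintype.card G : ℝ) ≤ C.card) :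
    |inn F (dens C)| ≤ 2 * knorm k F := by
  have : Nonempty G := ⟨hC.choose⟩
  have hN : (0 : ℝ) < Fintype.card G := by exact_mod_cast Fintype.card_pos
  have hC0 : (0 : ℝ) < C.card := by exact_mod_cast hC.card_pos
  have hF : 0 ≤ knorm k F := by unfold knorm; positivity
  have hinn : inn F (dens C) = (∑ x ∈ C, F x) / C.card := by
    simp only [inn, dens, mul_ite, mul_zero, Finset.sum_ite_mem, Finset.univ_inter,
      ← Finset.sum_mul]
    field_simp
  have hle := (knorm_le_iff hk F hF).1 le_rfl
  have hGC : (Fintype.card G : ℝ) ≤ 2 ^ k * C.card := by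
    rw [Real.rpow_neg zero_le_two, Real.rpow_natCast] at hCG
    rwa [inv_mul_le_iff₀ (by positivity)] at hCG
  rw [hinn, abs_div, Nat.abs_cast, div_le_iff₀ hC0]
  refine (Finset.abs_sum_le_sum_abs _ _).trans ?_
  refine le_of_pow_le_pow_left₀ hk (by positivity) ?_
  obtain ⟨n, rfl⟩ := Nat.exists_eq_succ_of_ne_zero hk
  have hjensen := pow_sum_div_card_le_sum_pow (s := C) (f := fun x => |F x|) (n := n)
    (fun _ _ => abs_nonneg _)
  rw [div_le_iff₀ (by positivity)] at hjensen
  calc (∑ x ∈ C, |F x|) ^ (n + 1)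
      ≤ (∑ x ∈ C, |F x| ^ (n + 1)) * C.card ^ n := hjensen
    _ ≤ (∑ x, |F x| ^ (n + 1)) * C.card ^ n := by
        gcongr
        exact Finset.subset_univ C
    _ ≤ (knorm (n + 1) F ^ (n + 1) * (2 ^ (n + 1) * C.card)) * C.card ^ n := by
        gcongr
        exact hle.trans (by gcongr)
    _ = _ := by
        rw [Nat.succ_eq_add_one]
        ring


/-- Strong two-sided bounds from self-regularity: if `‖A ⋆ A‖_m, ‖B ⋆ B‖_m ≤ 1 + ε` with
`m = ⌈k/ε⌉`, then `‖A * B − 1‖_k ≤ 2ε`, and `|⟨A * B, C⟩ − 1| ≤ 4ε` for all large `C`. -/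
theorem two_sided_bounds_from_self_regularity
    {G : Type*} [AddCommGroup G] [Fintype G] [DecidableEq G]
    (A B : Finset G) (hA : A.Nonempty) (hB : B.Nonempty)
    (ε : ℝ) (hε0 : 0 < ε) (hε : ε ≤ 1/4) (k : ℕ) (hk : 2 ≤ k) (hke : Even k)
    (hAA : knorm ⌈(k:ℝ)/ε⌉₊ (starC (dens A) (dens A)) ≤ 1 + ε)
    (hBB : knorm ⌈(k:ℝ)/ε⌉₊ (starC (dens B) (dens B)) ≤ 1 + ε) :
    knorm k (fun x => convC (dens A) (dens B) x - 1) ≤ 2 * ε ∧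
    ∀ C : Finset G, C.Nonempty → (2:ℝ) ^ (-(k:ℝ)) * (Fintype.card G : ℝ) ≤ C.card →
      |inn (convC (dens A) (dens B)) (dens C) - 1| ≤ 4 * ε := by
  have hk0 : k ≠ 0 := by omega
  have hN : (0 : ℝ) < Fintype.card G := by exact_mod_cast Fintype.card_pos
  have hmain : knorm k (fun x => convC (dens A) (dens B) x - 1) ≤ 2 * ε := by
    rw [knorm_le_iff hk0 _ (by positivity)]
    simp_rw [hke.pow_abs]
    have h := sum_convC_pow_sq_le (fun y => dens A y - 1) (fun y => dens B y - 1) k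
    simp only [convC_dens_sub_one hA hB, starC_dens_sub_one hA, starC_dens_sub_one hB] at h
    refine le_of_sq_le_sq ?_ (by positivity)
    rw [sq ((2 * ε) ^ k * _)]
    exact h.trans (mul_le_mul (sum_starC_dens_sub_one_pow_le hA hε0 hε hk hAA)
      (sum_starC_dens_sub_one_pow_le hB hε0 hε hk hBB)
      (Finset.sum_nonneg fun _ _ => hke.pow_nonneg _) (by positivity))
  refine ⟨hmain, fun C hC hCG => ?_⟩
  have hinn : inn (convC (dens A) (dens B)) (dens C) - 1 =
      inn (fun x => convC (dens A) (dens B) x - 1) (dens C) := by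
    simp only [inn, sub_mul, one_mul, Finset.sum_sub_distrib, sum_dens hC]
    rw [sub_div, div_self hN.ne']
  rw [hinn]
  linarith [abs_inn_dens_le (fun x => convC (dens A) (dens B) x - 1) hk0 hC hCG]
end
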